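/- arXiv:dg-ga/9708012 — 2 statements merged into one kernel-verified Lean document; each statement's English description precedes it below -/
import Mathlib

section
/- For all p, q ∈ Ω the inequality d̄_Ω(p,q) ≤ d_Ω(p,q) holds between the integrated Kobayashi–Royden pseudodistance and the Kobayashi pseudodistance. -/
open Metric Set Filter
open scoped ENNReal Topology

noncomputable section

abbrev Cn (n : ℕ) := EuclideanSpace ℂ (Fin n)

def IsAlmostComplexOn (n : ℕ) (Ω : Set (Cn n)) (J : Cn n → (Cn n →L[ℝ] Cn n)) : Prop :=
  ContDiffOn ℝ (⊤ : ℕ∞) J Ω ∧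
    ∀ x ∈ Ω, (J x).comp (J x) = -ContinuousLinearMap.id ℝ (Cn n)

def IsJHolomorphicOn (n : ℕ) (Ω : Set (Cn n)) (J : Cn n → (Cn n →L[ℝ] Cn n))
    (R : ℝ) (f : ℂ → Cn n) : Prop :=
  MapsTo f (ball (0:ℂ) R) Ω ∧
    ∀ z ∈ ball (0:ℂ) R, DifferentiableAt ℝ f z ∧
      ∀ ξ : ℂ, fderiv ℝ f z (Complex.I * ξ) = J (f z) (fderiv ℝ f z ξ)

def kobayashiRoyden (n : ℕ) (Ω : Set (Cn n)) (J : Cn n → (Cn n →L[ℝ] Cn n))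
    (p v : Cn n) : ℝ≥0∞ :=
  sInf {c : ℝ≥0∞ | ∃ r : ℝ, 0 < r ∧
    (∃ f : ℂ → Cn n, IsJHolomorphicOn n Ω J 1 f ∧ f 0 = p ∧ fderiv ℝ f 0 1 = r • v) ∧
    c = ENNReal.ofReal (1 / r)}

/-- The inverse hyperbolic tangent, `arctanh x = ½ log((1 + x)/(1 - x))`. -/
def arctanh (x : ℝ) : ℝ := (1 / 2) * Real.log ((1 + x) / (1 - x))

/-- The Poincaré distance on the unit disc. -/
def poincareDist (z w : ℂ) : ℝ :=
  arctanh (‖z - w‖ / ‖1 - (starRingEnd ℂ) z * w‖)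

/-- The Kobayashi pseudodistance `d_Ω(p, q)` of the almost complex manifold `(Ω, J)`. -/
def kobayashiDist (n : ℕ) (Ω : Set (Cn n)) (J : Cn n → (Cn n →L[ℝ] Cn n))
    (p q : Cn n) : ℝ≥0∞ :=
  sInf {c : ℝ≥0∞ | ∃ m : ℕ, ∃ z w : Fin (m + 1) → ℂ, ∃ f : Fin (m + 1) → ℂ → Cn n,
    (∀ k, z k ∈ ball (0:ℂ) 1 ∧ w k ∈ ball (0:ℂ) 1 ∧ IsJHolomorphicOn n Ω J 1 (f k)) ∧
    f 0 (z 0) = p ∧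
    (∀ k : Fin m, f k.castSucc (w k.castSucc) = f k.succ (z k.succ)) ∧
    f (Fin.last m) (w (Fin.last m)) = q ∧
    c = ENNReal.ofReal (∑ k, poincareDist (z k) (w k))}

/-- `γ` is a piecewise continuously differentiable path in `Ω`, parametrized by `[0,1]`. -/
def IsPiecewiseC1PathIn (n : ℕ) (Ω : Set (Cn n)) (γ : ℝ → Cn n) : Prop :=
  ContinuousOn γ (Icc (0:ℝ) 1) ∧ MapsTo γ (Icc (0:ℝ) 1) Ω ∧
    ∃ (k : ℕ) (t : Fin (k + 1) → ℝ), StrictMono t ∧ t 0 = 0 ∧ t (Fin.last k) = 1 ∧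
      ∀ i : Fin k, ContDiffOn ℝ 1 γ (Icc (t i.castSucc) (t i.succ))

/-- The Kobayashi–Royden length `∫₀¹ F_Ω(γ(t), γ′(t)) dt` of a path. -/
def kobayashiRoydenLength (n : ℕ) (Ω : Set (Cn n)) (J : Cn n → (Cn n →L[ℝ] Cn n))
    (γ : ℝ → Cn n) : ℝ≥0∞ :=
  ∫⁻ t in Icc (0:ℝ) 1, kobayashiRoyden n Ω J (γ t) (deriv γ t)

/-- The integrated Kobayashi–Royden pseudodistance `d̄_Ω(p, q)`. -/
def integratedKRDist (n : ℕ) (Ω : Set (Cn n)) (J : Cn n → (Cn n →L[ℝ] Cn n))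
    (p q : Cn n) : ℝ≥0∞ :=
  ⨅ γ : {γ : ℝ → Cn n // IsPiecewiseC1PathIn n Ω γ ∧ γ 0 = p ∧ γ 1 = q},
    kobayashiRoydenLength n Ω J γ

section KRReg

variable {E : Type*} [NormedAddCommGroup E] [NormedSpace ℝ E]

/-- local data of a J-holomorphic curve -/
structure JLoc (D : Set ℂ) (f : ℂ → E) (j : ℂ → (E →L[ℝ] E)) (K L : ℝ) : Prop where
  hopen : IsOpen D
  hdiff : ∀ z ∈ D, DifferentiableAt ℝ f z
  hhol : ∀ z ∈ D, ∀ ξ : ℂ, fderiv ℝ f z (Complex.I * ξ) = j z (fderiv ℝ f z ξ)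
  hsq : ∀ z ∈ D, ∀ v, j z (j z v) = -v
  hK : ∀ z ∈ D, ‖j z‖ ≤ K
  hK1 : 0 ≤ K
  hL : ∀ z ∈ D, ∀ w ∈ D, ‖j z - j w‖ ≤ L * ‖f z - f w‖
  hL0 : 0 ≤ L

theorem JLoc.mono {D D' : Set ℂ} {f : ℂ → E} {j : ℂ → (E →L[ℝ] E)} {K L : ℝ}
    (h : JLoc D f j K L) (hD : IsOpen D') (hs : D' ⊆ D) : JLoc D' f j K L :=
  ⟨hD, fun z hz => h.hdiff z (hs hz), fun z hz => h.hhol z (hs hz), fun z hz => h.hsq z (hs hz),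
    fun z hz => h.hK z (hs hz), h.hK1, fun z hz w hw => h.hL z (hs hz) w (hs hw), h.hL0⟩

def uu (θ : ℝ) : ℂ := Complex.exp (θ * Complex.I)

theorem norm_uu (θ : ℝ) : ‖uu θ‖ = 1 := Complex.norm_exp_ofReal_mul_I θ

theorem uu_eq (θ : ℝ) : uu θ = (Real.cos θ) + Complex.I * (Real.sin θ) := by
  unfold uu
  rw [Complex.exp_mul_I, Complex.ofReal_cos, Complex.ofReal_sin]; ring

theorem continuous_uu : Continuous uu := by unfold uu; fun_prop

theorem hasDerivAt_uu (θ : ℝ) : HasDerivAt uu (Complex.I * uu θ) θ := by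
  unfold uu
  have h1 : HasDerivAt (fun t : ℝ => (t : ℂ) * Complex.I) (1 * Complex.I) θ :=
    (Complex.ofRealCLM.hasDerivAt).mul_const _
  have := h1.cexp
  convert this using 1; ring

def PP (A : E →L[ℝ] E) (θ : ℝ) (v : E) : E := Real.cos θ • v - Real.sin θ • A v

theorem norm_PP_le (A : E →L[ℝ] E) {K : ℝ} (hA : ‖A‖ ≤ K) (θ : ℝ) (v : E) :
    ‖PP A θ v‖ ≤ (1 + K) * ‖v‖ := by
  unfold PP
  have h1 : ‖Real.cos θ • v‖ ≤ ‖v‖ := by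
    rw [norm_smul, Real.norm_eq_abs]
    exact mul_le_of_le_one_left (norm_nonneg _) (Real.abs_cos_le_one θ)
  have h2 : ‖Real.sin θ • A v‖ ≤ K * ‖v‖ := by
    rw [norm_smul, Real.norm_eq_abs]
    exact (mul_le_of_le_one_left (norm_nonneg _) (Real.abs_sin_le_one θ)).trans
      (A.le_of_opNorm_le hA v)
  calc _ ≤ _ := norm_sub_le _ _
    _ ≤ _ := by linarith

theorem PP_continuous (A : E →L[ℝ] E) {g : ℝ → E} (hg : Continuous g) :
    Continuous (fun θ => PP A θ (g θ)) :=
  (Real.continuous_cos.smul hg).sub (Real.continuous_sin.smul (A.continuous.comp hg))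

theorem PP_add (A : E →L[ℝ] E) (θ : ℝ) (v w : E) : PP A θ (v + w) = PP A θ v + PP A θ w := by
  simp only [PP, map_add, smul_add]; abel

theorem PP_sub (A : E →L[ℝ] E) (θ : ℝ) (v w : E) : PP A θ (v - w) = PP A θ v - PP A θ w := by
  simp only [PP, map_sub, smul_sub]; abel

theorem PP_smul (A : E →L[ℝ] E) (θ c : ℝ) (v : E) : PP A θ (c • v) = c • PP A θ v := by
  simp only [PP, map_smul, smul_sub]; rw [smul_comm c, smul_comm c]

theorem PP_hol {A : E →L[ℝ] E} (hA : ∀ v, A (A v) = -v) (T : ℂ →L[ℝ] E)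
    (hT : ∀ ξ, T (Complex.I * ξ) = A (T ξ)) (θ : ℝ) : PP A θ (T (uu θ)) = T 1 := by
  have e1 : T (uu θ) = Real.cos θ • T 1 + Real.sin θ • A (T 1) := by
    rw [uu_eq, map_add, hT]
    have (x : ℝ) : T (x : ℂ) = x • T 1 := by
      rw [← map_smul]; simp
    rw [this, this, map_smul]
  rw [e1]
  simp only [PP, map_add, map_smul, hA, smul_add, smul_smul, smul_neg]
  have := Real.sin_sq_add_cos_sq θ
  rw [mul_comm (Real.sin θ) (Real.cos θ)]
  have e : T 1 = (Real.cos θ * Real.cos θ) • T 1 + (Real.sin θ * Real.sin θ) • T 1 := by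
    rw [← add_smul, show Real.cos θ * Real.cos θ + Real.sin θ * Real.sin θ = 1 by nlinarith, one_smul]
  conv_rhs => rw [e]
  abel

/-- the averaged difference quotient -/
def bb (f : ℂ → E) (j : ℂ → (E →L[ℝ] E)) (z₀ : ℂ) (ρ : ℝ) : E :=
  ρ⁻¹ • ∫ θ in (0:ℝ)..(2 * Real.pi), PP (j z₀) θ (f (z₀ + ρ * uu θ) - f z₀)

theorem norm_bb_le {f : ℂ → E} {j : ℂ → (E →L[ℝ] E)} {z₀ : ℂ} {r o K : ℝ} (hr : 0 < r)
    (hK : ‖j z₀‖ ≤ K) (hK1 : 0 ≤ K)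
    (ho : ∀ θ : ℝ, ‖f (z₀ + r * uu θ) - f z₀‖ ≤ o) :
    ‖bb f j z₀ r‖ ≤ 2 * Real.pi * ((1 + K) * o / r) := by
  unfold bb
  rw [norm_smul, norm_inv, Real.norm_eq_abs, abs_of_pos hr]
  have := intervalIntegral.norm_integral_le_of_norm_le_const (a := 0) (b := 2 * Real.pi)
    (f := fun θ => PP (j z₀) θ (f (z₀ + r * uu θ) - f z₀)) (C := (1 + K) * o)
    (fun θ _ => (norm_PP_le _ hK θ _).trans (mul_le_mul_of_nonneg_left (ho θ) (by linarith)))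
  rw [sub_zero, abs_of_pos Real.two_pi_pos] at this
  calc _ ≤ r⁻¹ * ((1 + K) * o * (2 * Real.pi)) := by gcongr
    _ = _ := by field_simp

theorem fderiv_norm_le_of_one {f : ℂ → E} {j : ℂ → (E →L[ℝ] E)} {z₀ : ℂ} {D : Set ℂ} {K L : ℝ}
    (h : JLoc D f j K L) (hz : z₀ ∈ D) :
    ‖fderiv ℝ f z₀‖ ≤ (1 + K) * ‖fderiv ℝ f z₀ 1‖ := by
  have hK1 := h.hK1
  refine ContinuousLinearMap.opNorm_le_bound _ (by positivity) fun ξ => ?_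
  have e : fderiv ℝ f z₀ ξ = ξ.re • fderiv ℝ f z₀ 1 + ξ.im • j z₀ (fderiv ℝ f z₀ 1) := by
    rw [← h.hhol _ hz, ← map_smul, ← map_smul, ← map_add]
    congr 1
    apply Complex.ext <;> simp
  rw [e]
  refine (norm_add_le _ _).trans ?_
  rw [norm_smul, norm_smul, Real.norm_eq_abs, Real.norm_eq_abs]
  have h1 := Complex.abs_re_le_norm ξ
  have h2 := Complex.abs_im_le_norm ξ
  have h3 := (j z₀).le_of_opNorm_le (h.hK z₀ hz) (fderiv ℝ f z₀ 1)
  calc _ ≤ ‖ξ‖ * ‖fderiv ℝ f z₀ 1‖ + ‖ξ‖ * (K * ‖fderiv ℝ f z₀ 1‖) := by gcongr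
    _ = _ := by ring

variable [CompleteSpace E]

theorem bb_tendsto {f : ℂ → E} {j : ℂ → (E →L[ℝ] E)} {z₀ : ℂ} {D : Set ℂ} {K L : ℝ}
    (h : JLoc D f j K L) (hz : z₀ ∈ D) :
    Tendsto (bb f j z₀) (𝓝[>] 0) (𝓝 ((2 * Real.pi) • fderiv ℝ f z₀ 1)) := by
  rw [Metric.tendsto_nhds]
  intro ε hε
  have hK1 := h.hK1
  set η := ε / (2 * (2 * Real.pi * (1 + K))) with hη
  have hηpos : 0 < η := by positivity
  have hd := (h.hdiff z₀ hz).hasFDerivAt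
  have hlo := hd.isLittleO.def hηpos
  rw [Metric.eventually_nhds_iff] at hlo
  obtain ⟨δ, hδ, hlo⟩ := hlo
  obtain ⟨s, hs, hsD⟩ := Metric.isOpen_iff.1 h.hopen z₀ hz
  have hcont : ContinuousOn f D := fun z hz => (h.hdiff z hz).continuousAt.continuousWithinAt
  filter_upwards [Ioo_mem_nhdsGT (show (0:ℝ) < min δ s by positivity)] with ρ hρ
  have hρ0 : 0 < ρ := hρ.1
  have hmem : ∀ θ, z₀ + ρ * uu θ ∈ D := fun θ => hsD (by
    simp [norm_uu, abs_of_pos hρ0]; exact lt_of_lt_of_le hρ.2 (min_le_right _ _))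
  have hci : Continuous (fun θ => f (z₀ + ρ * uu θ)) := by
    rw [continuous_iff_continuousAt]
    intro θ
    refine ContinuousAt.comp (f := fun θ => z₀ + ρ * uu θ) (h.hdiff _ (hmem θ)).continuousAt ?_
    have := continuous_uu
    fun_prop
  have e1 : (2 * Real.pi) • fderiv ℝ f z₀ 1 =
      ρ⁻¹ • ∫ θ in (0:ℝ)..(2 * Real.pi), PP (j z₀) θ (fderiv ℝ f z₀ (ρ * uu θ)) := by
    have : ∀ θ, PP (j z₀) θ (fderiv ℝ f z₀ (ρ * uu θ)) = ρ • fderiv ℝ f z₀ 1 := by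
      intro θ
      rw [show (ρ : ℂ) * uu θ = ρ • uu θ by simp, map_smul, PP_smul,
        PP_hol (h.hsq z₀ hz) _ (h.hhol z₀ hz)]
    simp only [this]
    rw [intervalIntegral.integral_const, smul_smul, smul_smul, sub_zero]
    congr 1; field_simp
  rw [dist_eq_norm, e1]
  unfold bb
  rw [← smul_sub, ← intervalIntegral.integral_sub]
  rotate_left
  · exact (PP_continuous _ (hci.sub continuous_const)).intervalIntegrable _ _
  · apply Continuous.intervalIntegrable
    have := continuous_uu
    unfold PP; fun_prop
  rw [norm_smul, norm_inv, Real.norm_eq_abs, abs_of_pos hρ0]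
  have := intervalIntegral.norm_integral_le_of_norm_le_const (a := 0) (b := 2 * Real.pi)
    (f := fun θ => PP (j z₀) θ (f (z₀ + ρ * uu θ) - f z₀)
      - PP (j z₀) θ (fderiv ℝ f z₀ (ρ * uu θ))) (C := (1 + K) * (η * ρ)) (by
    intro θ _
    rw [← PP_sub]
    refine (norm_PP_le _ (h.hK z₀ hz) θ _).trans (mul_le_mul_of_nonneg_left ?_ (by linarith))
    have := @hlo (z₀ + ρ * uu θ) (by
      simp [norm_uu, abs_of_pos hρ0]; exact lt_of_lt_of_le hρ.2 (min_le_left _ _))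
    simpa [norm_uu, abs_of_pos hρ0] using this)
  rw [sub_zero, abs_of_pos Real.two_pi_pos] at this
  calc _ ≤ ρ⁻¹ * ((1 + K) * (η * ρ) * (2 * Real.pi)) := by gcongr
    _ = ε / 2 := by rw [hη]; field_simp
    _ < ε := by linarith

variable [MeasurableSpace E] [BorelSpace E] [SecondCountableTopology E]

theorem bb_hasDerivAt {f : ℂ → E} {j : ℂ → (E →L[ℝ] E)} {z₀ : ℂ} {D : Set ℂ} {K L M R ρ : ℝ}
    (h : JLoc D f j K L) (hz : z₀ ∈ D) (hρ : 0 < ρ) (hρR : ρ < R) (hM0 : 0 ≤ M)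
    (hball : ball z₀ R ⊆ D) (hM : ∀ z ∈ ball z₀ R, ‖fderiv ℝ f z‖ ≤ M) :
    ∃ b' : E, HasDerivAt (bb f j z₀) b' ρ ∧
      ‖b'‖ ≤ 2 * Real.pi * ((1 + K) ^ 2 * L * M ^ 2) := by
  have hK1 := h.hK1
  have hL0 := h.hL0
  have hcu := continuous_uu
  have hmem : ∀ x : ℝ, x ∈ Ioo 0 R → ∀ θ, z₀ + x * uu θ ∈ ball z₀ R := fun x hx θ => by
    simp [norm_uu, abs_of_pos hx.1]; exact hx.2
  have hci : ∀ x : ℝ, x ∈ Ioo 0 R → Continuous (fun θ => f (z₀ + x * uu θ)) := by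
    intro x hx
    rw [continuous_iff_continuousAt]
    intro θ
    refine ContinuousAt.comp (f := fun θ => z₀ + x * uu θ)
      (h.hdiff _ (hball (hmem x hx θ))).continuousAt ?_
    fun_prop
  have hPc : ∀ x : ℝ, x ∈ Ioo 0 R → Continuous
      (fun θ => PP (j z₀) θ (f (z₀ + x * uu θ) - f z₀)) := by
    intro x hx
    exact PP_continuous _ ((hci x hx).sub continuous_const)
  have hTm : ∀ (x : ℝ) (c : ℂ), Measurable
      (fun θ : ℝ => fderiv ℝ f (z₀ + x * uu θ) (c * uu θ)) := by
    intro x c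
    have hcm : Measurable (fun θ : ℝ => z₀ + x * uu θ) := by
      apply Continuous.measurable; fun_prop
    have e : (fun θ : ℝ => fderiv ℝ f (z₀ + x * uu θ) (c * uu θ)) =
        fun θ : ℝ => Real.cos θ • fderiv ℝ f (z₀ + x * uu θ) c
          + Real.sin θ • fderiv ℝ f (z₀ + x * uu θ) (c * Complex.I) := by
      funext θ
      rw [← map_smul, ← map_smul, ← map_add, uu_eq]
      congr 1
      simp; ring
    rw [e]
    have m1 := (measurable_fderiv_apply_const ℝ f c).comp hcm
    have m2 := (measurable_fderiv_apply_const ℝ f (c * Complex.I)).comp hcm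
    exact (Real.measurable_cos.smul m1).add (Real.measurable_sin.smul m2)
  have hPm : ∀ (x : ℝ) (c : ℂ), Measurable
      (fun θ : ℝ => PP (j z₀) θ (fderiv ℝ f (z₀ + x * uu θ) (c * uu θ))) := by
    intro x c
    unfold PP
    exact (Real.measurable_cos.smul (hTm x c)).sub
      (Real.measurable_sin.smul ((j z₀).continuous.measurable.comp (hTm x c)))
  have hTb : ∀ x ∈ Ioo 0 R, ∀ (c : ℂ) (θ : ℝ),
      ‖fderiv ℝ f (z₀ + x * uu θ) (c * uu θ)‖ ≤ M * ‖c‖ := by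
    intro x hx c θ
    have := (fderiv ℝ f (z₀ + x * uu θ)).le_of_opNorm_le (hM _ (hmem x hx θ)) (c * uu θ)
    simpa [norm_uu] using this
  -- derivative under the integral
  have hD := intervalIntegral.hasDerivAt_integral_of_dominated_loc_of_deriv_le
    (μ := MeasureTheory.volume) (a := 0) (b := 2 * Real.pi)
    (F := fun (x : ℝ) θ => PP (j z₀) θ (f (z₀ + x * uu θ) - f z₀))
    (F' := fun (x : ℝ) θ => PP (j z₀) θ (fderiv ℝ f (z₀ + x * uu θ) (1 * uu θ)))
    (x₀ := ρ) (s := Ioo 0 R) (bound := fun _ => (1 + K) * (M * ‖(1:ℂ)‖))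
    (Ioo_mem_nhds hρ hρR)
    (by
      filter_upwards [Ioo_mem_nhds hρ hρR] with x hx
      exact (hPc x hx).aestronglyMeasurable)
    ((hPc ρ ⟨hρ, hρR⟩).intervalIntegrable _ _)
    (hPm ρ 1).aestronglyMeasurable
    (by
      refine Eventually.of_forall fun θ _ x hx => ?_
      exact (norm_PP_le _ (h.hK z₀ hz) θ _).trans
        (mul_le_mul_of_nonneg_left (hTb x hx 1 θ) (by linarith)))
    intervalIntegrable_const
    (by
      refine Eventually.of_forall fun θ _ x hx => ?_
      have hc : HasDerivAt (fun x : ℝ => z₀ + (x:ℂ) * uu θ) (1 * uu θ) x :=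
        ((Complex.ofRealCLM.hasDerivAt).mul_const _).const_add _
      have hg := ((h.hdiff _ (hball (hmem x hx θ))).hasFDerivAt.comp_hasDerivAt x hc).sub_const
        (f z₀)
      have hA := ((j z₀).hasFDerivAt.comp_hasDerivAt x hg)
      exact (hg.const_smul (Real.cos θ)).sub (hA.const_smul (Real.sin θ)))
  obtain ⟨hint1, hD⟩ := hD
  -- integration by parts
  have hQint : IntervalIntegrable
      (fun θ : ℝ => PP (j z₀) θ (j z₀ (fderiv ℝ f (z₀ + ρ * uu θ) (Complex.I * uu θ))))
      MeasureTheory.volume 0 (2 * Real.pi) := by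
    rw [intervalIntegrable_iff]
    refine MeasureTheory.Measure.integrableOn_of_bounded (M := (1 + K) * (K * (M * ‖Complex.I‖)))
      (by rw [uIoc_of_le Real.two_pi_pos.le, Real.volume_Ioc]; exact ENNReal.ofReal_ne_top) ?_ ?_
    · refine Measurable.aestronglyMeasurable ?_
      unfold PP
      have m := (j z₀).continuous.measurable.comp (hTm ρ Complex.I)
      exact (Real.measurable_cos.smul m).sub
        (Real.measurable_sin.smul ((j z₀).continuous.measurable.comp m))
    · refine Eventually.of_forall fun θ => ?_
      refine (norm_PP_le _ (h.hK z₀ hz) θ _).trans (mul_le_mul_of_nonneg_left ?_ (by linarith))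
      exact ((j z₀).le_of_opNorm_le (h.hK z₀ hz) _).trans
        (mul_le_mul_of_nonneg_left (hTb ρ ⟨hρ, hρR⟩ _ θ) hK1)
  have hQint' : IntervalIntegrable
      (fun θ : ℝ => ρ • PP (j z₀) θ (j z₀ (fderiv ℝ f (z₀ + ρ * uu θ) (Complex.I * uu θ))))
      MeasureTheory.volume 0 (2 * Real.pi) := hQint.smul ρ
  have hparts := intervalIntegral.integral_eq_sub_of_hasDerivAt (a := 0) (b := 2 * Real.pi)
    (f := fun θ : ℝ => PP (j z₀) θ (j z₀ (f (z₀ + ρ * uu θ) - f z₀)))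
    (f' := fun θ : ℝ => PP (j z₀) θ (f (z₀ + ρ * uu θ) - f z₀) +
      ρ • PP (j z₀) θ (j z₀ (fderiv ℝ f (z₀ + ρ * uu θ) (Complex.I * uu θ))))
    (by
      intro θ _
      have hc : HasDerivAt (fun θ : ℝ => z₀ + (ρ:ℂ) * uu θ) ((ρ:ℂ) * (Complex.I * uu θ)) θ :=
        ((hasDerivAt_uu θ).const_mul _).const_add _
      have hg := ((h.hdiff _ (hball (hmem ρ ⟨hρ, hρR⟩ θ))).hasFDerivAt.comp_hasDerivAt θ
        hc).sub_const (f z₀)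
      have hA := ((j z₀).hasFDerivAt.comp_hasDerivAt θ hg)
      have hAA := ((j z₀).hasFDerivAt.comp_hasDerivAt θ hA)
      have key := ((Real.hasDerivAt_cos θ).smul hA).sub ((Real.hasDerivAt_sin θ).smul hAA)
      refine key.congr_deriv ?_
      rw [show (ρ : ℂ) * (Complex.I * uu θ) = ρ • (Complex.I * uu θ) by simp, map_smul]
      simp only [PP, Function.comp, map_smul, smul_sub, h.hsq z₀ hz, smul_neg, neg_smul]
      rw [smul_comm ρ (Real.cos θ), smul_comm ρ (Real.sin θ)]
      abel)
    (((hPc ρ ⟨hρ, hρR⟩).intervalIntegrable _ _).add hQint')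
  have huu : uu (2 * Real.pi) = uu 0 := by simp [uu_eq]
  simp only [huu] at hparts
  rw [show ∀ v, PP (j z₀) (2 * Real.pi) v = PP (j z₀) 0 v by intro v; simp [PP], sub_self,
    intervalIntegral.integral_add ((hPc ρ ⟨hρ, hρR⟩).intervalIntegrable _ _) hQint',
    intervalIntegral.integral_smul] at hparts
  have hb := (hasDerivAt_inv hρ.ne').smul hD
  refine ⟨_, hb, ?_⟩
  have e2 : (∫ θ in (0:ℝ)..(2 * Real.pi), PP (j z₀) θ (f (z₀ + ρ * uu θ) - f z₀)) =
      - (ρ • ∫ θ in (0:ℝ)..(2 * Real.pi),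
        PP (j z₀) θ (j z₀ (fderiv ℝ f (z₀ + ρ * uu θ) (Complex.I * uu θ)))) :=
    eq_neg_of_add_eq_zero_left hparts
  rw [e2, smul_neg, neg_smul, smul_smul, neg_neg,
    show (ρ ^ 2)⁻¹ * ρ = ρ⁻¹ by field_simp, ← smul_add, ← intervalIntegral.integral_add hint1 hQint,
    norm_smul, norm_inv, Real.norm_eq_abs, abs_of_pos hρ]
  have := intervalIntegral.norm_integral_le_of_norm_le_const (a := 0) (b := 2 * Real.pi)
    (f := fun θ => PP (j z₀) θ (fderiv ℝ f (z₀ + ρ * uu θ) (1 * uu θ)) +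
      PP (j z₀) θ (j z₀ (fderiv ℝ f (z₀ + ρ * uu θ) (Complex.I * uu θ))))
    (C := (1 + K) * (K * ((L * (M * ρ)) * M))) (by
    intro θ _
    have hm := hmem ρ ⟨hρ, hρR⟩ θ
    rw [← PP_add]
    refine (norm_PP_le _ (h.hK z₀ hz) θ _).trans (mul_le_mul_of_nonneg_left ?_ (by linarith))
    have e3 : fderiv ℝ f (z₀ + ρ * uu θ) (1 * uu θ) +
        j z₀ (fderiv ℝ f (z₀ + ρ * uu θ) (Complex.I * uu θ)) =
        j z₀ ((j (z₀ + ρ * uu θ) - j z₀) (fderiv ℝ f (z₀ + ρ * uu θ) (1 * uu θ))) := by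
      rw [h.hhol _ (hball hm), _root_.sub_apply, map_sub, h.hsq z₀ hz, one_mul]
      abel
    rw [e3]
    refine ((j z₀).le_of_opNorm_le (h.hK z₀ hz) _).trans (mul_le_mul_of_nonneg_left ?_ hK1)
    have hz0 : z₀ ∈ ball z₀ R := mem_ball_self (hρ.trans hρR)
    have hmv := Convex.norm_image_sub_le_of_norm_fderiv_le
      (fun z hz => h.hdiff z (hball hz)) hM (convex_ball z₀ R) hz0 hm
    have hn : ‖z₀ + ρ * uu θ - z₀‖ = ρ := by simp [norm_uu, abs_of_pos hρ]
    rw [hn] at hmv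
    have hj : ‖j (z₀ + ρ * uu θ) - j z₀‖ ≤ L * (M * ρ) :=
      (h.hL _ (hball hm) _ hz).trans (mul_le_mul_of_nonneg_left hmv hL0)
    refine (ContinuousLinearMap.le_of_opNorm_le _ hj _).trans
      (mul_le_mul_of_nonneg_left ?_ (by positivity))
    have := hTb ρ ⟨hρ, hρR⟩ 1 θ
    rwa [norm_one, mul_one] at this)
  rw [sub_zero, abs_of_pos Real.two_pi_pos] at this
  calc _ ≤ ρ⁻¹ * ((1 + K) * (K * ((L * (M * ρ)) * M)) * (2 * Real.pi)) := by gcongr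
    _ = 2 * Real.pi * ((1 + K) * K * (L * M ^ 2)) := by field_simp
    _ ≤ 2 * Real.pi * ((1 + K) * (1 + K) * (L * M ^ 2)) := by gcongr; linarith
    _ = _ := by ring

theorem bb_approx {f : ℂ → E} {j : ℂ → (E →L[ℝ] E)} {z₀ : ℂ} {D : Set ℂ} {K L M R r : ℝ}
    (h : JLoc D f j K L) (hz : z₀ ∈ D) (hr : 0 < r) (hrR : r < R) (hM0 : 0 ≤ M)
    (hball : ball z₀ R ⊆ D) (hM : ∀ z ∈ ball z₀ R, ‖fderiv ℝ f z‖ ≤ M) :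
    ‖bb f j z₀ r - (2 * Real.pi) • fderiv ℝ f z₀ 1‖
      ≤ 2 * Real.pi * ((1 + K) ^ 2 * L * M ^ 2) * r := by
  have hK1 := h.hK1
  have hL0 := h.hL0
  have hlim : Tendsto (fun ρ => ‖bb f j z₀ r - bb f j z₀ ρ‖) (𝓝[>] 0)
      (𝓝 ‖bb f j z₀ r - (2 * Real.pi) • fderiv ℝ f z₀ 1‖) :=
    (tendsto_const_nhds.sub (bb_tendsto h hz)).norm
  refine le_of_tendsto hlim ?_
  filter_upwards [Ioo_mem_nhdsGT hr] with ρ hρ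
  have key := fun (x : ℝ) (hx : x ∈ Ioo 0 R) =>
    bb_hasDerivAt h hz hx.1 hx.2 hM0 hball hM
  choose! b' hb' hb'n using key
  have := Convex.norm_image_sub_le_of_norm_hasDerivWithin_le
    (fun x hx => (hb' x hx).hasDerivWithinAt) hb'n (convex_Ioo 0 R)
    (x := ρ) (y := r) ⟨hρ.1, hρ.2.trans hrR⟩ ⟨hr, hrR⟩
  refine this.trans ?_
  gcongr
  rw [Real.norm_eq_abs, abs_of_pos (by linarith [hρ.2])]
  linarith [hρ.1]

theorem point_est {f : ℂ → E} {j : ℂ → (E →L[ℝ] E)} {z₀ : ℂ} {D : Set ℂ} {K L M R r o : ℝ}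
    (h : JLoc D f j K L) (hz : z₀ ∈ D) (hr : 0 < r) (hrR : r < R) (hM0 : 0 ≤ M)
    (hball : ball z₀ R ⊆ D) (hM : ∀ z ∈ ball z₀ R, ‖fderiv ℝ f z‖ ≤ M)
    (ho : ∀ z ∈ ball z₀ R, ‖f z - f z₀‖ ≤ o) :
    ‖fderiv ℝ f z₀‖ ≤ (1 + K) ^ 3 * (o / r + L * M ^ 2 * r) := by
  have hK1 := h.hK1
  have hL0 := h.hL0
  have ho0 : 0 ≤ o := by
    have := ho z₀ (mem_ball_self (hr.trans hrR)); simpa using this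
  have h1 := bb_approx h hz hr hrR hM0 hball hM
  have h2 : ‖bb f j z₀ r‖ ≤ 2 * Real.pi * ((1 + K) * o / r) :=
    norm_bb_le hr (h.hK z₀ hz) hK1 (fun θ => ho _ (by simpa [norm_uu, abs_of_pos hr] using hrR))
  have h3 : ‖(2 * Real.pi) • fderiv ℝ f z₀ 1‖ ≤ 2 * Real.pi * ((1 + K) * o / r)
      + 2 * Real.pi * ((1 + K) ^ 2 * L * M ^ 2) * r := by
    have := norm_sub_norm_le ((2 * Real.pi) • fderiv ℝ f z₀ 1) (bb f j z₀ r)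
    rw [norm_sub_rev] at this
    linarith
  rw [norm_smul, Real.norm_eq_abs, abs_of_pos Real.two_pi_pos] at h3
  have h4 : ‖fderiv ℝ f z₀ 1‖ ≤ (1 + K) * o / r + (1 + K) ^ 2 * L * M ^ 2 * r := by
    refine le_of_mul_le_mul_left ?_ Real.two_pi_pos
    linarith
  refine (fderiv_norm_le_of_one h hz).trans ?_
  have h5 : (1 + K) * o / r ≤ (1 + K) ^ 2 * (o / r) := by
    rw [mul_div_assoc]
    apply mul_le_mul_of_nonneg_right _ (by positivity)
    nlinarith
  calc _ ≤ (1 + K) * ((1 + K) ^ 2 * (o / r) + (1 + K) ^ 2 * L * M ^ 2 * r) := by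
        gcongr; linarith
    _ = _ := by ring

set_option linter.unusedSectionVars false

theorem grad_est {f : ℂ → E} {j : ℂ → (E →L[ℝ] E)} {z₁ : ℂ} {D : Set ℂ} {K L R o B : ℝ}
    (h : JLoc D f j K L) (hR : 0 < R)
    (hball : ball z₁ R ⊆ D) (hB : ∀ z ∈ ball z₁ R, ‖fderiv ℝ f z‖ ≤ B)
    (ho : ∀ z ∈ ball z₁ R, ∀ w ∈ ball z₁ R, ‖f z - f w‖ ≤ o)
    (hsmall : 16 * ((1 + K) ^ 3) ^ 2 * L * o < 1) :
    R * ‖fderiv ℝ f z₁‖ ≤ 8 * (1 + K) ^ 3 * o := by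
  have hK1 := h.hK1
  have hL0 := h.hL0
  have hz1 : z₁ ∈ ball z₁ R := mem_ball_self hR
  have ho0 : 0 ≤ o := by simpa using ho z₁ hz1 z₁ hz1
  have hB0 : 0 ≤ B := (norm_nonneg _).trans (hB z₁ hz1)
  set C := (1 + K) ^ 3 with hC
  have hC0 : 0 < C := by positivity
  set T : Set ℝ := (fun z => (R - dist z z₁) * ‖fderiv ℝ f z‖) '' ball z₁ R with hT
  have hTb : BddAbove T := by
    refine ⟨R * B, ?_⟩
    rintro _ ⟨z, hz, rfl⟩
    have h1 := hB z hz
    have h2 : dist z z₁ < R := hz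
    have h3 : R - dist z z₁ ≤ R := by linarith [dist_nonneg (x := z) (y := z₁)]
    exact mul_le_mul h3 h1 (norm_nonneg _) hR.le
  set S := sSup T with hS
  have hle : ∀ z ∈ ball z₁ R, (R - dist z z₁) * ‖fderiv ℝ f z‖ ≤ S := fun z hz =>
    le_csSup hTb ⟨z, hz, rfl⟩
  have hSR : R * ‖fderiv ℝ f z₁‖ ≤ S := by simpa using hle z₁ hz1
  have hS0 : 0 ≤ S := le_trans (by positivity) hSR
  have main : ∀ θ : ℝ, 0 < θ → θ ≤ 1 / 2 → S ≤ 2 * C * o / θ + 2 * C * L * S ^ 2 * θ := by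
    intro θ hθ hθ2
    refine csSup_le ⟨_, z₁, hz1, rfl⟩ ?_
    rintro _ ⟨z, hz, rfl⟩
    set d := R - dist z z₁ with hd
    have hd0 : 0 < d := by have : dist z z₁ < R := hz; linarith
    have hθd : θ * d ≤ d / 2 := by nlinarith
    have hsub : ball z (θ * d) ⊆ ball z₁ R := by
      apply ball_subset_ball'; linarith
    have hp := point_est (M := 2 * S / d) (r := θ * d / 2) (R := θ * d) (o := o) h (hball hz)
      (by positivity) (by linarith [mul_pos hθ hd0]) (by positivity) (hsub.trans hball)
      (by
        intro w hw
        have hw2 : dist w z < θ * d := hw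
        have h1 := hle w (hsub hw)
        have h2 : d / 2 ≤ R - dist w z₁ := by
          have := dist_triangle w z z₁; linarith
        rw [le_div_iff₀ hd0]
        nlinarith [norm_nonneg (fderiv ℝ f w)])
      (fun w hw => ho w (hsub hw) z hz)
    show d * ‖fderiv ℝ f z‖ ≤ _
    calc d * ‖fderiv ℝ f z‖ ≤ d * (C * (o / (θ * d / 2) + L * (2 * S / d) ^ 2 * (θ * d / 2))) := by
          gcongr
      _ = _ := by field_simp
  refine hSR.trans ?_
  by_cases hc : 2 * C * L * S ≤ 1
  · have := main (1 / 2) (by norm_num) le_rfl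
    have h2 : 2 * C * L * S ^ 2 * (1 / 2) ≤ S / 2 := by nlinarith
    have h3 : 2 * C * o / (1 / 2) = 4 * C * o := by ring
    linarith
  · exfalso
    push Not at hc
    have hSp : 0 < S := by
      rcases hS0.eq_or_lt with h0 | h0
      · rw [← h0] at hc; norm_num at hc
      · exact h0
    have hLp : 0 < L := by
      rcases hL0.eq_or_lt with h0 | h0
      · rw [← h0] at hc; norm_num at hc
      · exact h0
    have := main (1 / (4 * C * L * S)) (by positivity) (by
      rw [div_le_div_iff₀ (by positivity) (by norm_num)]; linarith)
    have e1 : 2 * C * o / (1 / (4 * C * L * S)) = (8 * C ^ 2 * L * o) * S := by field_simp; ring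
    have e2 : 2 * C * L * S ^ 2 * (1 / (4 * C * L * S)) = S / 2 := by field_simp; ring
    rw [e1, e2] at this
    nlinarith

theorem bdd_of_compact {f : ℂ → E} {s : Set ℂ} (hs : IsCompact s)
    (hl : ∀ z ∈ s, ∃ B, ∀ᶠ w in 𝓝 z, ‖fderiv ℝ f w‖ ≤ B) :
    ∃ B, ∀ w ∈ s, ‖fderiv ℝ f w‖ ≤ B := by
  refine hs.induction_on (p := fun s => ∃ B, ∀ w ∈ s, ‖fderiv ℝ f w‖ ≤ B) ⟨0, by simp⟩ ?_ ?_ ?_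
  · rintro s t hst ⟨B, hB⟩; exact ⟨B, fun w hw => hB w (hst hw)⟩
  · rintro s t ⟨B, hB⟩ ⟨B', hB'⟩
    refine ⟨max B B', fun w hw => ?_⟩
    rcases hw with hw | hw
    · exact (hB w hw).trans (le_max_left _ _)
    · exact (hB' w hw).trans (le_max_right _ _)
  · intro z hz
    obtain ⟨B, hB⟩ := hl z hz
    exact ⟨_, mem_nhdsWithin_of_mem_nhds hB, B, fun w hw => hw⟩

theorem loc_bdd {f : ℂ → E} {j : ℂ → (E →L[ℝ] E)} {D : Set ℂ} {K L o : ℝ}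
    (h : JLoc D f j K L)
    (ho : ∀ z ∈ D, ∀ w ∈ D, ‖f z - f w‖ ≤ o)
    (hsmall : 16 * ((1 + K) ^ 3) ^ 2 * L * o < 1) :
    ∀ z ∈ D, ∃ B, ∀ᶠ w in 𝓝 z, ‖fderiv ℝ f w‖ ≤ B := by
  have hK1 := h.hK1
  have hL0 := h.hL0
  set G : Set ℂ := {z | ∃ B, ∀ᶠ w in 𝓝 z, ‖fderiv ℝ f w‖ ≤ B} with hG
  have hGo : IsOpen G := by
    rw [isOpen_iff_mem_nhds]
    rintro z ⟨B, hB⟩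
    filter_upwards [eventually_eventually_nhds.2 hB] with w hw
    exact ⟨B, hw⟩
  by_contra hcon
  simp only [not_forall] at hcon
  obtain ⟨e₀, he₀D, he₀⟩ := hcon
  set X : Set ℂ := D ∩ Gᶜ with hX
  have he₀X : e₀ ∈ X := ⟨he₀D, by rintro ⟨B, hB⟩; exact he₀ ⟨B, hB⟩⟩
  have hXlc : IsLocallyClosed X := h.hopen.isLocallyClosed.inter hGo.isClosed_compl.isLocallyClosed
  have : LocallyCompactSpace X := hXlc.locallyCompactSpace
  have : Nonempty X := ⟨⟨e₀, he₀X⟩⟩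
  have hfX : Continuous (fun z : X => f z) := by
    rw [continuous_iff_continuousAt]
    intro z
    exact ContinuousAt.comp (f := fun z : X => (z : ℂ)) (h.hdiff z z.2.1).continuousAt
      continuous_subtype_val.continuousAt
  set F : ℕ → Set X := fun m => {z : X | ∀ w ∈ D, dist w (z : ℂ) < 1 / ((m : ℝ) + 1) →
    ‖f w - f z‖ ≤ m * dist w (z : ℂ)} with hF
  have hFc : ∀ m, IsClosed (F m) := by
    intro m
    have : F m = ⋂ w ∈ D, ({z : X | 1 / ((m : ℝ) + 1) ≤ dist w (z : ℂ)} ∪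
        {z : X | ‖f w - f z‖ ≤ m * dist w (z : ℂ)}) := by
      ext z
      simp only [hF, mem_ofPred_eq, mem_iInter, mem_union]
      refine forall₂_congr fun w _ => ?_
      rw [imp_iff_not_or, not_lt]
    rw [this]
    refine isClosed_biInter fun w _ => IsClosed.union ?_ ?_
    · exact isClosed_le continuous_const (continuous_const.dist continuous_subtype_val)
    · exact isClosed_le (continuous_const.sub hfX).norm
        (continuous_const.mul (continuous_const.dist continuous_subtype_val))
  have hFu : ⋃ m, F m = univ := by
    rw [eq_univ_iff_forall]
    intro z
    have hO := (h.hdiff z z.2.1).hasFDerivAt.isBigO_sub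
    obtain ⟨c, hc⟩ := hO.bound
    obtain ⟨δ, hδ, hc⟩ := Metric.eventually_nhds_iff.1 hc
    obtain ⟨m1, hm1⟩ := exists_nat_gt c
    obtain ⟨m2, hm2⟩ := exists_nat_one_div_lt hδ
    rw [mem_iUnion]
    refine ⟨max m1 m2, fun w _ hw => ?_⟩
    have hw' : dist w (z : ℂ) < δ := by
      refine hw.trans_le (le_trans ?_ hm2.le)
      have : (m2 : ℝ) ≤ ((max m1 m2 : ℕ) : ℝ) := by exact_mod_cast le_max_right _ _
      gcongr
    have h1 := hc hw'
    rw [← dist_eq_norm w] at h1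
    refine h1.trans ?_
    have : (m1 : ℝ) ≤ ((max m1 m2 : ℕ) : ℝ) := by exact_mod_cast le_max_left _ _
    gcongr
    linarith
  obtain ⟨m, ⟨x, hx⟩⟩ := nonempty_interior_of_iUnion_of_closed hFc hFu
  obtain ⟨ε, hε, hxε⟩ := Metric.mem_nhds_iff.1 (mem_interior_iff_mem_nhds.1 hx)
  obtain ⟨ε', hε', hxD⟩ := Metric.isOpen_iff.1 h.hopen x x.2.1
  set e : ℂ := (x : ℂ) with he
  set δ := min (min ε ε') (1 / ((m : ℝ) + 1)) with hδ
  have hδ0 : 0 < δ := by positivity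
  have hδ1 : δ ≤ ε := (min_le_left _ _).trans (min_le_left _ _)
  have hδ2 : δ ≤ ε' := (min_le_left _ _).trans (min_le_right _ _)
  have hδ3 : δ ≤ 1 / ((m : ℝ) + 1) := min_le_right _ _
  have hE : ∀ y ∈ X, dist y e < δ → ∀ w ∈ D, dist w y < δ → ‖f w - f y‖ ≤ m * dist w y := by
    intro y hy hye w hw hwy
    have : (⟨y, hy⟩ : X) ∈ F m := hxε (by
      rw [mem_ball, Subtype.dist_eq]; exact hye.trans_le hδ1)
    exact this w hw (hwy.trans_le hδ3)
  have hm0 : (0 : ℝ) ≤ m := Nat.cast_nonneg m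
  have hballD : ball e δ ⊆ D := (ball_subset_ball hδ2).trans hxD
  have hC1 : (1 : ℝ) ≤ (1 + K) ^ 3 := one_le_pow₀ (by linarith)
  refine x.2.2 ⟨80 * (1 + K) ^ 3 * m, ?_⟩
  filter_upwards [ball_mem_nhds e (show (0:ℝ) < δ / 4 by positivity)] with z hz
  have hze : dist z e < δ / 4 := hz
  have hzD : z ∈ D := hballD (by rw [mem_ball]; linarith)
  by_cases hzX : z ∈ X
  · have : ‖fderiv ℝ f z‖ ≤ m := by
      refine (h.hdiff z hzD).hasFDerivAt.le_of_lip' hm0 ?_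
      filter_upwards [ball_mem_nhds z hδ0, h.hopen.mem_nhds hzD] with w hw hwD
      rw [← dist_eq_norm w]
      exact hE z hzX (by linarith) w hwD hw
    nlinarith
  · have hXne : X.Nonempty := ⟨e, x.2⟩
    set d := infDist z X with hd
    have hde : d ≤ dist z e := infDist_le_dist_of_mem x.2
    have hd0 : 0 < d := by
      have hzG : z ∈ G := by
        by_contra hh; exact hzX ⟨hzD, hh⟩
      rcases (infDist_nonneg (s := X) (x := z)).eq_or_lt with h0 | h0
      · exfalso
        have hcl : z ∈ closure X := (mem_closure_iff_infDist_zero hXne).2 h0.symm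
        have : closure X ⊆ Gᶜ := closure_minimal inter_subset_right hGo.isClosed_compl
        exact this hcl hzG
      · exact h0
    obtain ⟨y, hyX, hy⟩ := (infDist_lt_iff hXne).1 (show infDist z X < 2 * d by linarith)
    have hye : dist y e < δ := by
      have := dist_triangle_left y e z; linarith
    have hcb : closedBall z (d / 2) ⊆ D := by
      intro w hw
      apply hballD
      have hw : dist w z ≤ d / 2 := hw
      have := dist_triangle w z e
      rw [mem_ball]; linarith
    have hcG : ∀ w ∈ closedBall z (d / 2), w ∈ G := by
      intro w hw
      by_contra hh
      have h1 : d ≤ dist z w := infDist_le_dist_of_mem (⟨hcb hw, hh⟩ : w ∈ X)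
      have hw : dist w z ≤ d / 2 := hw
      rw [dist_comm] at h1; linarith
    obtain ⟨B, hB⟩ := bdd_of_compact (isCompact_closedBall z (d / 2)) hcG
    have hosc : ∀ w ∈ ball z (d / 2), ‖f w - f y‖ ≤ m * (5 / 2 * d) := by
      intro w hw
      have hw' : dist w z < d / 2 := hw
      have hwy : dist w y ≤ 5 / 2 * d := by
        have := dist_triangle w z y; linarith
      refine (hE y hyX hye w (hcb (ball_subset_closedBall hw)) (by linarith)).trans ?_
      gcongr
    have hsm : 16 * ((1 + K) ^ 3) ^ 2 * L * min o (5 * m * d) < 1 :=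
      lt_of_le_of_lt (by gcongr; exact min_le_left _ _) hsmall
    have hg := grad_est (R := d / 2) (z₁ := z) (o := min o (5 * m * d)) h (by positivity)
      (ball_subset_closedBall.trans hcb) (fun w hw => hB w (ball_subset_closedBall hw))
      (fun w hw w' hw' => le_min
        (ho w (hcb (ball_subset_closedBall hw)) w' (hcb (ball_subset_closedBall hw')))
        (by
          have h1 := hosc w hw
          have h2 := hosc w' hw'
          rw [norm_sub_rev] at h2
          have := norm_sub_le_norm_sub_add_norm_sub (f w) (f y) (f w')
          linarith)) hsm
    have h2 : d / 2 * ‖fderiv ℝ f z‖ ≤ d / 2 * (80 * (1 + K) ^ 3 * m) := by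
      refine hg.trans ?_
      calc 8 * (1 + K) ^ 3 * min o (5 * m * d) ≤ 8 * (1 + K) ^ 3 * (5 * m * d) := by
            gcongr; exact min_le_right _ _
        _ = d / 2 * (80 * (1 + K) ^ 3 * m) := by ring
    exact le_of_mul_le_mul_left h2 (by positivity)

theorem fx_continuousAt {f : ℂ → E} {j : ℂ → (E →L[ℝ] E)} {D : Set ℂ} {K L : ℝ} {z₀ : ℂ}
    (h : JLoc D f j K L) (hz : z₀ ∈ D) (hj : ContinuousAt j z₀)
    (hb : ∃ B, ∀ᶠ w in 𝓝 z₀, ‖fderiv ℝ f w‖ ≤ B) :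
    ContinuousAt (fun z => fderiv ℝ f z 1) z₀ := by
  have hK1 := h.hK1
  have hL0 := h.hL0
  have hcu := continuous_uu
  obtain ⟨M, hM⟩ := hb
  obtain ⟨s, hs, hsM⟩ := Metric.mem_nhds_iff.1 (inter_mem hM (h.hopen.mem_nhds hz))
  have hM0 : 0 ≤ M := (norm_nonneg _).trans (hsM (mem_ball_self hs)).1
  have hD : ball z₀ s ⊆ D := fun z hz => (hsM hz).2
  have hMb : ∀ z ∈ ball z₀ s, ‖fderiv ℝ f z‖ ≤ M := fun z hz => (hsM hz).1
  have hmem : ∀ z ∈ ball z₀ (s / 2), ∀ r ∈ Ioo 0 (s / 2), ∀ θ, z + (r : ℝ) * uu θ ∈ ball z₀ s := by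
    intro z hz r hr θ
    have h1 : dist (z + r * uu θ) z = r := by simp [dist_eq_norm, norm_uu, abs_of_pos hr.1]
    have h2 : dist z z₀ < s / 2 := hz
    have := dist_triangle (z + r * uu θ) z z₀
    rw [mem_ball]; linarith [hr.2]
  refine continuousAt_of_locally_uniform_approx_of_continuousAt fun u hu => ?_
  obtain ⟨ε, hε, hu⟩ := Metric.mem_uniformity_dist.1 hu
  set A := (1 + K) ^ 2 * L * M ^ 2 with hA
  have hA0 : 0 ≤ A := by positivity
  set r := min (s / 4) (ε / (2 * (A + 1))) with hr
  have hr0 : 0 < r := by positivity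
  have hrs : r < s / 2 := lt_of_le_of_lt (min_le_left _ _) (by linarith)
  have hrA : A * r < ε := by
    have h1 : r ≤ ε / (2 * (A + 1)) := min_le_right _ _
    rw [le_div_iff₀ (by positivity)] at h1
    nlinarith
  refine ⟨ball z₀ (s / 2), ball_mem_nhds _ (by positivity),
    fun z => (2 * Real.pi)⁻¹ • bb f j z r, ?_, ?_⟩
  · refine ContinuousAt.const_smul ?_ _
    unfold bb
    refine ContinuousAt.const_smul ?_ _
    refine intervalIntegral.continuousAt_of_dominated_interval
      (bound := fun _ => (1 + K) * (M * s)) ?_ ?_ intervalIntegrable_const ?_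
    · filter_upwards [ball_mem_nhds z₀ (show (0:ℝ) < s / 2 by positivity)] with z hz
      refine (PP_continuous _ (Continuous.sub ?_ continuous_const)).aestronglyMeasurable
      rw [continuous_iff_continuousAt]
      intro θ
      refine ContinuousAt.comp (f := fun θ => z + r * uu θ)
        (h.hdiff _ (hD (hmem z hz r ⟨hr0, hrs⟩ θ))).continuousAt ?_
      fun_prop
    · filter_upwards [ball_mem_nhds z₀ (show (0:ℝ) < s / 2 by positivity)] with z hz
      refine Eventually.of_forall fun θ _ => ?_
      have hz' : z ∈ ball z₀ s := ball_subset_ball (by linarith) hz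
      refine (norm_PP_le _ (h.hK z (hD hz')) θ _).trans
        (mul_le_mul_of_nonneg_left ?_ (by linarith))
      refine (Convex.norm_image_sub_le_of_norm_fderiv_le
        (fun z hz => h.hdiff z (hD hz)) hMb (convex_ball z₀ s) hz'
        (hmem z hz r ⟨hr0, hrs⟩ θ)).trans ?_
      have : ‖z + r * uu θ - z‖ = r := by simp [norm_uu, abs_of_pos hr0]
      rw [this]
      gcongr
      linarith
    · refine Eventually.of_forall fun θ _ => ?_
      have hm0 := hmem z₀ (mem_ball_self (by positivity)) r ⟨hr0, hrs⟩ θ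
      have c1 : ContinuousAt (fun z => f (z + r * uu θ)) z₀ :=
        ContinuousAt.comp (f := fun z => z + r * uu θ) (h.hdiff _ (hD hm0)).continuousAt
          (by fun_prop)
      have c2 : ContinuousAt (fun z => f (z + r * uu θ) - f z) z₀ :=
        c1.sub (h.hdiff _ hz).continuousAt
      exact (c2.const_smul (Real.cos θ)).sub ((hj.clm_apply c2).const_smul (Real.sin θ))
  · intro z hz
    have hz' : z ∈ ball z₀ s := ball_subset_ball (by linarith) hz
    have hsub : ball z (s / 2) ⊆ ball z₀ s := by
      apply ball_subset_ball'
      have : dist z z₀ < s / 2 := hz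
      linarith
    have hap := bb_approx (R := s / 2) h (hD hz') hr0 hrs hM0 (hsub.trans hD)
      (fun w hw => hMb w (hsub hw))
    apply hu
    rw [dist_comm, dist_eq_norm]
    have e1 : (2 * Real.pi)⁻¹ • bb f j z r - fderiv ℝ f z 1 =
        (2 * Real.pi)⁻¹ • (bb f j z r - (2 * Real.pi) • fderiv ℝ f z 1) := by
      rw [smul_sub, smul_smul, inv_mul_cancel₀ Real.two_pi_pos.ne', one_smul]
    rw [e1, norm_smul, norm_inv, Real.norm_eq_abs, abs_of_pos Real.two_pi_pos]
    refine lt_of_le_of_lt ?_ hrA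
    rw [inv_mul_le_iff₀ Real.two_pi_pos]
    linarith

theorem fderiv_continuousAt {f : ℂ → E} {j : ℂ → (E →L[ℝ] E)} {D : Set ℂ} {K L o : ℝ} {z₀ : ℂ}
    (h : JLoc D f j K L) (hz : z₀ ∈ D) (hj : ContinuousAt j z₀)
    (ho : ∀ z ∈ D, ∀ w ∈ D, ‖f z - f w‖ ≤ o)
    (hsmall : 16 * ((1 + K) ^ 3) ^ 2 * L * o < 1) :
    ContinuousAt (fderiv ℝ f) z₀ := by
  have hx := fx_continuousAt h hz hj (loc_bdd h ho hsmall z₀ hz)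
  have hy : ContinuousAt (fun z => j z (fderiv ℝ f z 1)) z₀ := hj.clm_apply hx
  have hc : ContinuousAt (fun z => Complex.reCLM.smulRight (fderiv ℝ f z 1)
      + Complex.imCLM.smulRight (j z (fderiv ℝ f z 1))) z₀ := by
    refine ContinuousAt.add ?_ ?_
    · exact ContinuousAt.comp (g := fun v => ContinuousLinearMap.smulRightL ℝ ℂ E Complex.reCLM v)
        (ContinuousLinearMap.continuous _).continuousAt hx
    · exact ContinuousAt.comp (g := fun v => ContinuousLinearMap.smulRightL ℝ ℂ E Complex.imCLM v)
        (ContinuousLinearMap.continuous _).continuousAt hy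
  refine hc.congr ?_
  filter_upwards [h.hopen.mem_nhds hz] with z hz
  ext ξ
  have e : fderiv ℝ f z ξ = ξ.re • fderiv ℝ f z 1 + ξ.im • j z (fderiv ℝ f z 1) := by
    rw [← h.hhol _ hz, ← map_smul, ← map_smul, ← map_add]
    congr 1
    apply Complex.ext <;> simp
  rw [e]; simp

end KRReg

theorem jhol_fderiv_continuousAt {n : ℕ} {Ω : Set (Cn n)} (hΩ : IsOpen Ω)
    {J : Cn n → (Cn n →L[ℝ] Cn n)} (hJ : IsAlmostComplexOn n Ω J) {f : ℂ → Cn n}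
    (hf : IsJHolomorphicOn n Ω J 1 f) {z₀ : ℂ} (hz : z₀ ∈ ball (0:ℂ) 1) :
    ContinuousAt (fderiv ℝ f) z₀ := by
  have hp : f z₀ ∈ Ω := hf.1 hz
  have hJd : ContDiffAt ℝ 1 J (f z₀) :=
    (hJ.1.contDiffAt (hΩ.mem_nhds hp)).of_le (by exact_mod_cast le_top)
  obtain ⟨L, t, ht, hLip⟩ := hJd.exists_lipschitzOnWith
  have hJc : ContinuousAt J (f z₀) := hJd.continuousAt
  have hfc : ContinuousAt f z₀ := (hf.2 z₀ hz).1.continuousAt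
  set K := ‖J (f z₀)‖ + 1 with hK
  have hK0 : 0 ≤ K := by positivity
  have hn : ∀ᶠ x in 𝓝 (f z₀), ‖J x‖ < K := hJc.norm.eventually_lt_const (by linarith)
  set o : ℝ := 1 / (16 * ((1 + K) ^ 3) ^ 2 * L + 1) with ho
  have hq : 0 ≤ 16 * ((1 + K) ^ 3) ^ 2 * (L : ℝ) := by positivity
  have ho0 : 0 < o := by positivity
  have hev : ∀ᶠ z in 𝓝 z₀, z ∈ ball (0:ℂ) 1 ∧ f z ∈ t ∧ ‖J (f z)‖ < K ∧
      f z ∈ ball (f z₀) (o / 2) := by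
    filter_upwards [isOpen_ball.mem_nhds hz, hfc ht, hfc.eventually hn,
      hfc (ball_mem_nhds _ (half_pos ho0))] with z h1 h2 h3 h4
    exact ⟨h1, h2, h3, h4⟩
  obtain ⟨D, hDs, hDo, hzD⟩ := _root_.mem_nhds_iff.1 hev
  have hloc : JLoc D f (fun z => J (f z)) K L :=
    { hopen := hDo
      hdiff := fun z hz => (hf.2 z (hDs hz).1).1
      hhol := fun z hz => (hf.2 z (hDs hz).1).2
      hsq := fun z hz v => by
        have := congrArg (fun T => T v) (hJ.2 (f z) (hf.1 (hDs hz).1))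
        simpa using this
      hK := fun z hz => (hDs hz).2.2.1.le
      hK1 := hK0
      hL := fun z hz w hw => by
        have := hLip.dist_le_mul _ (hDs hz).2.1 _ (hDs hw).2.1
        simpa [dist_eq_norm] using this
      hL0 := L.2 }
  refine fderiv_continuousAt (o := o) hloc hzD (ContinuousAt.comp (g := J) hJc hfc) ?_ ?_
  · intro z hz w hw
    have h1 : dist (f z) (f z₀) < o / 2 := (hDs hz).2.2.2
    have h2 : dist (f w) (f z₀) < o / 2 := (hDs hw).2.2.2
    rw [← dist_eq_norm]
    have := dist_triangle_right (f z) (f w) (f z₀)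
    linarith
  · rw [ho, mul_one_div, div_lt_one (by positivity)]
    linarith

theorem jhol_contDiffOn {n : ℕ} {Ω : Set (Cn n)} (hΩ : IsOpen Ω)
    {J : Cn n → (Cn n →L[ℝ] Cn n)} (hJ : IsAlmostComplexOn n Ω J) {f : ℂ → Cn n}
    (hf : IsJHolomorphicOn n Ω J 1 f) : ContDiffOn ℝ 1 f (ball (0:ℂ) 1) := by
  rw [show (1 : WithTop ℕ∞) = 0 + 1 from rfl, contDiffOn_succ_iff_fderiv_of_isOpen isOpen_ball]
  refine ⟨fun z hz => (hf.2 z hz).1.differentiableWithinAt, by simp, ?_⟩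
  rw [contDiffOn_zero]
  exact fun z hz => (jhol_fderiv_continuousAt hΩ hJ hf hz).continuousWithinAt

theorem jhol_comp {n : ℕ} {Ω : Set (Cn n)}
    {J : Cn n → (Cn n →L[ℝ] Cn n)} {f : ℂ → Cn n}
    (hf : IsJHolomorphicOn n Ω J 1 f) {φ : ℂ → ℂ}
    (hφ : ∀ z ∈ ball (0:ℂ) 1, DifferentiableAt ℂ φ z)
    (hm : MapsTo φ (ball (0:ℂ) 1) (ball (0:ℂ) 1)) :
    IsJHolomorphicOn n Ω J 1 (f ∘ φ) ∧ ∀ z ∈ ball (0:ℂ) 1, ∀ ξ : ℂ,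
      fderiv ℝ (f ∘ φ) z ξ = fderiv ℝ f (φ z) (deriv φ z * ξ) := by
  have key : ∀ z ∈ ball (0:ℂ) 1, DifferentiableAt ℝ (f ∘ φ) z ∧ ∀ ξ : ℂ,
      fderiv ℝ (f ∘ φ) z ξ = fderiv ℝ f (φ z) (deriv φ z * ξ) := by
    intro z hz
    have h1 := (hf.2 _ (hm hz)).1.hasFDerivAt
    have h2 := (hφ z hz).hasDerivAt.hasFDerivAt.restrictScalars ℝ
    have h3 := h1.comp z h2
    refine ⟨h3.differentiableAt, fun ξ => ?_⟩
    rw [h3.fderiv]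
    simp [mul_comm]
  refine ⟨⟨hf.1.comp hm, fun z hz => ⟨(key z hz).1, fun ξ => ?_⟩⟩, fun z hz => (key z hz).2⟩
  rw [(key z hz).2, (key z hz).2, Function.comp, ← (hf.2 _ (hm hz)).2]
  congr 1; ring

/-- Moebius maps of the disc -/
def mob (a ζ : ℂ) : ℂ := (ζ + a) / (1 + (starRingEnd ℂ) a * ζ)

theorem mob_den_ne {a ζ : ℂ} (ha : a ∈ ball (0:ℂ) 1) (hζ : ζ ∈ ball (0:ℂ) 1) :
    1 + (starRingEnd ℂ) a * ζ ≠ 0 := by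
  intro h0
  rw [mem_ball_zero_iff] at ha hζ
  have h1 : (starRingEnd ℂ) a * ζ = -1 := by linear_combination h0
  have h2 : ‖a‖ * ‖ζ‖ = 1 := by
    have := congrArg norm h1
    simpa using this
  nlinarith [norm_nonneg a, norm_nonneg ζ]

theorem mob_mem {a ζ : ℂ} (ha : a ∈ ball (0:ℂ) 1) (hζ : ζ ∈ ball (0:ℂ) 1) :
    mob a ζ ∈ ball (0:ℂ) 1 := by
  have hne := mob_den_ne ha hζ
  rw [mem_ball_zero_iff] at *
  unfold mob
  rw [norm_div, div_lt_one (norm_pos_iff.2 hne)]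
  refine lt_of_pow_lt_pow_left₀ 2 (norm_nonneg _) ?_
  have ha2 : ‖a‖ ^ 2 < 1 := by nlinarith [norm_nonneg a]
  have hζ2 : ‖ζ‖ ^ 2 < 1 := by nlinarith [norm_nonneg ζ]
  rw [← Complex.normSq_eq_norm_sq] at *
  rw [← Complex.normSq_eq_norm_sq]
  simp only [Complex.normSq_apply, Complex.add_re, Complex.add_im, Complex.mul_re, Complex.mul_im,
    Complex.conj_re, Complex.conj_im, Complex.one_re, Complex.one_im] at *
  nlinarith [mul_pos (sub_pos.2 ha2) (sub_pos.2 hζ2)]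

theorem mob_diff {a ζ : ℂ} (ha : a ∈ ball (0:ℂ) 1) (hζ : ζ ∈ ball (0:ℂ) 1) :
    DifferentiableAt ℂ (mob a) ζ := by
  unfold mob
  have := mob_den_ne ha hζ
  fun_prop (disch := assumption)

theorem mob_hasDerivAt_zero (a u : ℂ) :
    HasDerivAt (fun ζ => mob a (u * ζ)) ((1 - (starRingEnd ℂ) a * a) * u) 0 := by
  unfold mob
  have h1 : HasDerivAt (fun ζ : ℂ => u * ζ + a) u 0 := by
    simpa using ((hasDerivAt_id (0:ℂ)).const_mul u).add_const a
  have h2 : HasDerivAt (fun ζ : ℂ => 1 + (starRingEnd ℂ) a * (u * ζ))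
      ((starRingEnd ℂ) a * u) 0 := by
    simpa using (((hasDerivAt_id (0:ℂ)).const_mul u).const_mul ((starRingEnd ℂ) a)).const_add 1
  refine (h1.div h2 (by simp)).congr_deriv ?_
  simp; ring

theorem mob_inv {z w : ℂ} (hz : z ∈ ball (0:ℂ) 1) (hw : w ∈ ball (0:ℂ) 1) :
    mob z (mob (-z) w) = w := by
  have hz' : -z ∈ ball (0:ℂ) 1 := by simpa using hz
  have h1 := mob_den_ne hz' hw
  have h2 := mob_den_ne hz (mob_mem hz' hw)
  have h3 := mob_den_ne hz' (show z ∈ ball (0:ℂ) 1 from hz)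
  unfold mob at *
  rw [div_eq_iff h2]
  simp only [map_neg] at *
  generalize (starRingEnd ℂ) z = c at *
  have h4 : 1 - c * w ≠ 0 := by intro h; apply h1; linear_combination h
  have e1 : (w + -z) / (1 + -c * w) = (w - z) / (1 - c * w) := by congr 1 <;> ring
  rw [e1]
  have e2 : (w - z) / (1 - c * w) * (1 - c * w) = w - z := div_mul_cancel₀ _ h4
  refine mul_right_cancel₀ h4 ?_
  linear_combination (1 - c * w) * e2

theorem kr_zero {n : ℕ} {Ω : Set (Cn n)} {J : Cn n → (Cn n →L[ℝ] Cn n)} {p : Cn n}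
    (hp : p ∈ Ω) : kobayashiRoyden n Ω J p 0 = 0 := by
  refine le_antisymm ?_ bot_le
  refine ENNReal.le_of_forall_pos_le_add fun ε hε _ => ?_
  rw [zero_add]
  refine sInf_le ⟨1 / ε, by positivity, ⟨fun _ => p, ⟨fun _ _ => hp, fun z _ => ?_⟩, rfl, ?_⟩, ?_⟩
  · refine ⟨differentiableAt_const p, fun ξ => ?_⟩
    simp
  · simp
  · simp

theorem kr_le {n : ℕ} {Ω : Set (Cn n)} {J : Cn n → (Cn n →L[ℝ] Cn n)} {g : ℂ → Cn n}
    (hg : IsJHolomorphicOn n Ω J 1 g) {s : ℂ} {t c : ℝ} (hc : 0 < c)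
    (hts : (t : ℂ) * s ∈ ball (0:ℂ) 1) :
    kobayashiRoyden n Ω J (g (t * s)) (c • fderiv ℝ g (t * s) s) ≤
      ENNReal.ofReal (c * ‖s‖ / (1 - (t * ‖s‖) ^ 2)) := by
  rcases eq_or_ne s 0 with rfl | hs
  · simp only [map_zero, smul_zero]
    rw [kr_zero (hg.1 hts)]
    exact bot_le
  · have hs0 : 0 < ‖s‖ := norm_pos_iff.2 hs
    have hlt : 0 < 1 - (t * ‖s‖) ^ 2 := by
      rw [mem_ball_zero_iff, norm_mul, Complex.norm_real, Real.norm_eq_abs] at hts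
      have : (t * ‖s‖) ^ 2 = (|t| * ‖s‖) ^ 2 := by rw [mul_pow, mul_pow, sq_abs]
      rw [this]
      nlinarith [mul_nonneg (abs_nonneg t) hs0.le]
    set u : ℂ := s / ‖s‖ with hu
    have hun : ‖u‖ = 1 := by
      rw [hu, norm_div, Complex.norm_real, norm_norm, div_self hs0.ne']
    have hub : ∀ ζ ∈ ball (0:ℂ) 1, u * ζ ∈ ball (0:ℂ) 1 := by
      intro ζ hζ
      rw [mem_ball_zero_iff] at *
      rwa [norm_mul, hun, one_mul]
    obtain ⟨h1, h2⟩ := jhol_comp hg (φ := fun ζ => mob (t * s) (u * ζ))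
      (fun ζ hζ => by
        have := mob_diff hts (hub ζ hζ)
        exact DifferentiableAt.comp (g := mob (t * s)) ζ this (by fun_prop))
      (fun ζ hζ => mob_mem hts (hub ζ hζ))
    have h0 : mob (t * s) (u * 0) = t * s := by simp [mob]
    refine sInf_le ⟨(1 - (t * ‖s‖) ^ 2) / (c * ‖s‖), by positivity, ⟨_, h1, ?_, ?_⟩, ?_⟩
    · show g (mob (t * s) (u * 0)) = _
      rw [h0]
    · rw [h2 0 (by simp), (mob_hasDerivAt_zero _ _).deriv, h0, smul_smul, ← map_smul]
      congr 1
      have e : (starRingEnd ℂ) ((t:ℂ) * s) * (t * s) = (((t * ‖s‖) ^ 2 : ℝ) : ℂ) := by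
        rw [Complex.conj_mul']
        simp [mul_pow]
        rw [← Complex.ofReal_pow, sq_abs, Complex.ofReal_pow]
        exact Or.inl rfl
      rw [e, hu]
      have : (‖s‖ : ℂ) ≠ 0 := by exact_mod_cast hs0.ne'
      have hcc : (c : ℂ) ≠ 0 := by exact_mod_cast hc.ne'
      simp only [Complex.real_smul]
      push_cast
      field_simp
    · rw [one_div_div]

theorem arctanh_hasDerivAt {x : ℝ} (h1 : -1 < x) (h2 : x < 1) :
    HasDerivAt arctanh (1 / (1 - x ^ 2)) x := by
  unfold arctanh
  have hp : 0 < 1 + x := by linarith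
  have hm : 0 < 1 - x := by linarith
  have a1 : HasDerivAt (fun x : ℝ => 1 + x) 1 x := (hasDerivAt_id x).const_add 1
  have a2 : HasDerivAt (fun x : ℝ => 1 - x) (-1) x := (hasDerivAt_id x).const_sub 1
  have a3 := ((a1.div a2 hm.ne').log (div_pos hp hm).ne').const_mul (1 / 2 : ℝ)
  refine a3.congr_deriv ?_
  have : 1 - x ^ 2 ≠ 0 := by nlinarith
  simp only [Pi.div_apply]
  field_simp
  ring

theorem arctanh_nonneg {x : ℝ} (h0 : 0 ≤ x) (h1 : x < 1) : 0 ≤ arctanh x := by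
  unfold arctanh
  refine mul_nonneg (by norm_num) (Real.log_nonneg ?_)
  rw [le_div_iff₀ (by linarith)]; linarith

theorem piece_integral {σ N k : ℝ} (h0 : 0 ≤ σ) (h1 : σ < 1) (hN : 0 < N) :
    ∫⁻ t in Ioo (k / N) ((k + 1) / N), ENNReal.ofReal (N * σ / (1 - ((N * t - k) * σ) ^ 2))
      = ENNReal.ofReal (arctanh σ) := by
  have hab : k / N ≤ (k + 1) / N := by gcongr; linarith
  have hr : ∀ t ∈ Icc (k / N) ((k + 1) / N), 0 ≤ (N * t - k) * σ ∧ (N * t - k) * σ < 1 := by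
    intro t ht
    have e1 : k ≤ N * t := by have := ht.1; rw [div_le_iff₀ hN] at this; linarith
    have e2 : N * t ≤ k + 1 := by have := ht.2; rw [le_div_iff₀ hN] at this; linarith
    constructor
    · exact mul_nonneg (by linarith) h0
    · nlinarith
  have hcont : ContinuousOn (fun t : ℝ => N * σ / (1 - ((N * t - k) * σ) ^ 2))
      (Icc (k / N) ((k + 1) / N)) := by
    refine ContinuousOn.div (by fun_prop) (by fun_prop) fun t ht => ?_
    have := hr t ht
    nlinarith
  rw [MeasureTheory.setLIntegral_congr MeasureTheory.Ioo_ae_eq_Ioc,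
    ← MeasureTheory.ofReal_integral_eq_lintegral_ofReal,
    ← intervalIntegral.integral_of_le hab]
  · congr 1
    have := intervalIntegral.integral_eq_sub_of_hasDerivAt (a := k / N) (b := (k + 1) / N)
      (f := fun t => arctanh ((N * t - k) * σ))
      (f' := fun t : ℝ => N * σ / (1 - ((N * t - k) * σ) ^ 2))
      (by
        intro t ht
        rw [uIcc_of_le hab] at ht
        have h := hr t ht
        have d1 : HasDerivAt (fun t : ℝ => (N * t - k) * σ) (N * σ) t := by
          simpa using (((hasDerivAt_id t).const_mul N).sub_const k).mul_const σ
        refine ((arctanh_hasDerivAt (by linarith) h.2).comp t d1).congr_deriv ?_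
        ring)
      (by
        apply ContinuousOn.intervalIntegrable
        rwa [uIcc_of_le hab])
    rw [this]
    have e1 : N * ((k + 1) / N) - k = 1 := by field_simp; ring
    have e2 : N * (k / N) - k = 0 := by field_simp; ring
    simp only [e1, e2]
    simp [arctanh]
  · exact (hcont.integrableOn_Icc).mono_set Ioc_subset_Icc_self
  · refine (MeasureTheory.ae_restrict_iff' measurableSet_Ioc).2 (Eventually.of_forall fun t ht => ?_)
    have h := hr t (Ioc_subset_Icc_self ht)
    have : 0 ≤ 1 - ((N * t - k) * σ) ^ 2 := by nlinarith
    simp only [Pi.zero_apply]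
    positivity

theorem concat_path {E : Type*} (m : ℕ) (h : Fin (m + 1) → ℝ → E)
    (hc : ∀ k : Fin m, h k.castSucc 1 = h k.succ 0) :
    ∃ Γ : ℝ → E, ∀ k : Fin (m + 1), ∀ t ∈ Icc ((k : ℝ) / ((m : ℝ) + 1)) (((k : ℝ) + 1) / ((m : ℝ) + 1)),
      Γ t = h k (((m : ℝ) + 1) * t - k) := by
  have hN : (0 : ℝ) < (m : ℝ) + 1 := by positivity
  refine ⟨fun t => h ⟨min ⌊((m : ℝ) + 1) * t⌋₊ m, by omega⟩
    (((m : ℝ) + 1) * t - (min ⌊((m : ℝ) + 1) * t⌋₊ m : ℕ)), fun k t ht => ?_⟩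
  have e1 : (k : ℝ) ≤ ((m : ℝ) + 1) * t := by
    have := ht.1; rw [div_le_iff₀ hN] at this; linarith
  have e2 : ((m : ℝ) + 1) * t ≤ k + 1 := by
    have := ht.2; rw [le_div_iff₀ hN] at this; linarith
  have hk : (k : ℕ) ≤ m := by omega
  have fin : ∀ i : ℕ, ∀ hi : i < m + 1, i = k →
      h ⟨i, hi⟩ (((m : ℝ) + 1) * t - (i : ℕ)) = h k (((m : ℝ) + 1) * t - k) := by
    rintro i hi rfl; rfl
  rcases e2.lt_or_eq with e3 | e3
  · apply fin
    have : ⌊((m : ℝ) + 1) * t⌋₊ = k := by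
      rw [Nat.floor_eq_iff ((Nat.cast_nonneg _).trans e1)]
      exact ⟨e1, e3⟩
    rw [this]; omega
  · have hfl : ⌊((m : ℝ) + 1) * t⌋₊ = (k : ℕ) + 1 := by
      rw [e3]; exact_mod_cast Nat.floor_natCast ((k : ℕ) + 1)
    rcases hk.eq_or_lt with hkm | hkm
    · apply fin
      rw [hfl]; omega
    · have := hc ⟨k, hkm⟩
      have e4 : min ⌊((m : ℝ) + 1) * t⌋₊ m = (k : ℕ) + 1 := by rw [hfl]; omega
      have fin2 : ∀ i : ℕ, ∀ hi : i < m + 1, i = k + 1 →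
          h ⟨i, hi⟩ (((m : ℝ) + 1) * t - (i : ℕ)) = h k (((m : ℝ) + 1) * t - k) := by
        rintro i hi rfl
        rw [e3]
        push_cast
        rw [sub_self, add_sub_cancel_left]
        exact this.symm
      exact fin2 _ _ e4

theorem poincare_mob (z w : ℂ) : poincareDist z w = arctanh ‖mob (-z) w‖ := by
  unfold poincareDist mob
  rw [norm_div, norm_sub_rev]
  congr 3
  simp [sub_eq_add_neg]

theorem ts_mem {s : ℂ} (hs : s ∈ ball (0:ℂ) 1) {t : ℝ} (h0 : 0 ≤ t) (h1 : t ≤ 1) :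
    (t : ℂ) * s ∈ ball (0:ℂ) 1 := by
  rw [mem_ball_zero_iff] at *
  rw [norm_mul, Complex.norm_real, Real.norm_eq_abs, abs_of_nonneg h0]
  nlinarith [norm_nonneg s]

theorem chain_path {n : ℕ} {Ω : Set (Cn n)} (hΩ : IsOpen Ω)
    {J : Cn n → (Cn n →L[ℝ] Cn n)} (hJ : IsAlmostComplexOn n Ω J) (m : ℕ)
    (g : Fin (m + 1) → ℂ → Cn n) (s : Fin (m + 1) → ℂ)
    (hs : ∀ k, s k ∈ ball (0:ℂ) 1) (hg : ∀ k, IsJHolomorphicOn n Ω J 1 (g k))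
    (hc : ∀ k : Fin m, g k.castSucc (s k.castSucc) = g k.succ 0) :
    integratedKRDist n Ω J (g 0 0) (g (Fin.last m) (s (Fin.last m))) ≤
      ENNReal.ofReal (∑ k, arctanh ‖s k‖) := by
  obtain ⟨Γ, hΓ⟩ := concat_path m (fun k t => g k ((t : ℂ) * s k))
    (fun k => by simpa using hc k)
  have hN : (0 : ℝ) < (m : ℝ) + 1 := by positivity
  have hr : ∀ k : Fin (m + 1), ∀ t ∈ Icc ((k : ℝ) / ((m : ℝ) + 1)) (((k : ℝ) + 1) / ((m : ℝ) + 1)),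
      0 ≤ ((m : ℝ) + 1) * t - k ∧ ((m : ℝ) + 1) * t - k ≤ 1 := by
    intro k t ht
    have h1 := ht.1
    have h2 := ht.2
    rw [div_le_iff₀ hN] at h1
    rw [le_div_iff₀ hN] at h2
    constructor <;> linarith
  have hmem : ∀ k : Fin (m + 1), ∀ t ∈ Icc ((k : ℝ) / ((m : ℝ) + 1)) (((k : ℝ) + 1) / ((m : ℝ) + 1)),
      ((((m : ℝ) + 1) * t - k : ℝ) : ℂ) * s k ∈ ball (0:ℂ) 1 := fun k t ht =>
    ts_mem (hs k) (hr k t ht).1 (hr k t ht).2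
  have hcov : Icc (0:ℝ) 1 ⊆ ⋃ k : Fin (m + 1),
      Icc ((k : ℝ) / ((m : ℝ) + 1)) (((k : ℝ) + 1) / ((m : ℝ) + 1)) := by
    intro t ht
    rw [mem_iUnion]
    have hnn : 0 ≤ ((m : ℝ) + 1) * t := mul_nonneg hN.le ht.1
    refine ⟨⟨min ⌊((m : ℝ) + 1) * t⌋₊ m, by omega⟩, ?_, ?_⟩
    · rw [div_le_iff₀ hN, mul_comm t]
      refine le_trans ?_ (Nat.floor_le hnn)
      exact_mod_cast min_le_left _ _
    · rw [le_div_iff₀ hN, mul_comm t]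
      rcases le_total ⌊((m : ℝ) + 1) * t⌋₊ m with h | h
      · simp only [min_eq_left h]
        exact (Nat.lt_floor_add_one _).le
      · simp only [min_eq_right h]
        nlinarith [ht.2]
  have hsm : ∀ k : Fin (m + 1), ContDiffOn ℝ 1 Γ
      (Icc ((k : ℝ) / ((m : ℝ) + 1)) (((k : ℝ) + 1) / ((m : ℝ) + 1))) := by
    intro k
    refine ContDiffOn.congr ?_ (hΓ k)
    refine (jhol_contDiffOn hΩ hJ (hg k)).comp
      (f := fun t : ℝ => ((((m : ℝ) + 1) * t - k : ℝ) : ℂ) * s k) ?_ (hmem k)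
    refine ContDiff.contDiffOn ?_
    refine ContDiff.mul ?_ contDiff_const
    have hb : ContDiff ℝ 1 (fun t : ℝ => ((m : ℝ) + 1) * t - k) :=
      (contDiff_const.mul contDiff_id).sub contDiff_const
    exact Complex.ofRealCLM.contDiff.comp hb
  have hmap : MapsTo Γ (Icc (0:ℝ) 1) Ω := by
    intro t ht
    obtain ⟨k, hk⟩ := mem_iUnion.1 (hcov ht)
    rw [hΓ k t hk]
    exact (hg k).1 (hmem k t hk)
  have hcont : ContinuousOn Γ (Icc (0:ℝ) 1) := by
    refine ContinuousOn.mono ?_ hcov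
    exact (locallyFinite_of_finite _).continuousOn_iUnion (fun _ => isClosed_Icc)
      (fun k => (hsm k).continuousOn)
  have hpath : IsPiecewiseC1PathIn n Ω Γ := by
    refine ⟨hcont, hmap, m + 1, fun i => (i : ℝ) / ((m : ℝ) + 1), ?_, by simp, ?_, ?_⟩
    · intro i j hij
      have : (i : ℝ) < (j : ℝ) := by exact_mod_cast hij
      show (i : ℝ) / ((m : ℝ) + 1) < (j : ℝ) / ((m : ℝ) + 1)
      gcongr
    · simp only [Fin.val_last]
      push_cast
      exact div_self hN.ne'
    · intro i
      simpa using hsm i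
  have h0 : Γ 0 = g 0 0 := by
    have := hΓ 0 0 ⟨by simp, by simp; positivity⟩
    simpa using this
  have h1 : Γ 1 = g (Fin.last m) (s (Fin.last m)) := by
    have := hΓ (Fin.last m) 1 ⟨by
      rw [div_le_iff₀ hN]; simp, by rw [le_div_iff₀ hN]; simp⟩
    simpa using this
  refine (iInf_le _ (⟨Γ, hpath, h0, h1⟩ :
    {γ : ℝ → Cn n // IsPiecewiseC1PathIn n Ω γ ∧ γ 0 = g 0 0 ∧
      γ 1 = g (Fin.last m) (s (Fin.last m))})).trans ?_
  show kobayashiRoydenLength n Ω J Γ ≤ _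
  unfold kobayashiRoydenLength
  refine (MeasureTheory.lintegral_mono_set hcov).trans ?_
  refine (MeasureTheory.lintegral_iUnion_le _ _).trans ?_
  rw [tsum_fintype, ENNReal.ofReal_sum_of_nonneg
    (fun k _ => arctanh_nonneg (norm_nonneg _) (mem_ball_zero_iff.1 (hs k)))]
  refine Finset.sum_le_sum fun k _ => ?_
  rw [← piece_integral (k := k) (norm_nonneg _) (mem_ball_zero_iff.1 (hs k)) hN,
    ← MeasureTheory.setLIntegral_congr MeasureTheory.Ioo_ae_eq_Icc]
  refine MeasureTheory.setLIntegral_mono' measurableSet_Ioo fun t ht => ?_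
  have htI := Ioo_subset_Icc_self ht
  have hd : HasDerivAt Γ (((m : ℝ) + 1) • fderiv ℝ (g k)
      (((((m : ℝ) + 1) * t - k : ℝ) : ℂ) * s k) (s k)) t := by
    have a1 : HasDerivAt (fun t : ℝ => ((((m : ℝ) + 1) * t - k : ℝ) : ℂ) * s k)
        ((((m : ℝ) + 1 : ℝ) : ℂ) * s k) t := by
      have b : HasDerivAt (fun t : ℝ => ((m : ℝ) + 1) * t - k) ((m : ℝ) + 1) t := by
        simpa using ((hasDerivAt_id t).const_mul ((m : ℝ) + 1)).sub_const (k : ℝ)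
      exact b.ofReal_comp.mul_const (s k)
    have a2 := ((hg k).2 _ (hmem k t htI)).1.hasFDerivAt
    have a3 := a2.comp_hasDerivAt t a1
    rw [← Complex.real_smul (x := (m : ℝ) + 1), map_smul] at a3
    refine a3.congr_of_eventuallyEq ?_
    filter_upwards [isOpen_Ioo.mem_nhds ht] with x hx
    exact hΓ k x (Ioo_subset_Icc_self hx)
  rw [hd.deriv, hΓ k t htI]
  exact kr_le (hg k) hN (hmem k t htI)

/-- the integrated Kobayashi–Royden pseudodistance is bounded above by the
Kobayashi pseudodistance. -/
theorem integratedKRDist_le_kobayashiDist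
    (n : ℕ) (hn : 1 ≤ n) (Ω : Set (Cn n)) (hΩ : IsOpen Ω) (hne : Ω.Nonempty)
    (J : Cn n → (Cn n →L[ℝ] Cn n)) (hJ : IsAlmostComplexOn n Ω J) :
    ∀ p ∈ Ω, ∀ q ∈ Ω, integratedKRDist n Ω J p q ≤ kobayashiDist n Ω J p q := by
  intro p hp q hq
  refine le_sInf ?_
  rintro c ⟨m, z, w, f, hk, h0, hc, h1, rfl⟩
  have hnz : ∀ k, -(z k) ∈ ball (0:ℂ) 1 := fun k => by simpa using (hk k).1
  have key := chain_path hΩ hJ m (fun k => f k ∘ mob (z k)) (fun k => mob (-(z k)) (w k))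
    (fun k => mob_mem (hnz k) (hk k).2.1)
    (fun k => (jhol_comp (hk k).2.2 (fun _ hζ => mob_diff (hk k).1 hζ)
      (fun _ hζ => mob_mem (hk k).1 hζ)).1)
    (fun k => by
      simp only [Function.comp, mob_inv (hk k.castSucc).1 (hk k.castSucc).2.1]
      rw [hc k]
      simp [mob])
  simp only [Function.comp, mob_inv (hk (Fin.last m)).1 (hk (Fin.last m)).2.1, h1,
    ← poincare_mob] at key
  have e0 : mob (z 0) 0 = z 0 := by simp [mob]
  rwa [e0, h0] at key
end
end

section
/- Let γ : (a, b) → Ω be a continuously differentiable path and let t ∈ (a, b). Then limsup_{δ → 0⁺} d_Ω(γ(t), γ(t + δ))/δ ≤ F_Ω(γ(t), γ′(t)), where d_Ω is the Kobayashi pseudodistance. -/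
open Metric Set Filter
open scoped ENNReal Topology

noncomputable section

/-! ### The Wiener algebra on the 2-torus -/

abbrev Wn := lp (fun _ : ℤ × ℤ => ℂ) 1

lemma Wn_summable (a : Wn) : Summable (fun m => ‖a m‖) := by
  have := (lp.memℓp a).summable (by simp)
  simpa using this

def Wmk (c : ℤ × ℤ → ℂ) (h : Summable fun m => ‖c m‖) : Wn :=
  ⟨c, memℓp_gen (by simpa using h)⟩

@[simp] lemma Wmk_apply (c : ℤ × ℤ → ℂ) (h : Summable fun m => ‖c m‖) (m : ℤ × ℤ) :
    Wmk c h m = c m := rfl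

lemma Wn_norm (a : Wn) : ‖a‖ = ∑' m, ‖a m‖ := by
  have := lp.norm_eq_tsum_rpow (p := 1) (by simp) a
  simpa using this

lemma Wn_ext {a b : Wn} (h : ∀ m, a m = b m) : a = b := lp.ext (funext h)

lemma Wn_add_apply (a b : Wn) (m) : (a + b) m = a m + b m := rfl
lemma Wn_sub_apply (a b : Wn) (m) : (a - b) m = a m - b m := rfl
lemma Wn_smul_apply (c : ℂ) (a : Wn) (m) : (c • a) m = c * a m := rfl
lemma Wn_zero_apply (m) : (0 : Wn) m = 0 := rfl
lemma Wn_neg_apply (a : Wn) (m) : (-a) m = - a m := rfl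

lemma Wn_apply_le (a : Wn) (m) : ‖a m‖ ≤ ‖a‖ := lp.norm_apply_le_norm (by simp) a m

def ech (m : ℤ × ℤ) (z : ℂ) : ℂ :=
  Complex.exp (2 * Real.pi * Complex.I * (m.1 * z.re + m.2 * z.im))

lemma ech_zero (z : ℂ) : ech 0 z = 1 := by simp [ech]

lemma ech_add (m k : ℤ × ℤ) (z : ℂ) : ech (m + k) z = ech m z * ech k z := by
  simp only [ech, ← Complex.exp_add]; congr 1; push_cast [Prod.fst_add, Prod.snd_add]; ring

lemma ech_norm (m : ℤ × ℤ) (z : ℂ) : ‖ech m z‖ = 1 := by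
  have : (2 * Real.pi * Complex.I * (m.1 * z.re + m.2 * z.im) : ℂ) =
    ((2 * Real.pi * (m.1 * z.re + m.2 * z.im) : ℝ) : ℂ) * Complex.I := by push_cast; ring
  rw [ech, this, Complex.norm_exp_ofReal_mul_I]

lemma ech_neg (m : ℤ × ℤ) (z : ℂ) : ech (-m) z = (starRingEnd ℂ) (ech m z) := by
  simp only [ech, ← Complex.exp_conj]
  congr 1
  have : (starRingEnd ℂ) 2 = 2 := Complex.conj_ofNat 2
  simp [Complex.conj_ofReal, this]
  ring

lemma ech_at_zero (m : ℤ × ℤ) : ech m 0 = 1 := by simp [ech]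

lemma ev_summable (z : ℂ) (a : Wn) : Summable fun m => a m * ech m z := by
  apply Summable.of_norm
  simpa [ech_norm] using Wn_summable a

def ev (z : ℂ) : Wn →L[ℂ] ℂ :=
  LinearMap.mkContinuous
    { toFun := fun a => ∑' m, a m * ech m z
      map_add' := fun a b => by
        rw [← (ev_summable z a).tsum_add (ev_summable z b)]
        exact tsum_congr fun m => by rw [Wn_add_apply]; ring
      map_smul' := fun c a => by
        simp only [RingHom.id_apply, smul_eq_mul]
        rw [← tsum_mul_left]
        exact tsum_congr fun m => by rw [Wn_smul_apply]; ring } 1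
    (fun a => by
      simp only [LinearMap.coe_mk, AddHom.coe_mk, one_mul]
      rw [Wn_norm]
      have h : Summable fun m => ‖a m * ech m z‖ := by simpa [ech_norm] using Wn_summable a
      refine (norm_tsum_le_tsum_norm h).trans_eq ?_
      simp [ech_norm])

lemma ev_apply (z : ℂ) (a : Wn) : ev z a = ∑' m, a m * ech m z := rfl

lemma ev_norm_le (z : ℂ) (a : Wn) : ‖ev z a‖ ≤ ‖a‖ := by
  have h := (ev z).le_opNorm a
  have h2 : ‖ev z‖ ≤ 1 := LinearMap.mkContinuous_norm_le _ zero_le_one _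
  nlinarith [norm_nonneg a]

lemma integral_exp_int (n : ℤ) :
    ∫ x in Icc (0:ℝ) 1, Complex.exp (2 * Real.pi * Complex.I * n * x) = if n = 0 then 1 else 0 := by
  rw [MeasureTheory.integral_Icc_eq_integral_Ioc, ← intervalIntegral.integral_of_le zero_le_one]
  split_ifs with h
  · simp [h]
  · have hc : (2 * Real.pi * Complex.I * n : ℂ) ≠ 0 := by
      simp [h, Real.pi_ne_zero, Complex.I_ne_zero]
    rw [integral_exp_mul_complex hc]
    have : Complex.exp (2 * Real.pi * Complex.I * n * (1:ℝ)) = 1 := by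
      rw [Complex.exp_eq_one_iff]
      exact ⟨n, by push_cast; ring⟩
    rw [this]; simp

def sqm : MeasureTheory.Measure (ℝ × ℝ) :=
  (MeasureTheory.volume.restrict (Icc (0:ℝ) 1)).prod (MeasureTheory.volume.restrict (Icc (0:ℝ) 1))

instance : MeasureTheory.IsProbabilityMeasure (MeasureTheory.volume.restrict (Icc (0:ℝ) 1)) :=
  ⟨by simp⟩

instance : MeasureTheory.IsProbabilityMeasure sqm := by unfold sqm; infer_instance

def toC (q : ℝ × ℝ) : ℂ := ⟨q.1, q.2⟩

lemma ech_toC_cont (m : ℤ × ℤ) : Continuous fun q : ℝ × ℝ => ech m (toC q) := by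
  unfold ech toC; fun_prop

lemma integral_ech (m : ℤ × ℤ) : ∫ q, ech m (toC q) ∂sqm = if m = 0 then 1 else 0 := by
  have h : ∀ q : ℝ × ℝ, ech m (toC q) = Complex.exp (2 * Real.pi * Complex.I * m.1 * q.1) *
      Complex.exp (2 * Real.pi * Complex.I * m.2 * q.2) := by
    intro q; rw [← Complex.exp_add, ech, toC]; congr 1; ring
  simp_rw [h, sqm]
  rw [MeasureTheory.integral_prod_mul (fun x : ℝ => Complex.exp (2 * Real.pi * Complex.I * m.1 * x))
    (fun x : ℝ => Complex.exp (2 * Real.pi * Complex.I * m.2 * x)), integral_exp_int,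
    integral_exp_int]
  by_cases h1 : m.1 = 0 <;> by_cases h2 : m.2 = 0 <;> simp [h1, h2, Prod.ext_iff]

lemma coeff_eq (a : Wn) (m : ℤ × ℤ) :
    a m = ∫ q, ev (toC q) a * ech (-m) (toC q) ∂sqm := by
  have hint : ∀ k, MeasureTheory.Integrable (fun q => a k * ech (k - m) (toC q)) sqm := by
    intro k
    refine MeasureTheory.Integrable.of_bound (C := ‖a k‖)
      ((continuous_const.mul (ech_toC_cont _)).aestronglyMeasurable) ?_
    exact Eventually.of_forall fun q => by simp [ech_norm]
  have hs : Summable fun k => ∫ q, ‖a k * ech (k - m) (toC q)‖ ∂sqm := by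
    simpa [ech_norm] using Wn_summable a
  have key := MeasureTheory.hasSum_integral_of_summable_integral_norm hint hs
  have h1 : ∀ q, ev (toC q) a * ech (-m) (toC q) = ∑' k, a k * ech (k - m) (toC q) := by
    intro q
    rw [ev_apply, ← tsum_mul_right]
    refine tsum_congr fun k => ?_
    rw [sub_eq_add_neg, ech_add, mul_assoc]
  simp_rw [h1]
  rw [← key.tsum_eq, tsum_eq_single m]
  · rw [MeasureTheory.integral_const_mul, integral_ech]; simp
  · intro k hk
    rw [MeasureTheory.integral_const_mul, integral_ech, if_neg (sub_ne_zero.2 hk), mul_zero]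

lemma coeff_le (a : Wn) (M : ℝ) (h : ∀ z, ‖ev z a‖ ≤ M) (m) : ‖a m‖ ≤ M := by
  rw [coeff_eq a m]
  refine (MeasureTheory.norm_integral_le_of_norm_le_const (C := M) ?_).trans_eq (by simp)
  exact Eventually.of_forall fun q => by simpa [ech_norm] using h _

lemma ev_inj {a b : Wn} (h : ∀ z, ev z a = ev z b) : a = b := by
  refine Wn_ext fun m => ?_
  have := coeff_le (a - b) 0 (fun z => by simp [h z]) m
  rw [Wn_sub_apply] at this
  exact sub_eq_zero.1 (norm_le_zero_iff.1 this)

def shear : (ℤ × ℤ) × (ℤ × ℤ) ≃ (ℤ × ℤ) × (ℤ × ℤ) where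
  toFun p := (p.1 + p.2, p.1)
  invFun p := (p.2, p.1 - p.2)
  left_inv p := by ext <;> simp
  right_inv p := by ext <;> simp

lemma conv_summable2 (a b : Wn) :
    Summable fun p : (ℤ × ℤ) × (ℤ × ℤ) => ‖a p.2‖ * ‖b (p.1 - p.2)‖ := by
  have := Summable.mul_of_nonneg (Wn_summable a) (Wn_summable b)
    (fun _ => norm_nonneg _) (fun _ => norm_nonneg _)
  rw [← shear.symm.summable_iff] at this
  exact this

lemma conv_norm (a b : Wn) :
    ∑' p : (ℤ × ℤ) × (ℤ × ℤ), ‖a p.2‖ * ‖b (p.1 - p.2)‖ = ‖a‖ * ‖b‖ := by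
  rw [Wn_norm, Wn_norm, tsum_mul_tsum_of_summable_norm (by simpa using Wn_summable a)
    (by simpa using Wn_summable b)]
  exact shear.symm.tsum_eq (fun p : (ℤ × ℤ) × (ℤ × ℤ) => ‖a p.1‖ * ‖b p.2‖)

def convf (a b : Wn) (m : ℤ × ℤ) : ℂ := ∑' k, a k * b (m - k)

lemma convf_norm_le (a b : Wn) (m : ℤ × ℤ) : ‖convf a b m‖ ≤ ∑' k, ‖a k‖ * ‖b (m - k)‖ := by
  have := (conv_summable2 a b).prod_factor m
  refine (norm_tsum_le_tsum_norm (by simpa using this)).trans_eq (by simp)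

lemma convf_summable (a b : Wn) : Summable fun m => ‖convf a b m‖ :=
  Summable.of_nonneg_of_le (fun _ => norm_nonneg _) (convf_norm_le a b) (conv_summable2 a b).prod

instance : Mul Wn := ⟨fun a b => Wmk (convf a b) (convf_summable a b)⟩

lemma Wn_mul_apply (a b : Wn) (m) : (a * b) m = ∑' k, a k * b (m - k) := rfl

lemma Wn_norm_mul (a b : Wn) : ‖a * b‖ ≤ ‖a‖ * ‖b‖ := by
  rw [← conv_norm, Wn_norm, (conv_summable2 a b).tsum_prod]
  exact (convf_summable a b).tsum_le_tsum (convf_norm_le a b) (conv_summable2 a b).prod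

lemma ev_mul (z : ℂ) (a b : Wn) : ev z (a * b) = ev z a * ev z b := by
  rw [ev_apply, ev_apply, ev_apply]
  have h1 : Summable fun m => ‖a m * ech m z‖ := by simpa [ech_norm] using Wn_summable a
  have h2 : Summable fun m => ‖b m * ech m z‖ := by simpa [ech_norm] using Wn_summable b
  rw [tsum_mul_tsum_of_summable_norm h1 h2]
  rw [← shear.symm.tsum_eq (fun p : (ℤ × ℤ) × (ℤ × ℤ) => a p.1 * ech p.1 z * (b p.2 * ech p.2 z))]
  have h3 : Summable fun p : (ℤ × ℤ) × (ℤ × ℤ) =>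
      a (shear.symm p).1 * ech (shear.symm p).1 z * (b (shear.symm p).2 * ech (shear.symm p).2 z) := by
    apply Summable.of_norm
    simp only [norm_mul, ech_norm, mul_one]
    exact conv_summable2 a b
  rw [h3.tsum_prod]
  refine tsum_congr fun m => ?_
  rw [Wn_mul_apply, ← tsum_mul_right]
  refine tsum_congr fun k => ?_
  have : ech m z = ech k z * ech (m - k) z := by rw [← ech_add]; congr 1; abel
  rw [this]
  change _ = a k * ech k z * (b (m - k) * ech (m - k) z)
  ring

def delta0 : Wn := lp.single 1 (0 : ℤ × ℤ) (1 : ℂ)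

lemma delta0_apply (m : ℤ × ℤ) : delta0 m = if m = 0 then 1 else 0 := by
  rw [delta0, lp.single_apply, Pi.single_apply]

instance : One Wn := ⟨delta0⟩

lemma Wn_one_apply (m : ℤ × ℤ) : (1 : Wn) m = if m = 0 then 1 else 0 := delta0_apply m

lemma ev_one (z : ℂ) : ev z (1 : Wn) = 1 := by
  rw [ev_apply, tsum_eq_single 0]
  · simp [Wn_one_apply, ech_zero]
  · intro m hm; simp [Wn_one_apply, hm]

instance instWnRing : NormedCommRing Wn :=
  { (inferInstance : NormedAddCommGroup Wn) with
    mul := (· * ·)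
    one := 1
    left_distrib := fun a b c => ev_inj fun z => by simp only [ev_mul, map_add]; ring
    right_distrib := fun a b c => ev_inj fun z => by simp only [ev_mul, map_add]; ring
    zero_mul := fun a => ev_inj fun z => by simp only [ev_mul, map_zero]; ring
    mul_zero := fun a => ev_inj fun z => by simp only [ev_mul, map_zero]; ring
    mul_assoc := fun a b c => ev_inj fun z => by simp only [ev_mul]; ring
    one_mul := fun a => ev_inj fun z => by simp only [ev_mul, ev_one]; ring
    mul_one := fun a => ev_inj fun z => by simp only [ev_mul, ev_one]; ring
    mul_comm := fun a b => ev_inj fun z => by simp only [ev_mul]; ring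
    dist_eq := fun a b => by rw [dist_eq_norm, norm_sub_rev, sub_eq_neg_add]
    norm_mul_le := Wn_norm_mul }

instance : Algebra ℂ Wn := Algebra.ofModule
  (fun r a b => ev_inj fun z => by simp only [ev_mul, map_smul, smul_eq_mul]; ring)
  (fun r a b => ev_inj fun z => by simp only [ev_mul, map_smul, smul_eq_mul]; ring)

instance : NormedAlgebra ℂ Wn where
  norm_smul_le := norm_smul_le

instance : NormOneClass Wn := ⟨by
  have : ‖(lp.single 1 (0 : ℤ × ℤ) (1 : ℂ) : Wn)‖ = ‖(1:ℂ)‖ := lp.norm_single (by simp) _ _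
  rw [norm_one] at this
  exact this⟩

instance : NormedAlgebra ℚ Wn := NormedAlgebra.restrictScalars ℚ ℂ Wn

def evA (z : ℂ) : Wn →ₐ[ℂ] ℂ :=
  AlgHom.ofLinearMap (ev z).toLinearMap (ev_one z) (ev_mul z)

lemma evA_apply (z : ℂ) (a : Wn) : evA z a = ev z a := rfl

lemma ev_exp (z : ℂ) (a : Wn) : ev z (NormedSpace.exp a) = Complex.exp (ev z a) := by
  rw [Complex.exp_eq_exp_ℂ, ← evA_apply, ← evA_apply]
  exact NormedSpace.map_exp (evA z) (ev z).continuous a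

/-! ### Multipliers, real elements, exponential bound -/

def mulT (σ : ℤ × ℤ → ℂ) (C : ℝ) (h : ∀ m, ‖σ m‖ ≤ C) : Wn →L[ℂ] Wn :=
  have hb : ∀ a : Wn, ∀ m, ‖σ m * a m‖ ≤ C * ‖a m‖ := fun a m => by
    rw [norm_mul]; exact mul_le_mul_of_nonneg_right (h m) (norm_nonneg _)
  have hs : ∀ a : Wn, Summable fun m => ‖σ m * a m‖ := fun a =>
    Summable.of_nonneg_of_le (fun _ => norm_nonneg _) (hb a) ((Wn_summable a).mul_left C)
  LinearMap.mkContinuous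
    { toFun := fun a => Wmk (fun m => σ m * a m) (hs a)
      map_add' := fun a b => Wn_ext fun m => by
        simp only [Wmk_apply, Wn_add_apply]; ring
      map_smul' := fun c a => Wn_ext fun m => by
        simp only [Wmk_apply, Wn_smul_apply, RingHom.id_apply]; ring } C
    (fun a => by
      simp only [LinearMap.coe_mk, AddHom.coe_mk]
      rw [Wn_norm, Wn_norm, ← tsum_mul_left]
      exact (hs a).tsum_le_tsum (hb a) ((Wn_summable a).mul_left C))

lemma mulT_apply (σ : ℤ × ℤ → ℂ) (C : ℝ) (h : ∀ m, ‖σ m‖ ≤ C) (a : Wn) (m) :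
    mulT σ C h a m = σ m * a m := rfl

lemma mulT_norm_le (σ : ℤ × ℤ → ℂ) (C : ℝ) (h : ∀ m, ‖σ m‖ ≤ C) (a : Wn) :
    ‖mulT σ C h a‖ ≤ C * ‖a‖ := by
  rw [Wn_norm, Wn_norm, ← tsum_mul_left]
  refine (Wn_summable _).tsum_le_tsum (fun m => ?_) ((Wn_summable a).mul_left C)
  rw [mulT_apply, norm_mul]
  exact mul_le_mul_of_nonneg_right (h m) (norm_nonneg _)

def wt (m : ℤ × ℤ) : ℝ := 1 + ‖m‖

lemma wt_pos (m) : 0 < wt m := by unfold wt; positivity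
lemma wt_one_le (m) : 1 ≤ wt m := by unfold wt; linarith [norm_nonneg m]

def GG : Wn →L[ℂ] Wn := mulT (fun m => ((wt m)⁻¹ : ℝ)) 1 (fun m => by
  rw [Complex.norm_real, Real.norm_of_nonneg (inv_nonneg.2 (wt_pos m).le)]
  exact inv_le_one_of_one_le₀ (wt_one_le m))

lemma GG_apply (a : Wn) (m) : GG a m = ((wt m)⁻¹ : ℝ) * a m := rfl

lemma GG_norm_le (a : Wn) : ‖GG a‖ ≤ ‖a‖ := by
  have := mulT_norm_le (fun m => ((wt m)⁻¹ : ℝ)) 1 (fun m => by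
    rw [Complex.norm_real, Real.norm_of_nonneg (inv_nonneg.2 (wt_pos m).le)]
    exact inv_le_one_of_one_le₀ (wt_one_le m)) a
  rw [one_mul] at this
  exact this

def IsRe (a : Wn) : Prop := ∀ m, a (-m) = (starRingEnd ℂ) (a m)

lemma IsRe.add {a b : Wn} (ha : IsRe a) (hb : IsRe b) : IsRe (a + b) := fun m => by
  rw [Wn_add_apply, Wn_add_apply, ha, hb, map_add]

lemma IsRe.smul {a : Wn} (ha : IsRe a) (r : ℝ) : IsRe ((r : ℂ) • a) := fun m => by
  rw [Wn_smul_apply, Wn_smul_apply, ha, map_mul, Complex.conj_ofReal]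

lemma IsRe.zero : IsRe 0 := fun m => by simp [Wn_zero_apply]

lemma IsRe.sum {ι : Type*} (s : Finset ι) (f : ι → Wn) (h : ∀ i ∈ s, IsRe (f i)) :
    IsRe (∑ i ∈ s, f i) := by
  classical
  induction s using Finset.induction_on with
  | empty => simpa using IsRe.zero
  | insert i s hi ih =>
    rw [Finset.sum_insert hi]
    exact (h i (Finset.mem_insert_self _ _)).add (ih fun j hj => h j (Finset.mem_insert_of_mem hj))

lemma IsRe.mulT {a : Wn} (ha : IsRe a) (σ : ℤ × ℤ → ℝ) (C : ℝ) (h : ∀ m, ‖(σ m : ℂ)‖ ≤ C)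
    (hσ : ∀ m, σ (-m) = σ m) : IsRe (mulT (fun m => (σ m : ℂ)) C h a) := fun m => by
  rw [mulT_apply, mulT_apply, ha, hσ, map_mul, Complex.conj_ofReal]

lemma IsRe.GG {a : Wn} (ha : IsRe a) : IsRe (GG a) := fun m => by
  rw [GG_apply, GG_apply, ha, map_mul, Complex.conj_ofReal]; simp [wt]

lemma IsRe.ev {a : Wn} (ha : IsRe a) (z : ℂ) : (starRingEnd ℂ) (ev z a) = ev z a := by
  rw [ev_apply, Complex.conj_tsum, ← (Equiv.neg (ℤ × ℤ)).tsum_eq]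
  refine tsum_congr fun m => ?_
  simp only [Equiv.neg_apply, map_mul, ha m, ech_neg, Complex.conj_conj]

lemma star_summable (a : Wn) :
    Summable fun m => ‖(starRingEnd ℂ) (a (-m))‖ := by
  simp only [RCLike.norm_conj]
  exact (Equiv.neg (ℤ × ℤ)).summable_iff.2 (Wn_summable a)

def cjW (a : Wn) : Wn := Wmk _ (star_summable a)

lemma cjW_apply (a : Wn) (m) : cjW a m = (starRingEnd ℂ) (a (-m)) := rfl

lemma cjW_norm (a : Wn) : ‖cjW a‖ = ‖a‖ := by
  rw [Wn_norm, Wn_norm, ← (Equiv.neg (ℤ × ℤ)).tsum_eq (fun m => ‖a m‖)]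
  simp [cjW_apply]

def reP (a : Wn) : Wn := (1/2 : ℂ) • (a + cjW a)

lemma reP_apply (a : Wn) (m) : reP a m = 1/2 * (a m + (starRingEnd ℂ) (a (-m))) := rfl

lemma reP_isRe (a : Wn) : IsRe (reP a) := fun m => by
  simp only [reP_apply, map_mul, map_add, Complex.conj_conj, neg_neg, map_div₀, map_one,
    Complex.conj_ofNat]
  ring

lemma reP_norm_le (a : Wn) : ‖reP a‖ ≤ ‖a‖ := by
  rw [reP, norm_smul]
  have := norm_add_le a (cjW a)
  rw [cjW_norm] at this
  norm_num
  linarith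

lemma reP_sub (a b : Wn) : reP a - reP b = reP (a - b) := Wn_ext fun m => by
  simp only [Wn_sub_apply, reP_apply, map_sub]; ring

lemma reP_zero : reP 0 = 0 := Wn_ext fun m => by simp [reP_apply, Wn_zero_apply]

lemma ev_cjW (z : ℂ) (a : Wn) : ev z (cjW a) = (starRingEnd ℂ) (ev z a) := by
  rw [ev_apply, ev_apply, Complex.conj_tsum, ← (Equiv.neg (ℤ × ℤ)).tsum_eq]
  refine tsum_congr fun m => ?_
  simp only [Equiv.neg_apply, map_mul, cjW_apply, ech_neg, neg_neg]

lemma GG_cjW (a : Wn) : GG (cjW a) = cjW (GG a) := Wn_ext fun m => by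
  simp [GG_apply, cjW_apply, wt]

lemma ev_GG_reP (z : ℂ) (a : Wn) : ev z (GG (reP a)) = ((ev z (GG a)).re : ℂ) := by
  rw [reP, map_smul, map_smul, map_add, map_add, GG_cjW, ev_cjW, Complex.add_conj]
  simp

def SuppW (a : Wn) (n : ℕ) : Prop := ∀ m : ℤ × ℤ, (n : ℝ) < ‖m‖ → a m = 0

lemma SuppW.mul {a b : Wn} {n k : ℕ} (ha : SuppW a n) (hb : SuppW b k) : SuppW (a * b) (n + k) := by
  intro m hm
  rw [Wn_mul_apply]
  convert tsum_zero with j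
  by_cases h : (n : ℝ) < ‖j‖
  · rw [ha j h, zero_mul]
  · rw [hb (m - j), mul_zero]
    have := norm_sub_norm_le m j
    push_cast at hm
    linarith

lemma SuppW.one : SuppW 1 0 := by
  intro m hm
  rw [Wn_one_apply, if_neg]
  rintro rfl
  simp at hm

lemma SuppW.pow {a : Wn} {n : ℕ} (ha : SuppW a n) (j : ℕ) : SuppW (a ^ j) (j * n) := by
  induction j with
  | zero => simpa using SuppW.one
  | succ j ih => rw [pow_succ, Nat.succ_mul]; exact ih.mul ha

lemma SuppW.mono {a : Wn} {n k : ℕ} (ha : SuppW a n) (h : n ≤ k) : SuppW a k :=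
  fun m hm => ha m (lt_of_le_of_lt (by exact_mod_cast h) hm)

lemma SuppW.norm_le {a : Wn} {n : ℕ} (ha : SuppW a n) (M : ℝ) (h : ∀ m, ‖a m‖ ≤ M) :
    ‖a‖ ≤ (2 * n + 1) ^ 2 * M := by
  let s : Finset (ℤ × ℤ) := Finset.Icc (-(n:ℤ)) n ×ˢ Finset.Icc (-(n:ℤ)) n
  rw [Wn_norm, tsum_eq_sum (s := s)]
  · refine (Finset.sum_le_card_nsmul s _ M fun m _ => h m).trans_eq ?_
    have : s.card = (2 * n + 1) ^ 2 := by
      simp only [s, Finset.card_product, Int.card_Icc]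
      rw [← sq]; congr 1; omega
    rw [this]; simp
  · intro m hm
    rw [ha m, norm_zero]
    by_contra hc
    apply hm
    rw [not_lt, Prod.norm_def, max_le_iff, Int.norm_eq_abs, Int.norm_eq_abs] at hc
    have h1 : |m.1| ≤ (n : ℤ) := by exact_mod_cast hc.1
    have h2 : |m.2| ≤ (n : ℤ) := by exact_mod_cast hc.2
    simp only [s, Finset.mem_product, Finset.mem_Icc]
    exact ⟨abs_le.1 h1, abs_le.1 h2⟩

lemma exp_tail (x : Wn) (R : ℝ) (hx : ‖x‖ ≤ R) (J : ℕ) (hJ : 3 * R ≤ J) :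
    ‖NormedSpace.exp x - ∑ j ∈ Finset.range J, ((j.factorial : ℂ)⁻¹) • x ^ j‖ ≤ 1 := by
  have hR : 0 ≤ R := (norm_nonneg _).trans hx
  have h1 : HasSum (fun j : ℕ => ((j.factorial : ℂ)⁻¹) • x ^ j) (NormedSpace.exp x) :=
    NormedSpace.exp_series_hasSum_exp' x
  have h2 : HasSum (fun j : ℕ => if j ∈ Finset.range J then ((j.factorial : ℂ)⁻¹) • x ^ j else 0)
      (∑ j ∈ Finset.range J, ((j.factorial : ℂ)⁻¹) • x ^ j) := by
    have := hasSum_sum_of_ne_finset_zero (L := .unconditional ℕ) (s := Finset.range J)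
      (f := fun j : ℕ => if j ∈ Finset.range J then ((j.factorial : ℂ)⁻¹) • x ^ j else 0)
      (fun b hb => if_neg hb)
    convert this using 1
    exact Finset.sum_congr rfl fun j hj => (if_pos hj).symm
  have h3 := h1.sub h2
  have h4 : HasSum (fun j : ℕ => (3:ℝ)⁻¹ ^ J * ((3 * R) ^ j / j.factorial))
      ((3:ℝ)⁻¹ ^ J * Real.exp (3 * R)) := by
    apply HasSum.mul_left
    rw [Real.exp_eq_exp_ℝ]
    exact NormedSpace.expSeries_div_hasSum_exp (3 * R)
  have h5 : ‖NormedSpace.exp x - ∑ j ∈ Finset.range J, ((j.factorial : ℂ)⁻¹) • x ^ j‖ ≤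
      (3:ℝ)⁻¹ ^ J * Real.exp (3 * R) := by
    rw [← h3.tsum_eq]
    refine tsum_of_norm_bounded h4 fun j => ?_
    split_ifs with hj
    · simp only [sub_self, norm_zero]; positivity
    · rw [sub_zero, norm_smul, norm_inv, Complex.norm_natCast]
      have hjJ : J ≤ j := by simpa using hj
      have e1 : ‖x ^ j‖ ≤ R ^ j := (norm_pow_le x j).trans (pow_le_pow_left₀ (norm_nonneg _) hx j)
      have e2 : R ^ j ≤ (3:ℝ)⁻¹ ^ J * (3 * R) ^ j := by
        rw [mul_pow, ← mul_assoc]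
        apply le_mul_of_one_le_left (by positivity)
        rw [inv_pow, inv_mul_eq_div, one_le_div (by positivity)]
        exact pow_le_pow_right₀ (by norm_num) hjJ
      calc ((j.factorial : ℝ))⁻¹ * ‖x ^ j‖ ≤ ((j.factorial : ℝ))⁻¹ * ((3:ℝ)⁻¹ ^ J * (3 * R) ^ j) := by
            gcongr; exact e1.trans e2
        _ = _ := by ring
  refine h5.trans ?_
  rw [inv_pow, inv_mul_eq_div, div_le_one (by positivity)]
  calc Real.exp (3 * R) ≤ Real.exp J := Real.exp_le_exp.2 hJ
    _ = Real.exp 1 ^ J := by rw [← Real.exp_nat_mul]; simp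
    _ ≤ 3 ^ J := by
      apply pow_le_pow_left₀ (Real.exp_pos _).le
      linarith [Real.exp_one_lt_d9]

lemma ev_I_norm {a : Wn} (ha : IsRe a) (z : ℂ) :
    ‖ev z (NormedSpace.exp (Complex.I • a))‖ = 1 := by
  rw [ev_exp, map_smul]
  obtain ⟨r, hr⟩ := Complex.conj_eq_iff_real.1 (ha.ev z)
  rw [hr, smul_eq_mul, mul_comm, Complex.norm_exp_ofReal_mul_I]

lemma exp_norm_le (x : Wn) : ‖NormedSpace.exp x‖ ≤ Real.exp ‖x‖ := by
  have h1 : HasSum (fun j : ℕ => ((j.factorial : ℂ)⁻¹) • x ^ j) (NormedSpace.exp x) :=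
    NormedSpace.exp_series_hasSum_exp' x
  have h4 : HasSum (fun j : ℕ => (‖x‖ ^ j / j.factorial)) (Real.exp ‖x‖) := by
    rw [Real.exp_eq_exp_ℝ]
    exact NormedSpace.expSeries_div_hasSum_exp ‖x‖
  rw [← h1.tsum_eq]
  refine tsum_of_norm_bounded h4 fun j => ?_
  rw [norm_smul, norm_inv, Complex.norm_natCast, inv_mul_eq_div]
  gcongr
  exact norm_pow_le x j

lemma exp_low {a : Wn} (ha : IsRe a) (R : ℝ) (hR : ‖a‖ ≤ R) (N J : ℕ) (hN : SuppW a N)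
    (hJ : 3 * R ≤ J) :
    ‖NormedSpace.exp (Complex.I • a)‖ ≤ 2 * (2 * (J * N : ℕ) + 1) ^ 2 + 1 := by
  set x := Complex.I • a with hx
  have hxR : ‖x‖ ≤ R := by rw [hx, norm_smul, Complex.norm_I, one_mul]; exact hR
  set P : Wn := ∑ j ∈ Finset.range J, ((j.factorial : ℂ)⁻¹) • x ^ j with hP
  have ht := exp_tail x R hxR J hJ
  rw [← hP] at ht
  have hsx : SuppW x N := fun m hm => by rw [hx, Wn_smul_apply, hN m hm, mul_zero]
  have hPs : SuppW P (J * N) := by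
    intro m hm
    have : ∀ s : Finset ℕ, (∀ j ∈ s, j ≤ J) →
        (∑ j ∈ s, ((j.factorial : ℂ)⁻¹) • x ^ j : Wn) m = 0 := by
      intro s
      induction s using Finset.induction_on with
      | empty => intro _; rfl
      | insert i s hi ih =>
        intro hs
        rw [Finset.sum_insert hi, Wn_add_apply, Wn_smul_apply,
          ih fun j hj => hs j (Finset.mem_insert_of_mem hj),
          ((hsx.pow i).mono (Nat.mul_le_mul_right N (hs i (Finset.mem_insert_self _ _)))) m hm]
        simp
    exact this _ fun j hj => (Finset.mem_range.1 hj).le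
  have hc : ∀ m, ‖P m‖ ≤ 2 := by
    intro m
    have h1 : ‖NormedSpace.exp x m‖ ≤ 1 := coeff_le _ 1 (fun z => (ev_I_norm ha z).le) m
    have h2 : ‖(NormedSpace.exp x - P) m‖ ≤ 1 := (Wn_apply_le _ m).trans ht
    have h3 : P m = NormedSpace.exp x m - (NormedSpace.exp x - P) m := by
      rw [Wn_sub_apply]; ring
    rw [h3]
    exact (norm_sub_le _ _).trans (by linarith)
  have h := hPs.norm_le 2 hc
  have : NormedSpace.exp x = P + (NormedSpace.exp x - P) := by abel
  rw [this]
  refine (norm_add_le _ _).trans ?_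
  linarith

lemma exp_bound {d : Wn} (hd : IsRe d) (R : ℝ) (hR : ‖d‖ ≤ R) :
    ‖NormedSpace.exp (Complex.I • GG d)‖ ≤ 1017 * (1 + R) ^ 4 := by
  have hR0 : 0 ≤ R := (norm_nonneg _).trans hR
  set N : ℕ := ⌈R⌉₊ + 1
  set J : ℕ := ⌈3 * R⌉₊
  have hN1 : R ≤ N := by simp only [N]; push_cast; linarith [Nat.le_ceil R]
  have hN2 : (N : ℝ) ≤ R + 2 := by
    simp only [N]; push_cast; linarith [Nat.ceil_lt_add_one hR0]
  have hJ1 : 3 * R ≤ J := Nat.le_ceil _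
  have hJ2 : (J : ℝ) ≤ 3 * R + 1 := (Nat.ceil_lt_add_one (by positivity)).le
  have hN0 : (0:ℝ) < N := by simp only [N]; positivity
  let σ : ℤ × ℤ → ℝ := fun m => if ‖m‖ ≤ N then 1 else 0
  have hσ : ∀ m, ‖(σ m : ℂ)‖ ≤ 1 := by
    intro m; simp only [σ]; split_ifs <;> simp
  set lo : Wn := mulT (fun m => (σ m : ℂ)) 1 hσ (GG d) with hlo
  have hloR : IsRe lo := hd.GG.mulT σ 1 hσ (fun m => by simp [σ])
  have hlon : ‖lo‖ ≤ R := by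
    have := mulT_norm_le (fun m => (σ m : ℂ)) 1 hσ (GG d)
    linarith [GG_norm_le d]
  have hlos : SuppW lo N := by
    intro m hm
    rw [hlo, mulT_apply]; simp only [σ]; rw [if_neg (not_le.2 hm)]; simp
  have hhi : ‖GG d - lo‖ ≤ 1 := by
    have h1 : ∀ m, ‖(GG d - lo) m‖ ≤ (N:ℝ)⁻¹ * ‖d m‖ := by
      intro m
      rw [Wn_sub_apply, hlo, mulT_apply]
      simp only [σ]
      split_ifs with h
      · simp only [Complex.ofReal_one, one_mul, sub_self, norm_zero]; positivity
      · rw [GG_apply]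
        simp only [Complex.ofReal_zero, zero_mul, sub_zero, norm_mul, Complex.norm_real]
        rw [Real.norm_of_nonneg (inv_nonneg.2 (wt_pos m).le)]
        gcongr
        unfold wt; linarith
    rw [Wn_norm]
    refine ((Wn_summable _).tsum_le_tsum h1 ((Wn_summable d).mul_left _)).trans ?_
    rw [tsum_mul_left, ← Wn_norm, inv_mul_eq_div, div_le_one hN0]
    linarith
  have hsplit : Complex.I • GG d = Complex.I • lo + Complex.I • (GG d - lo) := by
    rw [← smul_add]; congr 1; abel
  rw [hsplit, NormedSpace.exp_add_of_commute (Commute.all _ _)]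
  refine (norm_mul_le _ _).trans ?_
  have e1 := exp_low hloR R hlon N J hlos hJ1
  have e2 : ‖NormedSpace.exp (Complex.I • (GG d - lo))‖ ≤ 3 := by
    refine (exp_norm_le _).trans ?_
    rw [norm_smul, Complex.norm_I, one_mul]
    calc Real.exp ‖GG d - lo‖ ≤ Real.exp 1 := Real.exp_le_exp.2 hhi
      _ ≤ 3 := by linarith [Real.exp_one_lt_d9]
  have e3 : ((J * N : ℕ) : ℝ) ≤ 6 * (1 + R) ^ 2 := by
    push_cast
    calc (J : ℝ) * N ≤ (3 * R + 1) * (R + 2) := by gcongr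
      _ ≤ _ := by nlinarith
  have e4 : (2 * ((J * N : ℕ) : ℝ) + 1) ^ 2 ≤ (13 * (1 + R) ^ 2) ^ 2 := by
    gcongr; nlinarith
  have e5 : (1:ℝ) ≤ (1 + R) ^ 4 := one_le_pow₀ (by linarith)
  calc _ ≤ (2 * (2 * ((J * N : ℕ) : ℝ) + 1) ^ 2 + 1) * 3 := by gcongr
    _ ≤ _ := by nlinarith

/-! ### Smooth functional calculus -/

lemma exp_lip {a b : Wn} (ha : IsRe a) (hb : IsRe b) (R : ℝ) (haR : ‖a‖ ≤ R) (hbR : ‖b‖ ≤ R) :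
    ‖NormedSpace.exp (Complex.I • GG a) - NormedSpace.exp (Complex.I • GG b)‖ ≤
      1017 * (1 + R) ^ 4 * ‖a - b‖ := by
  set y : Wn := Complex.I • GG (a - b) with hy
  set x : Wn := Complex.I • GG b with hx
  let F : ℝ → Wn := fun s => NormedSpace.exp x * NormedSpace.exp (s • y)
  have hF : ∀ s, HasDerivAt F (NormedSpace.exp x * (NormedSpace.exp (s • y) * y)) s := fun s =>
    (hasDerivAt_exp_smul_const (𝕂 := ℝ) y s).const_mul _
  have hF2 : ∀ s : ℝ, NormedSpace.exp x * NormedSpace.exp (s • y) =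
      NormedSpace.exp (Complex.I • GG (((1 - s : ℝ) : ℂ) • b + (s : ℂ) • a)) := by
    intro s
    rw [← NormedSpace.exp_add_of_commute (Commute.all _ _)]
    congr 1
    refine ev_inj fun z => ?_
    have : (s • y : Wn) = (s : ℂ) • y := rfl
    rw [this]
    simp only [hx, hy, map_add, map_smul, map_sub, smul_eq_mul]
    push_cast
    ring
  have hbd : ∀ s ∈ Ico (0:ℝ) 1, ‖NormedSpace.exp x * (NormedSpace.exp (s • y) * y)‖ ≤
      1017 * (1 + R) ^ 4 * ‖a - b‖ := by
    intro s hs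
    rw [← mul_assoc, hF2]
    refine (norm_mul_le _ _).trans ?_
    have hR : 0 ≤ R := (norm_nonneg _).trans haR
    have h1 : ‖((1 - s : ℝ) : ℂ) • b + (s : ℂ) • a‖ ≤ R := by
      refine (norm_add_le _ _).trans ?_
      rw [norm_smul, norm_smul, Complex.norm_real, Complex.norm_real,
        Real.norm_of_nonneg hs.1, Real.norm_of_nonneg (by linarith [hs.2])]
      nlinarith [hs.1, hs.2]
    have h2 := exp_bound ((hb.smul (1 - s)).add (ha.smul s)) R h1
    have h3 : ‖y‖ ≤ ‖a - b‖ := by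
      rw [hy, norm_smul, Complex.norm_I, one_mul]; exact GG_norm_le _
    gcongr
  have key := norm_image_sub_le_of_norm_deriv_le_segment_01'
    (fun s _ => (hF s).hasDerivWithinAt) hbd
  have e1 : F 1 = NormedSpace.exp (Complex.I • GG a) := by
    simp only [F]; rw [hF2]; simp
  have e0 : F 0 = NormedSpace.exp (Complex.I • GG b) := by
    simp only [F]; rw [hF2]; simp
  rwa [e1, e0] at key

section FC
variable {κ : Type} [Fintype κ]

def lincomb (ξ : EuclideanSpace ℝ κ) (d : κ → Wn) : Wn :=
  ∑ k, ((2 * Real.pi * ξ k : ℝ) : ℂ) • reP (d k)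

lemma lincomb_isRe (ξ : EuclideanSpace ℝ κ) (d : κ → Wn) : IsRe (lincomb ξ d) :=
  IsRe.sum _ _ fun k _ => (reP_isRe _).smul _

lemma lincomb_sub_le (ξ : EuclideanSpace ℝ κ) (d d' : κ → Wn) :
    ‖lincomb ξ d - lincomb ξ d'‖ ≤ 2 * Real.pi * Fintype.card κ * ‖ξ‖ * ‖d - d'‖ := by
  unfold lincomb
  rw [← Finset.sum_sub_distrib]
  refine (norm_sum_le_of_le Finset.univ (f := fun k => ((2 * Real.pi * ξ k : ℝ) : ℂ) • reP (d k) -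
    ((2 * Real.pi * ξ k : ℝ) : ℂ) • reP (d' k))
    (n := fun _ => 2 * Real.pi * ‖ξ‖ * ‖d - d'‖) fun k _ => ?_).trans_eq ?_
  · rw [← smul_sub, norm_smul, reP_sub, Complex.norm_real, norm_mul,
      Real.norm_of_nonneg (by positivity : (0:ℝ) ≤ 2 * Real.pi)]
    have h1 : ‖ξ k‖ ≤ ‖ξ‖ := PiLp.norm_apply_le ξ k
    have h2 : ‖reP (d k - d' k)‖ ≤ ‖d - d'‖ := (reP_norm_le _).trans (norm_le_pi_norm (d - d') k)
    gcongr
  · simp; ring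

lemma lincomb_le (ξ : EuclideanSpace ℝ κ) (d : κ → Wn) (hd : ‖d‖ ≤ 1) :
    ‖lincomb ξ d‖ ≤ 2 * Real.pi * Fintype.card κ * ‖ξ‖ := by
  have h := lincomb_sub_le ξ d 0
  have h0 : lincomb ξ (0 : κ → Wn) = 0 := by simp [lincomb, reP_zero]
  rw [h0, sub_zero, sub_zero] at h
  refine h.trans (mul_le_of_le_one_right (by positivity) hd)

def Ech (ξ : EuclideanSpace ℝ κ) (d : κ → Wn) : Wn :=
  NormedSpace.exp (Complex.I • GG (lincomb ξ d))

lemma Ech_cont (d : κ → Wn) : Continuous fun ξ : EuclideanSpace ℝ κ => Ech ξ d := by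
  unfold Ech
  apply NormedSpace.exp_continuous.comp
  have hcont : Continuous fun ξ : EuclideanSpace ℝ κ => GG (lincomb ξ d) := by
    apply GG.continuous.comp
    unfold lincomb
    fun_prop
  exact hcont.const_smul Complex.I

lemma ev_Ech (z : ℂ) (ξ : EuclideanSpace ℝ κ) (d : κ → Wn) :
    ev z (Ech ξ d) = Complex.exp (((2 * Real.pi * inner ℝ ξ
      (WithLp.toLp 2 fun k => (ev z (GG (d k))).re) : ℝ) : ℂ) * Complex.I) := by
  rw [Ech, ev_exp, map_smul, lincomb, map_sum, map_sum]
  simp only [map_smul, ev_GG_reP, smul_eq_mul]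
  rw [mul_comm]
  congr 2
  rw [PiLp.inner_apply]
  push_cast
  rw [Finset.mul_sum]
  refine Finset.sum_congr rfl fun k _ => ?_
  simp
  ring

open scoped FourierTransform SchwartzMap

lemma weight_integrable (f : 𝓢(EuclideanSpace ℝ κ, ℂ)) (c : ℝ) (hc : 0 ≤ c) :
    MeasureTheory.Integrable (fun ξ => ‖f ξ‖ * (1 + c * ‖ξ‖) ^ 5) := by
  have h0 := f.integrable_pow_mul MeasureTheory.volume 0
  have h5 := f.integrable_pow_mul MeasureTheory.volume 5
  have h := (h0.const_mul (2 ^ 4)).add (h5.const_mul (2 ^ 4 * c ^ 5))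
  refine h.mono' (by fun_prop) (Eventually.of_forall fun ξ => ?_)
  rw [Real.norm_of_nonneg (by positivity)]
  have := add_pow_le (zero_le_one) (mul_nonneg hc (norm_nonneg ξ)) 5
  simp only [Pi.add_apply, pow_zero, one_mul]
  calc ‖f ξ‖ * (1 + c * ‖ξ‖) ^ 5 ≤ ‖f ξ‖ * (2 ^ (5 - 1) * (1 ^ 5 + (c * ‖ξ‖) ^ 5)) := by gcongr
    _ = _ := by norm_num; ring

def FCal (φ : 𝓢(EuclideanSpace ℝ κ, ℂ)) (d : κ → Wn) : Wn :=
  ∫ ξ, (𝓕 φ) ξ • Ech ξ d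

lemma FCal_integrable (φ : 𝓢(EuclideanSpace ℝ κ, ℂ)) (d : κ → Wn) (hd : ‖d‖ ≤ 1) :
    MeasureTheory.Integrable (fun ξ => (𝓕 φ) ξ • Ech ξ d) := by
  have h := (weight_integrable (𝓕 φ) (2 * Real.pi * Fintype.card κ) (by positivity)).const_mul 1017
  refine h.mono' ?_ (Eventually.of_forall fun ξ => ?_)
  · exact ((𝓕 φ).continuous.smul (Ech_cont d)).aestronglyMeasurable
  · rw [norm_smul]
    have := exp_bound (lincomb_isRe ξ d) _ (lincomb_le ξ d hd)
    have h2 : (1 + 2 * Real.pi * Fintype.card κ * ‖ξ‖) ^ 4 ≤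
        (1 + 2 * Real.pi * Fintype.card κ * ‖ξ‖) ^ 5 :=
      pow_le_pow_right₀ (le_add_of_nonneg_right (by positivity)) (by norm_num)
    calc ‖(𝓕 φ) ξ‖ * ‖Ech ξ d‖
        ≤ ‖(𝓕 φ) ξ‖ * (1017 * (1 + 2 * Real.pi * Fintype.card κ * ‖ξ‖) ^ 5) := by
          gcongr; exact this.trans (by gcongr)
      _ = _ := by ring

lemma FCal_ev (φ : 𝓢(EuclideanSpace ℝ κ, ℂ)) (d : κ → Wn) (hd : ‖d‖ ≤ 1) (z : ℂ) :
    ev z (FCal φ d) = φ (WithLp.toLp 2 fun k => (ev z (GG (d k))).re) := by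
  rw [FCal, ← ContinuousLinearMap.integral_comp_comm _ (FCal_integrable φ d hd)]
  simp only [map_smul, ev_Ech]
  have h : (𝓕⁻ (𝓕 φ)) (WithLp.toLp 2 fun k => (ev z (GG (d k))).re) =
    φ (WithLp.toLp 2 fun k => (ev z (GG (d k))).re) := by simp
  rw [← h, SchwartzMap.fourierInv_coe, Real.fourierInv_eq']
  refine MeasureTheory.integral_congr_ae (Eventually.of_forall fun ξ => ?_)
  simp only [smul_eq_mul]
  rw [mul_comm]

lemma FCal_lip (φ : 𝓢(EuclideanSpace ℝ κ, ℂ)) : ∃ K : ℝ, 0 ≤ K ∧ ∀ d d' : κ → Wn,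
    ‖d‖ ≤ 1 → ‖d'‖ ≤ 1 → ‖FCal φ d - FCal φ d'‖ ≤ K * ‖d - d'‖ := by
  set c : ℝ := 2 * Real.pi * Fintype.card κ with hc
  have hc0 : 0 ≤ c := by positivity
  have hI := weight_integrable (𝓕 φ) c hc0
  refine ⟨1017 * ∫ ξ, ‖(𝓕 φ) ξ‖ * (1 + c * ‖ξ‖) ^ 5,
    mul_nonneg (by norm_num) (MeasureTheory.integral_nonneg fun ξ => by positivity), ?_⟩
  intro d d' hd hd'
  rw [FCal, FCal, ← MeasureTheory.integral_sub (FCal_integrable φ d hd) (FCal_integrable φ d' hd')]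
  have hb : ∀ ξ, ‖(𝓕 φ) ξ • Ech ξ d - (𝓕 φ) ξ • Ech ξ d'‖ ≤
      (1017 * ‖d - d'‖) * (‖(𝓕 φ) ξ‖ * (1 + c * ‖ξ‖) ^ 5) := by
    intro ξ
    rw [← smul_sub, norm_smul]
    have h1 := exp_lip (lincomb_isRe ξ d) (lincomb_isRe ξ d') _ (lincomb_le ξ d hd)
      (lincomb_le ξ d' hd')
    have h2 := lincomb_sub_le ξ d d'
    rw [← hc] at h1 h2
    calc ‖(𝓕 φ) ξ‖ * ‖Ech ξ d - Ech ξ d'‖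
        ≤ ‖(𝓕 φ) ξ‖ * (1017 * (1 + c * ‖ξ‖) ^ 4 * ((1 + c * ‖ξ‖) * ‖d - d'‖)) := by
          gcongr
          refine h1.trans ?_
          gcongr
          refine h2.trans ?_
          gcongr
          linarith
      _ = _ := by ring
  refine (MeasureTheory.norm_integral_le_of_norm_le (hI.const_mul (1017 * ‖d - d'‖))
    (Eventually.of_forall hb)).trans_eq ?_
  rw [MeasureTheory.integral_const_mul]
  ring

end FC

/-! ### Derivatives and the Cauchy-Riemann right inverse -/

lemma fst_le_wt (m : ℤ × ℤ) : |(m.1 : ℝ)| ≤ wt m := by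
  have : ‖m.1‖ ≤ ‖m‖ := norm_fst_le m
  rw [Int.norm_eq_abs] at this
  unfold wt; linarith

lemma snd_le_wt (m : ℤ × ℤ) : |(m.2 : ℝ)| ≤ wt m := by
  have : ‖m.2‖ ≤ ‖m‖ := norm_snd_le m
  rw [Int.norm_eq_abs] at this
  unfold wt; linarith

lemma D_bound (x w : ℝ) (hw : 0 < w) (h : |x| ≤ w) :
    ‖(2 * Real.pi * Complex.I * x * ((w⁻¹ : ℝ) : ℂ) : ℂ)‖ ≤ 2 * Real.pi := by
  simp only [norm_mul, Complex.norm_real, Complex.norm_I, Complex.norm_ofNat, mul_one,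
    Real.norm_eq_abs, abs_inv, abs_of_pos Real.pi_pos, abs_of_pos hw]
  rw [mul_assoc]
  apply mul_le_of_le_one_right (by positivity)
  rw [← div_eq_mul_inv, div_le_one hw]
  exact h

def D1 : Wn →L[ℂ] Wn := mulT (fun m => 2 * Real.pi * Complex.I * ((m.1 : ℝ) : ℂ) * ((wt m)⁻¹ : ℝ))
  (2 * Real.pi) (fun m => D_bound _ _ (wt_pos m) (fst_le_wt m))

def D2 : Wn →L[ℂ] Wn := mulT (fun m => 2 * Real.pi * Complex.I * ((m.2 : ℝ) : ℂ) * ((wt m)⁻¹ : ℝ))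
  (2 * Real.pi) (fun m => D_bound _ _ (wt_pos m) (snd_le_wt m))

lemma D1_apply (a : Wn) (m) :
  D1 a m = 2 * Real.pi * Complex.I * ((m.1 : ℝ) : ℂ) * ((wt m)⁻¹ : ℝ) * a m := rfl
lemma D2_apply (a : Wn) (m) :
  D2 a m = 2 * Real.pi * Complex.I * ((m.2 : ℝ) : ℂ) * ((wt m)⁻¹ : ℝ) * a m := rfl
lemma D1_norm_le (a : Wn) : ‖D1 a‖ ≤ 2 * Real.pi * ‖a‖ := mulT_norm_le _ _ _ _
lemma D2_norm_le (a : Wn) : ‖D2 a‖ ≤ 2 * Real.pi * ‖a‖ := mulT_norm_le _ _ _ _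

/-- the real-linear map `ξ ↦ ξ.re * u + ξ.im * v` -/
def rlin (u v : ℂ) : ℂ →L[ℝ] ℂ :=
  (Complex.ofRealCLM.comp Complex.reCLM).smulRight u + (Complex.ofRealCLM.comp Complex.imCLM).smulRight v

lemma rlin_apply (u v ξ : ℂ) : rlin u v ξ = ξ.re * u + ξ.im * v := rfl

lemma ech_hasFDerivAt (m : ℤ × ℤ) (z : ℂ) :
    HasFDerivAt (fun z => ech m z) (rlin (2 * Real.pi * Complex.I * ((m.1 : ℝ) : ℂ) * ech m z)
      (2 * Real.pi * Complex.I * ((m.2 : ℝ) : ℂ) * ech m z)) z := by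
  have h1 : HasFDerivAt (fun z : ℂ => 2 * Real.pi * Complex.I * ((m.1 : ℂ) * z.re + m.2 * z.im))
      (rlin (2 * Real.pi * Complex.I * (m.1 : ℂ)) (2 * Real.pi * Complex.I * (m.2 : ℂ))) z := by
    have := (rlin (2 * Real.pi * Complex.I * (m.1 : ℂ)) (2 * Real.pi * Complex.I * (m.2 : ℂ))).hasFDerivAt (x := z)
    convert this using 1
    ext w
    rw [rlin_apply]; ring
  have h2 := h1.cexp
  refine h2.congr_fderiv ?_
  ext1 ξ
  simp only [rlin_apply, ech, smul_apply, smul_eq_mul]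
  push_cast
  ring

lemma rlin_norm_le (u v : ℂ) : ‖rlin u v‖ ≤ ‖u‖ + ‖v‖ := by
  refine ContinuousLinearMap.opNorm_le_bound _ (by positivity) fun ξ => ?_
  rw [rlin_apply]
  refine (norm_add_le _ _).trans ?_
  rw [norm_mul, norm_mul, Complex.norm_real, Complex.norm_real, add_mul, mul_comm ‖u‖, mul_comm ‖v‖]
  gcongr
  · exact Complex.abs_re_le_norm ξ
  · exact Complex.abs_im_le_norm ξ

lemma ev_GG_hasFDerivAt (c : Wn) (z : ℂ) :
    HasFDerivAt (fun z => ev z (GG c)) (rlin (ev z (D1 c)) (ev z (D2 c))) z := by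
  have hb : ∀ m z, HasFDerivAt (fun z => GG c m * ech m z)
      (rlin (D1 c m * ech m z) (D2 c m * ech m z)) z := by
    intro m z
    have := (ech_hasFDerivAt m z).const_mul (GG c m)
    refine this.congr_fderiv ?_
    ext1 ξ
    simp only [rlin_apply, D1_apply, D2_apply, GG_apply, smul_apply, smul_eq_mul]
    ring
  have hsum : Summable fun m => ‖D1 c m‖ + ‖D2 c m‖ := (Wn_summable _).add (Wn_summable _)
  have := hasFDerivAt_tsum hsum hb (fun m z => by
    refine (rlin_norm_le _ _).trans ?_
    rw [norm_mul, norm_mul, ech_norm, mul_one, mul_one]) (ev_summable 0 (GG c)) z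
  refine this.congr_fderiv ?_
  ext1 ξ
  have hs1 := (ev_summable z (D1 c))
  have hs2 := (ev_summable z (D2 c))
  have hss : Summable fun m => rlin (D1 c m * ech m z) (D2 c m * ech m z) := by
    refine Summable.of_norm_bounded hsum fun m => ?_
    refine (rlin_norm_le _ _).trans ?_
    rw [norm_mul, norm_mul, ech_norm, mul_one, mul_one]
  have hts := (ContinuousLinearMap.apply ℝ ℂ ξ).map_tsum hss
  simp only [ContinuousLinearMap.apply_apply] at hts
  rw [hts]
  simp only [rlin_apply, ev_apply]
  rw [(hs1.mul_left _).tsum_add (hs2.mul_left _), tsum_mul_left, tsum_mul_left]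

lemma A_bound (x r w : ℝ) (hw : 0 < w) (h : |x| * w ≤ 2 * r) (hr : 0 ≤ r) :
    ‖(-Complex.I * x * w * ((2 * Real.pi * r)⁻¹ : ℝ) : ℂ)‖ ≤ 1 := by
  simp only [norm_mul, norm_neg, Complex.norm_real, Complex.norm_I, one_mul,
    Real.norm_eq_abs, abs_inv, abs_of_pos hw]
  rw [← div_eq_mul_inv]
  apply div_le_one_of_le₀ _ (by positivity)
  rw [abs_of_nonneg (show 0 ≤ 2 * Real.pi * r by positivity)]
  have := Real.pi_gt_three
  nlinarith

def rr (m : ℤ × ℤ) : ℝ := (m.1 : ℝ) ^ 2 + (m.2 : ℝ) ^ 2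

lemma rr_nonneg (m) : 0 ≤ rr m := by unfold rr; positivity

lemma rr_pos {m : ℤ × ℤ} (hm : m ≠ 0) : 0 < rr m := by
  unfold rr
  by_contra h
  apply hm
  have h1 : (m.1 : ℝ) = 0 := by nlinarith [sq_nonneg (m.1 : ℝ), sq_nonneg (m.2 : ℝ)]
  have h2 : (m.2 : ℝ) = 0 := by nlinarith [sq_nonneg (m.1 : ℝ), sq_nonneg (m.2 : ℝ)]
  ext
  · exact_mod_cast h1
  · exact_mod_cast h2

lemma wt_rr (m : ℤ × ℤ) (x : ℝ) (hx : |x| ≤ ‖m‖) : |x| * wt m ≤ 2 * rr m := by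
  have h0 : ‖m‖ ≤ ‖m‖ ^ 2 := by
    by_cases h : m = 0
    · simp [h]
    have : 1 ≤ ‖m‖ := by
      by_contra hc
      rw [not_le, Prod.norm_def, max_lt_iff, Int.norm_eq_abs, Int.norm_eq_abs] at hc
      have h1 : |m.1| < 1 := by exact_mod_cast hc.1
      have h2 : |m.2| < 1 := by exact_mod_cast hc.2
      exact h (Prod.ext (Int.abs_lt_one_iff.1 h1) (Int.abs_lt_one_iff.1 h2))
    nlinarith
  have h1 : ‖m‖ ^ 2 ≤ rr m := by
    rw [Prod.norm_def, Int.norm_eq_abs, Int.norm_eq_abs, rr]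
    rcases max_cases |(m.1:ℝ)| |(m.2:ℝ)| with h | h
    · rw [h.1, sq_abs]; nlinarith [sq_nonneg (m.2 : ℝ)]
    · rw [h.1, sq_abs]; nlinarith [sq_nonneg (m.1 : ℝ)]
  unfold wt
  nlinarith [norm_nonneg m, abs_nonneg x]

def A1 : Wn →L[ℂ] Wn := mulT (fun m => -Complex.I * ((m.1 : ℝ) : ℂ) * wt m * ((2 * Real.pi * rr m)⁻¹ : ℝ))
  1 (fun m => A_bound _ _ _ (wt_pos m) (wt_rr m _ (by
    rw [← Int.norm_eq_abs]; exact norm_fst_le m)) (rr_nonneg m))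

def A2 : Wn →L[ℂ] Wn := mulT (fun m => -Complex.I * ((m.2 : ℝ) : ℂ) * wt m * ((2 * Real.pi * rr m)⁻¹ : ℝ))
  1 (fun m => A_bound _ _ _ (wt_pos m) (wt_rr m _ (by
    rw [← Int.norm_eq_abs]; exact norm_snd_le m)) (rr_nonneg m))

lemma A1_apply (a : Wn) (m) :
  A1 a m = -Complex.I * ((m.1 : ℝ) : ℂ) * wt m * ((2 * Real.pi * rr m)⁻¹ : ℝ) * a m := rfl
lemma A2_apply (a : Wn) (m) :
  A2 a m = -Complex.I * ((m.2 : ℝ) : ℂ) * wt m * ((2 * Real.pi * rr m)⁻¹ : ℝ) * a m := rfl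
lemma A1_norm_le (a : Wn) : ‖A1 a‖ ≤ ‖a‖ := (mulT_norm_le _ 1 _ _).trans_eq (one_mul _)
lemma A2_norm_le (a : Wn) : ‖A2 a‖ ≤ ‖a‖ := (mulT_norm_le _ 1 _ _).trans_eq (one_mul _)

lemma DA_cross (a : Wn) : D1 (A2 a) = D2 (A1 a) := Wn_ext fun m => by
  simp only [D1_apply, D2_apply, A1_apply, A2_apply]; ring

lemma DA_sum (a : Wn) : D1 (A1 a) + D2 (A2 a) = a - (a 0) • (1 : Wn) := Wn_ext fun m => by
  simp only [D1_apply, D2_apply, A1_apply, A2_apply, Wn_add_apply, Wn_sub_apply, Wn_smul_apply,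
    Wn_one_apply]
  split_ifs with h
  · subst h; simp
  · have h1 : (rr m : ℂ) ≠ 0 := by exact_mod_cast (rr_pos h).ne'
    have h2 : (wt m : ℂ) ≠ 0 := by exact_mod_cast (wt_pos m).ne'
    have h3 : (Real.pi : ℂ) ≠ 0 := by exact_mod_cast Real.pi_ne_zero
    have h4 : (rr m : ℂ) = ((m.1 : ℝ) : ℂ) ^ 2 + ((m.2 : ℝ) : ℂ) ^ 2 := by
      unfold rr; push_cast; rfl
    push_cast at *
    field_simp
    rw [Complex.I_sq, h4]
    ring

lemma GG_one : GG 1 = 1 := Wn_ext fun m => by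
  rw [GG_apply, Wn_one_apply]
  split_ifs with h
  · subst h; simp [wt]
  · simp

lemma D1_one : D1 1 = 0 := Wn_ext fun m => by
  rw [D1_apply, Wn_one_apply, Wn_zero_apply]
  split_ifs with h
  · subst h; simp
  · simp

lemma D2_one : D2 1 = 0 := Wn_ext fun m => by
  rw [D2_apply, Wn_one_apply, Wn_zero_apply]
  split_ifs with h
  · subst h; simp
  · simp

/-- difference quotient functional -/
def dq (s : ℝ) : Wn →L[ℂ] ℂ := ((s : ℂ)⁻¹) • ((ev s).comp GG - (ev 0).comp GG)

lemma dq_apply (s : ℝ) (c : Wn) : dq s c = (s : ℂ)⁻¹ * (ev s (GG c) - ev 0 (GG c)) := rfl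

lemma dq_norm_le (s : ℝ) (c : Wn) : ‖dq s c‖ ≤ 4 * Real.pi * ‖c‖ := by
  have h : ‖ev s (GG c) - ev 0 (GG c)‖ ≤ (4 * Real.pi * ‖c‖) * ‖(s : ℂ) - 0‖ := by
    refine Convex.norm_image_sub_le_of_norm_hasFDerivWithin_le (𝕜 := ℝ) (f := fun z => ev z (GG c))
      (s := univ) (fun x _ => (ev_GG_hasFDerivAt c x).hasFDerivWithinAt) (fun x _ => ?_)
      convex_univ (mem_univ _) (mem_univ _)
    have := rlin_norm_le (ev x (D1 c)) (ev x (D2 c))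
    linarith [ev_norm_le x (D1 c), ev_norm_le x (D2 c), D1_norm_le c, D2_norm_le c]
  rw [dq_apply, norm_mul, norm_inv]
  rw [sub_zero] at h
  by_cases hs : s = 0
  · simp [hs]; positivity
  · have : 0 < ‖(s : ℂ)‖ := by simpa using hs
    rw [inv_mul_eq_div, div_le_iff₀ this]
    exact h

/-! ### Periodic extension of the coordinate functions -/

section coordinates

open scoped FourierTransform SchwartzMap ContDiff

lemma exists_q : ∃ q : ℤ → ℂ, (Summable fun n : ℤ => (1 + |(n : ℝ)|) * ‖q n‖) ∧
    ∀ x : ℝ, |x| < 1 / 4 → ∑' n : ℤ, q n * Complex.exp (2 * Real.pi * Complex.I * (n * x)) = x := by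
  let χ : ContDiffBump (0 : ℝ) := ⟨1 / 4, 1 / 2, by norm_num, by norm_num⟩
  have hsm : ContDiff ℝ ∞ (fun x : ℝ => ((x * χ x : ℝ) : ℂ)) :=
    Complex.ofRealCLM.contDiff.comp (contDiff_id.mul χ.contDiff)
  have hcs : HasCompactSupport (fun x : ℝ => ((x * χ x : ℝ) : ℂ)) := by
    have h1 : HasCompactSupport (fun x : ℝ => x * χ x) :=
      HasCompactSupport.mul_left (f := fun x : ℝ => x) χ.hasCompactSupport
    exact h1.comp_left (g := fun y : ℝ => (y : ℂ)) Complex.ofReal_zero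
  let f : 𝓢(ℝ, ℂ) := hcs.toSchwartzMap hsm
  have hf : ∀ x, f x = ((x * χ x : ℝ) : ℂ) := fun x => rfl
  refine ⟨fun n => (𝓕 f) (n : ℝ), ?_, ?_⟩
  · obtain ⟨C, hC⟩ : ∃ C : ℝ, ∀ x : ℝ, (1 + ‖x‖) ^ 3 * ‖(𝓕 f) x‖ ≤ C := ⟨_, fun x => by
      have := SchwartzMap.one_add_le_sup_seminorm_apply (𝕜 := ℝ) (m := (3, 0)) (k := 3) (n := 0)
        le_rfl le_rfl (𝓕 f) x
      simpa using this⟩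
    have hs : Summable fun n : ℤ => C * (1 / (n : ℝ) ^ 2) :=
      (Real.summable_one_div_int_pow.2 (by norm_num)).mul_left C
    refine Summable.of_norm_bounded_eventually hs ?_
    have : ∀ᶠ n : ℤ in cofinite, n ≠ 0 := by
      rw [Filter.eventually_cofinite]; simp
    filter_upwards [this] with n hn
    have h0 : (0:ℝ) < |(n : ℝ)| := by simpa using hn
    rw [Real.norm_of_nonneg (by positivity), mul_one_div, ← sq_abs, le_div_iff₀ (by positivity)]
    refine le_trans ?_ (hC n)
    rw [Real.norm_eq_abs]
    have : |(n:ℝ)| ^ 2 ≤ (1 + |(n : ℝ)|) ^ 2 := by gcongr; linarith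
    calc _ ≤ (1 + |(n : ℝ)|) * ‖(𝓕 f) (n : ℝ)‖ * (1 + |(n : ℝ)|) ^ 2 := by gcongr
      _ = _ := by ring
  · intro x hx
    have h := SchwartzMap.tsum_eq_tsum_fourier f x
    have h1 : ∑' n : ℤ, f (x + n) = x := by
      rw [tsum_eq_single 0]
      · rw [hf]
        have : χ x = 1 := χ.one_of_mem_closedBall (by
          rw [mem_closedBall, Real.dist_eq, sub_zero]; exact hx.le)
        simp [this]
      · intro n hn
        rw [hf]
        have : χ (x + n) = 0 := χ.zero_of_le_dist (by
          change 1 / 2 ≤ _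
          rw [Real.dist_eq, sub_zero]
          have h1 : (1 : ℝ) ≤ |(n : ℝ)| := by
            rw [← Int.cast_abs]; exact_mod_cast Int.one_le_abs hn
          have h2 : |(n : ℝ)| ≤ |x + n| + |x| := by
            have := abs_sub (x + n) x
            simpa using this
          linarith)
        simp [this]
    rw [h1] at h
    refine Eq.trans ?_ h.symm
    refine tsum_congr fun n => ?_
    rw [fourier_coe_apply]
    congr 2
    simp
    ring

lemma exists_Q (ι : ℤ → ℤ × ℤ) (hι : Function.Injective ι) (hn : ∀ n, ‖ι n‖ = |(n : ℝ)|)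
    (L : ℂ → ℝ) (hL : ∀ n z, ech (ι n) z = Complex.exp (2 * Real.pi * Complex.I * (n * L z))) :
    ∃ Q : Wn, (∀ z, |L z| < 1 / 4 → ev z (GG Q) = L z) ∧ ∀ m, m ∉ range ι → Q m = 0 := by
  obtain ⟨q, hq, hx⟩ := exists_q
  let c : ℤ × ℤ → ℂ := Function.extend ι (fun n => ((1 + |(n : ℝ)| : ℝ) : ℂ) * q n) 0
  have hc : ∀ n, c (ι n) = ((1 + |(n : ℝ)| : ℝ) : ℂ) * q n := fun n => hι.extend_apply _ _ _
  have hc0 : ∀ m, m ∉ range ι → c m = 0 := fun m hm => by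
    exact Function.extend_apply' _ _ _ (by simpa using hm)
  have hs : Summable fun m => ‖c m‖ := by
    rw [← hι.summable_iff (fun m hm => by rw [hc0 m hm, norm_zero])]
    refine hq.congr fun n => ?_
    simp only [Function.comp, hc, norm_mul, Complex.norm_real]
    rw [Real.norm_of_nonneg (by positivity)]
  refine ⟨Wmk c hs, fun z hz => ?_, hc0⟩
  rw [← hx _ hz, ev_apply, ← hι.tsum_eq]
  · refine tsum_congr fun n => ?_
    rw [GG_apply, Wmk_apply, hc, hL, wt, hn, ← mul_assoc, ← Complex.ofReal_mul,
      inv_mul_cancel₀ (by positivity)]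
    simp
  · intro m hm
    by_contra h
    apply hm
    show _ * _ = _
    rw [GG_apply, Wmk_apply, hc0 m h]; simp

end coordinates

lemma exists_Qx : ∃ Q : Wn, (∀ z : ℂ, |z.re| < 1 / 4 → ev z (GG Q) = z.re) ∧ D2 Q = 0 := by
  obtain ⟨Q, h1, h2⟩ := exists_Q (fun n => (n, 0)) (fun a b h => by simpa using h)
    (fun n => by simp [Prod.norm_def, Int.norm_eq_abs]) Complex.re (fun n z => by simp [ech])
  refine ⟨Q, h1, Wn_ext fun m => ?_⟩
  rw [D2_apply, Wn_zero_apply]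
  by_cases h : m.2 = 0
  · simp [h]
  · rw [h2 m, mul_zero]
    rintro ⟨n, rfl⟩; simp at h

lemma exists_Qy : ∃ Q : Wn, (∀ z : ℂ, |z.im| < 1 / 4 → ev z (GG Q) = z.im) ∧ D1 Q = 0 := by
  obtain ⟨Q, h1, h2⟩ := exists_Q (fun n => (0, n)) (fun a b h => by simpa using h)
    (fun n => by simp [Prod.norm_def, Int.norm_eq_abs]) Complex.im (fun n z => by simp [ech])
  refine ⟨Q, h1, Wn_ext fun m => ?_⟩
  rw [D1_apply, Wn_zero_apply]
  by_cases h : m.1 = 0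
  · simp [h]
  · rw [h2 m, mul_zero]
    rintro ⟨n, rfl⟩; simp at h

def Qx : Wn := exists_Qx.choose
def Qy : Wn := exists_Qy.choose

lemma Qx_ev (z : ℂ) (hz : ‖z‖ < 1 / 4) : ev z (GG Qx) = z.re :=
  exists_Qx.choose_spec.1 z ((Complex.abs_re_le_norm z).trans_lt hz)
lemma Qy_ev (z : ℂ) (hz : ‖z‖ < 1 / 4) : ev z (GG Qy) = z.im :=
  exists_Qy.choose_spec.1 z ((Complex.abs_im_le_norm z).trans_lt hz)
lemma D2_Qx : D2 Qx = 0 := exists_Qx.choose_spec.2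
lemma D1_Qy : D1 Qy = 0 := exists_Qy.choose_spec.2

lemma D1_Qx (z : ℂ) (hz : ‖z‖ < 1 / 4) : ev z (D1 Qx) = 1 := by
  have h1 := ev_GG_hasFDerivAt Qx z
  have h2 : HasFDerivAt (fun z : ℂ => (z.re : ℂ)) (rlin 1 0) z := by
    have := (rlin 1 0).hasFDerivAt (x := z)
    refine this.congr_of_eventuallyEq (Eventually.of_forall fun w => ?_)
    simp [rlin_apply]
  have h3 : (fun z : ℂ => (z.re : ℂ)) =ᶠ[𝓝 z] fun z => ev z (GG Qx) := by
    filter_upwards [isOpen_ball.mem_nhds (show z ∈ ball (0:ℂ) (1 / 4) by simpa using hz)] with w hw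
    rw [Qx_ev w (by simpa using hw)]
  have h4 := (h1.congr_of_eventuallyEq h3).unique h2
  have h5 := congrArg (fun T : ℂ →L[ℝ] ℂ => T 1) h4
  simpa [rlin_apply] using h5

lemma D2_Qy (z : ℂ) (hz : ‖z‖ < 1 / 4) : ev z (D2 Qy) = 1 := by
  have h1 := ev_GG_hasFDerivAt Qy z
  have h2 : HasFDerivAt (fun z : ℂ => (z.im : ℂ)) (rlin 0 1) z := by
    have := (rlin 0 1).hasFDerivAt (x := z)
    refine this.congr_of_eventuallyEq (Eventually.of_forall fun w => ?_)
    simp [rlin_apply]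
  have h3 : (fun z : ℂ => (z.im : ℂ)) =ᶠ[𝓝 z] fun z => ev z (GG Qy) := by
    filter_upwards [isOpen_ball.mem_nhds (show z ∈ ball (0:ℂ) (1 / 4) by simpa using hz)] with w hw
    rw [Qy_ev w (by simpa using hw)]
  have h4 := (h1.congr_of_eventuallyEq h3).unique h2
  have h5 := congrArg (fun T : ℂ →L[ℝ] ℂ => T Complex.I) h4
  simpa [rlin_apply] using h5

/-! ### The fixed point argument -/

section fixedpoint

open scoped SchwartzMap

variable {κ : Type} [Fintype κ]

def liftW (T : Wn →L[ℂ] Wn) : (κ → Wn) →L[ℂ] (κ → Wn) :=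
  ContinuousLinearMap.pi fun i => T.comp (ContinuousLinearMap.proj i)

lemma liftW_apply (T : Wn →L[ℂ] Wn) (w : κ → Wn) (i) : liftW T w i = T (w i) := rfl

lemma liftW_norm_le (T : Wn →L[ℂ] Wn) (C : ℝ) (hC : 0 ≤ C) (h : ∀ a, ‖T a‖ ≤ C * ‖a‖) (w : κ → Wn) :
    ‖liftW T w‖ ≤ C * ‖w‖ := by
  rw [pi_norm_le_iff_of_nonneg (by positivity)]
  intro i
  rw [liftW_apply]
  exact (h _).trans (by gcongr; exact norm_le_pi_norm w i)

def matW (J0 : κ → κ → ℝ) : (κ → Wn) →L[ℂ] (κ → Wn) :=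
  ContinuousLinearMap.pi fun i => ∑ j, (J0 i j : ℂ) • ContinuousLinearMap.proj j

lemma matW_apply (J0 : κ → κ → ℝ) (w : κ → Wn) (i) : matW J0 w i = ∑ j, (J0 i j : ℂ) • w j := by
  simp [matW]

def cst (x : κ → ℝ) (Q : Wn) : κ → Wn := fun i => (x i : ℂ) • Q

lemma cst_norm_le (x : κ → ℝ) (Q : Wn) : ‖cst x Q‖ ≤ ‖x‖ * ‖Q‖ := by
  rw [pi_norm_le_iff_of_nonneg (by positivity)]
  intro i
  rw [cst, norm_smul, Complex.norm_real]
  gcongr; exact norm_le_pi_norm x i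

def co0 : Wn →L[ℂ] ℂ := LinearMap.mkContinuous
  { toFun := fun a => a 0, map_add' := fun _ _ => rfl, map_smul' := fun _ _ => rfl } 1
  (fun a => by rw [one_mul]; exact Wn_apply_le a 0)

lemma co0_apply (a : Wn) : co0 a = a 0 := rfl

def cfW (J0 : κ → κ → ℝ) : (κ → Wn) →L[ℂ] (κ → Wn) :=
  liftW A2 + (matW J0).comp (liftW A1) + liftW (co0.smulRight Qy)

lemma cfW_apply (J0 : κ → κ → ℝ) (w : κ → Wn) (i) :
    cfW J0 w i = A2 (w i) + ∑ j, (J0 i j : ℂ) • A1 (w j) + (w i 0) • Qy := by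
  simp only [cfW, add_apply, ContinuousLinearMap.comp_apply, Pi.add_apply, liftW_apply, matW_apply]
  rfl

def corW (J0 : κ → κ → ℝ) (s : ℝ) : (κ → Wn) →L[ℂ] (κ → Wn) :=
  ContinuousLinearMap.id ℂ _ - liftW (((ev 0).comp GG).smulRight 1) - liftW ((dq s).smulRight Qx)
    - (matW J0).comp (liftW ((dq s).smulRight Qy))

lemma corW_apply (J0 : κ → κ → ℝ) (s : ℝ) (c : κ → Wn) (i) :
    corW J0 s c i = c i - ev 0 (GG (c i)) • (1 : Wn) - dq s (c i) • Qx -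
      ∑ j, (J0 i j : ℂ) • (dq s (c j) • Qy) := by
  simp only [corW, sub_apply, ContinuousLinearMap.comp_apply, Pi.sub_apply, liftW_apply, matW_apply]
  rfl

lemma corW_norm_le (J0 : κ → κ → ℝ) : ∃ L : ℝ, 0 ≤ L ∧ ∀ s c, ‖corW J0 s c‖ ≤ L * ‖c‖ := by
  refine ⟨1 + 1 + 4 * Real.pi * ‖Qx‖ + ‖matW J0‖ * (4 * Real.pi * ‖Qy‖), by positivity, fun s c => ?_⟩
  have h1 : ‖liftW (((ev 0).comp GG).smulRight 1) c‖ ≤ 1 * ‖c‖ :=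
    liftW_norm_le _ 1 zero_le_one (fun a => by
      rw [ContinuousLinearMap.smulRight_apply, norm_smul, norm_one, mul_one, one_mul]
      exact (ev_norm_le 0 _).trans (GG_norm_le a)) c
  have h2 : ∀ Q, ‖liftW ((dq s).smulRight Q) c‖ ≤ (4 * Real.pi * ‖Q‖) * ‖c‖ := fun Q =>
    liftW_norm_le _ _ (by positivity) (fun a => by
      rw [ContinuousLinearMap.smulRight_apply, norm_smul]
      nlinarith [dq_norm_le s a, norm_nonneg Q]) c
  have h3 : ‖matW J0 (liftW ((dq s).smulRight Qy) c)‖ ≤ ‖matW J0‖ * ((4 * Real.pi * ‖Qy‖) * ‖c‖) :=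
    ((matW J0).le_opNorm _).trans (by gcongr; exact h2 Qy)
  have h4 : corW J0 s c = c - liftW (((ev 0).comp GG).smulRight 1) c - liftW ((dq s).smulRight Qx) c
    - matW J0 (liftW ((dq s).smulRight Qy) c) := rfl
  rw [h4]
  refine (norm_sub_le _ _).trans ?_
  refine (add_le_add_left ((norm_sub_le _ _).trans (add_le_add_left (norm_sub_le _ _) _)) _).trans ?_
  linarith [h2 Qx]

def NN (φ : κ → κ → 𝓢(EuclideanSpace ℝ κ, ℂ)) (d : κ → Wn) : κ → Wn :=
  fun i => ∑ j, FCal (φ i j) d * D1 (d j)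

lemma NN_zero (φ : κ → κ → 𝓢(EuclideanSpace ℝ κ, ℂ)) : NN φ 0 = 0 := by
  ext1 i; simp [NN]

lemma NN_lip (φ : κ → κ → 𝓢(EuclideanSpace ℝ κ, ℂ)) (hφ : ∀ i j, φ i j 0 = 0) :
    ∃ M : ℝ, 0 ≤ M ∧ ∀ ρ : ℝ, ρ ≤ 1 → ∀ d d' : κ → Wn, ‖d‖ ≤ ρ → ‖d'‖ ≤ ρ →
      ‖NN φ d - NN φ d'‖ ≤ M * ρ * ‖d - d'‖ := by
  choose K hK0 hK using fun i j => FCal_lip (φ i j)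
  have hF0 : ∀ i j, FCal (φ i j) 0 = 0 := fun i j => ev_inj fun z => by
    rw [FCal_ev _ _ (by simp)]
    have : (WithLp.toLp 2 fun k : κ => (ev z (GG ((0 : κ → Wn) k))).re) = 0 := by
      ext k; simp
    rw [this, hφ, map_zero]
  have hFb : ∀ i j d, ‖d‖ ≤ 1 → ‖FCal (φ i j) d‖ ≤ K i j * ‖d‖ := fun i j d hd => by
    have := hK i j d 0 hd (by simp)
    rwa [hF0, sub_zero, sub_zero] at this
  refine ⟨∑ i, ∑ j, K i j * (4 * Real.pi), Finset.sum_nonneg fun i _ => Finset.sum_nonneg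
    fun j _ => mul_nonneg (hK0 i j) (by positivity), fun ρ hρ d d' hd hd' => ?_⟩
  have hρ0 : 0 ≤ ρ := (norm_nonneg d).trans hd
  have hn : 0 ≤ ∑ i, ∑ j, K i j * (4 * Real.pi) := Finset.sum_nonneg fun i _ => Finset.sum_nonneg
    fun j _ => mul_nonneg (hK0 i j) (by positivity)
  rw [pi_norm_le_iff_of_nonneg (by positivity)]
  intro i
  have hij : ∀ j, ‖FCal (φ i j) d * D1 (d j) - FCal (φ i j) d' * D1 (d' j)‖ ≤
      K i j * (4 * Real.pi) * ρ * ‖d - d'‖ := by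
    intro j
    have e : FCal (φ i j) d * D1 (d j) - FCal (φ i j) d' * D1 (d' j) =
      (FCal (φ i j) d - FCal (φ i j) d') * D1 (d j) + FCal (φ i j) d' * D1 (d j - d' j) := by
      rw [map_sub]; ring
    rw [e]
    have hKK := hK0 i j
    have a1 : ‖D1 (d j)‖ ≤ 2 * Real.pi * ρ :=
      (D1_norm_le _).trans (by gcongr; exact (norm_le_pi_norm d j).trans hd)
    have a2 : ‖D1 (d j - d' j)‖ ≤ 2 * Real.pi * ‖d - d'‖ :=
      (D1_norm_le _).trans (by gcongr; exact norm_le_pi_norm (d - d') j)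
    have a3 := hK i j d d' (hd.trans hρ) (hd'.trans hρ)
    have a4 : ‖FCal (φ i j) d'‖ ≤ K i j * ρ := (hFb i j d' (hd'.trans hρ)).trans (by gcongr)
    calc _ ≤ ‖FCal (φ i j) d - FCal (φ i j) d'‖ * ‖D1 (d j)‖ +
          ‖FCal (φ i j) d'‖ * ‖D1 (d j - d' j)‖ :=
          (norm_add_le _ _).trans (add_le_add (norm_mul_le _ _) (norm_mul_le _ _))
      _ ≤ (K i j * ‖d - d'‖) * (2 * Real.pi * ρ) + (K i j * ρ) * (2 * Real.pi * ‖d - d'‖) := by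
          gcongr
      _ = _ := by ring
  rw [Pi.sub_apply, NN, NN, ← Finset.sum_sub_distrib]
  refine (norm_sum_le _ _).trans ((Finset.sum_le_sum fun j _ => hij j).trans ?_)
  rw [← Finset.sum_mul, ← Finset.sum_mul]
  refine mul_le_mul_of_nonneg_right (mul_le_mul_of_nonneg_right ?_ hρ0) (norm_nonneg _)
  exact Finset.single_le_sum (f := fun i => ∑ j, K i j * (4 * Real.pi))
    (fun i _ => Finset.sum_nonneg fun j _ => mul_nonneg (hK0 i j) (by positivity)) (Finset.mem_univ i)

lemma fixed_pt (L C0 M : ℝ) (hL : 0 ≤ L) (hC0 : 0 ≤ C0) (hM : 0 ≤ M) (ε : ℝ) (hε : 0 < ε)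
    (N : (κ → Wn) → (κ → Wn)) (hN0 : N 0 = 0)
    (hN : ∀ ρ : ℝ, ρ ≤ 1 → ∀ d d' : κ → Wn, ‖d‖ ≤ ρ → ‖d'‖ ≤ ρ → ‖N d - N d'‖ ≤ M * ρ * ‖d - d'‖) :
    ∃ η : ℝ, 0 < η ∧ ∀ (Λ : (κ → Wn) →L[ℂ] (κ → Wn)) (d0 : κ → Wn), (∀ w, ‖Λ w‖ ≤ L * ‖w‖) →
      ‖d0‖ ≤ C0 * η → ∃ w, ‖d0 + Λ w‖ ≤ ε ∧ N (d0 + Λ w) = w := by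
  obtain ⟨ρ, hρ0, hρε, hρ1, hρM⟩ : ∃ ρ : ℝ, 0 < ρ ∧ ρ ≤ ε ∧ ρ ≤ 1 ∧ M * ρ * L ≤ 1 / 2 := by
    refine ⟨min (min ε 1) (1 / (2 * (M * L + 1))), by positivity, (min_le_left _ _).trans (min_le_left _ _),
      (min_le_left _ _).trans (min_le_right _ _), ?_⟩
    have h := min_le_right (min ε 1) (1 / (2 * (M * L + 1)))
    rw [le_div_iff₀ (by positivity)] at h
    have h0 : 0 < min (min ε 1) (1 / (2 * (M * L + 1))) := by positivity
    nlinarith [mul_nonneg hM hL]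
  obtain ⟨τ, hτ0, hτ⟩ : ∃ τ : ℝ, 0 < τ ∧ L * τ ≤ ρ / 2 := by
    refine ⟨ρ / (2 * (L + 1)), by positivity, ?_⟩
    rw [mul_div_assoc', div_le_div_iff₀ (by positivity) (by positivity)]
    nlinarith
  obtain ⟨η, hη0, hη1, hη2⟩ : ∃ η : ℝ, 0 < η ∧ C0 * η ≤ ρ / 2 ∧ M * ρ * (C0 * η) ≤ τ / 2 := by
    refine ⟨min (ρ / (2 * (C0 + 1))) (τ / (2 * (M * ρ * C0 + 1))), by positivity, ?_, ?_⟩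
    · have h := min_le_left (ρ / (2 * (C0 + 1))) (τ / (2 * (M * ρ * C0 + 1)))
      rw [le_div_iff₀ (by positivity)] at h
      have h0 : 0 < min (ρ / (2 * (C0 + 1))) (τ / (2 * (M * ρ * C0 + 1))) := by positivity
      nlinarith
    · have h := min_le_right (ρ / (2 * (C0 + 1))) (τ / (2 * (M * ρ * C0 + 1)))
      rw [le_div_iff₀ (by positivity)] at h
      have h0 : 0 < min (ρ / (2 * (C0 + 1))) (τ / (2 * (M * ρ * C0 + 1))) := by positivity
      nlinarith
  refine ⟨η, hη0, fun Λ d0 hΛ hd0 => ?_⟩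
  have hd : ∀ w, ‖w‖ ≤ τ → ‖d0 + Λ w‖ ≤ ρ := fun w hw => by
    refine (norm_add_le _ _).trans ?_
    have : L * ‖w‖ ≤ L * τ := by gcongr
    linarith [hΛ w]
  have hmaps : MapsTo (fun w => N (d0 + Λ w)) (closedBall 0 τ) (closedBall 0 τ) := by
    intro w hw
    rw [mem_closedBall_zero_iff] at hw ⊢
    have h1 := hN ρ hρ1 (d0 + Λ w) 0 (hd w hw) (by simpa using hρ0.le)
    rw [hN0, sub_zero, sub_zero] at h1
    have h2 : ‖d0 + Λ w‖ ≤ C0 * η + L * τ := by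
      refine (norm_add_le _ _).trans ?_
      have : L * ‖w‖ ≤ L * τ := by gcongr
      linarith [hΛ w]
    calc _ ≤ M * ρ * (C0 * η + L * τ) := h1.trans (by gcongr)
      _ = M * ρ * (C0 * η) + M * ρ * L * τ := by ring
      _ ≤ τ / 2 + 1 / 2 * τ := by gcongr
      _ = τ := by ring
  have hcontr : ContractingWith (1 / 2) (hmaps.restrict _ _ _) := by
    refine ⟨by rw [← NNReal.coe_lt_coe]; norm_num, LipschitzWith.of_dist_le_mul fun u v => ?_⟩
    rw [Subtype.dist_eq, Subtype.dist_eq, dist_eq_norm, dist_eq_norm]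
    simp only [MapsTo.val_restrict_apply]
    have hu := mem_closedBall_zero_iff.1 u.2
    have hv := mem_closedBall_zero_iff.1 v.2
    have h1 := hN ρ hρ1 _ _ (hd _ hu) (hd _ hv)
    rw [add_sub_add_left_eq_sub, ← map_sub] at h1
    push_cast
    calc _ ≤ M * ρ * (L * ‖(u : κ → Wn) - v‖) := h1.trans (by gcongr; exact hΛ _)
      _ = M * ρ * L * ‖(u : κ → Wn) - v‖ := by ring
      _ ≤ _ := by gcongr
  obtain ⟨w, hw, hfix, -⟩ := ContractingWith.exists_fixedPoint' (isClosed_closedBall.isComplete)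
    hmaps hcontr (x := 0) (by simpa using hτ0.le) (edist_ne_top _ _)
  exact ⟨w, (hd w (mem_closedBall_zero_iff.1 hw)).trans hρε, hfix⟩

lemma pde_solve [DecidableEq κ] (J0 : κ → κ → ℝ)
    (hJ0 : ∀ i k, ∑ j, J0 i j * J0 j k = if i = k then -1 else 0)
    (φ : κ → κ → 𝓢(EuclideanSpace ℝ κ, ℂ)) (hφ : ∀ i j, φ i j 0 = 0) (ε : ℝ) (hε : 0 < ε)
    (hε1 : ε ≤ 1) :
    ∃ η : ℝ, 0 < η ∧ ∀ (s : ℝ) (x v : κ → ℝ), 0 < s → s < 1 / 4 → ‖x‖ ≤ η → ‖v‖ ≤ η →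
      ∃ d : κ → Wn, ‖d‖ ≤ ε ∧ (∀ i, ev 0 (GG (d i)) = x i) ∧
        (∀ i, ev s (GG (d i)) = (x i + s * v i : ℝ)) ∧
        ∀ z : ℂ, ‖z‖ < 1 / 4 → ∀ i, ev z (D2 (d i)) =
          ∑ j, (J0 i j + φ i j (WithLp.toLp 2 fun k => (ev z (GG (d k))).re)) * ev z (D1 (d j)) := by
  obtain ⟨M, hM0, hM⟩ := NN_lip φ hφ
  obtain ⟨L, hL0, hL⟩ := corW_norm_le J0
  obtain ⟨η, hη0, hη⟩ := fixed_pt (L * ‖cfW J0‖) (1 + ‖Qx‖ + ‖matW J0‖ * ‖Qy‖) M (by positivity)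
    (by positivity) hM0 ε hε (NN φ) (NN_zero φ) hM
  refine ⟨η, hη0, fun s x v hs0 hs1 hx hv => ?_⟩
  obtain ⟨w, hwε, hw⟩ := hη ((corW J0 s).comp (cfW J0))
    (cst x 1 + cst v Qx + matW J0 (cst v Qy)) (fun w => by
      refine (hL s _).trans ?_
      rw [mul_assoc]
      gcongr
      exact (cfW J0).le_opNorm w) (by
      have h1 := cst_norm_le x 1
      have h2 := cst_norm_le v Qx
      have h3 := (matW J0).le_opNorm (cst v Qy)
      have h4 : ‖matW J0‖ * ‖cst v Qy‖ ≤ ‖matW J0‖ * (η * ‖Qy‖) := by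
        gcongr; exact (cst_norm_le v Qy).trans (by gcongr)
      have h5 : ‖v‖ * ‖Qx‖ ≤ η * ‖Qx‖ := by gcongr
      rw [norm_one, mul_one] at h1
      refine (norm_add_le _ _).trans ((add_le_add_left (norm_add_le _ _) _).trans ?_)
      linarith)
  set c := cfW J0 w with hc
  set d := cst x 1 + cst v Qx + matW J0 (cst v Qy) + ((corW J0 s).comp (cfW J0)) w with hd
  have hdi : ∀ i, d i = (x i : ℂ) • (1 : Wn) + (v i : ℂ) • Qx + ∑ j, (J0 i j : ℂ) • ((v j : ℂ) • Qy) +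
      (c i - ev 0 (GG (c i)) • (1 : Wn) - dq s (c i) • Qx -
      ∑ j, (J0 i j : ℂ) • (dq s (c j) • Qy)) := by
    intro i
    rw [← corW_apply, hd, Pi.add_apply, Pi.add_apply, Pi.add_apply, matW_apply]
    rfl
  have hz0 : ‖(0:ℂ)‖ < 1 / 4 := by simp
  have hzs : ‖(s:ℂ)‖ < 1 / 4 := by rw [Complex.norm_real, Real.norm_of_nonneg hs0.le]; exact hs1
  refine ⟨d, hwε, fun i => ?_, fun i => ?_, fun z hz i => ?_⟩
  · rw [hdi]
    simp only [map_add, map_sub, map_sum, map_smul, GG_one, ev_one, Qx_ev _ hz0, Qy_ev _ hz0]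
    simp
  · rw [hdi]
    simp only [map_add, map_sub, map_sum, map_smul, GG_one, ev_one, Qx_ev _ hzs, Qy_ev _ hzs]
    have : (s : ℂ) ≠ 0 := by exact_mod_cast hs0.ne'
    simp [dq_apply]
    field_simp
    ring
  · have hwz : ev z (w i) = ∑ j, φ i j (WithLp.toLp 2 fun k => (ev z (GG (d k))).re) * ev z (D1 (d j)) := by
      conv_lhs => rw [← hw]
      rw [NN, map_sum]
      refine Finset.sum_congr rfl fun j _ => ?_
      rw [ev_mul, FCal_ev _ _ (hwε.trans hε1)]
    simp only [add_mul, Finset.sum_add_distrib]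
    rw [← hwz]
    have e1 : ∀ i, ev z (D1 (d i)) = v i + ev z (D1 (c i)) - dq s (c i) := by
      intro i
      rw [hdi]
      simp only [map_add, map_sub, map_sum, map_smul, D1_one, D1_Qy, D1_Qx z hz]
      simp
      ring
    have e2 : ev z (D2 (d i)) = ∑ j, (J0 i j : ℂ) * v j + ev z (D2 (c i)) -
        ∑ j, (J0 i j : ℂ) * dq s (c j) := by
      rw [hdi]
      simp only [map_add, map_sub, map_sum, map_smul, D2_one, D2_Qx, D2_Qy z hz]
      simp
      ring
    have e3 : ev z (D2 (c i)) = ∑ j, (J0 i j : ℂ) * ev z (D1 (c j)) + ev z (w i) := by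
      have f1 : ∀ j, ev z (D1 (c j)) = ev z (D1 (A2 (w j))) + ∑ k, (J0 j k : ℂ) * ev z (D1 (A1 (w k))) := by
        intro j
        rw [hc, cfW_apply]
        simp only [map_add, map_sum, map_smul, D1_Qy]
        simp
      have f2 : ev z (D2 (c i)) = ev z (D2 (A2 (w i))) + ∑ j, (J0 i j : ℂ) * ev z (D1 (A2 (w j))) + w i 0 := by
        rw [hc, cfW_apply]
        simp only [map_add, map_sum, map_smul, D2_Qy z hz, DA_cross]
        simp
      have f3 : ev z (D1 (A1 (w i))) + ev z (D2 (A2 (w i))) = ev z (w i) - w i 0 := by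
        rw [← map_add, DA_sum, map_sub, map_smul, ev_one]; simp
      have f4 : ∑ j, (J0 i j : ℂ) * ∑ k, (J0 j k : ℂ) * ev z (D1 (A1 (w k))) = - ev z (D1 (A1 (w i))) := by
        simp only [Finset.mul_sum, ← mul_assoc]
        rw [Finset.sum_comm]
        simp only [← Finset.sum_mul]
        have : ∀ k, ∑ j, (J0 i j : ℂ) * (J0 j k : ℂ) = if i = k then -1 else 0 := fun k => by
          have := congrArg (fun r : ℝ => (r : ℂ)) (hJ0 i k)
          simp only [Complex.ofReal_sum, Complex.ofReal_mul] at this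
          rw [this]; split_ifs <;> simp
        simp [this]
      rw [f2]
      simp only [f1, mul_add, Finset.sum_add_distrib, f4]
      linear_combination f3
    rw [e2, e3]
    simp only [e1, mul_add, mul_sub, Finset.sum_add_distrib, Finset.sum_sub_distrib]
    ring

end fixedpoint

/-! ### The local disc lemma -/

section localdisc

open scoped SchwartzMap ContDiff

lemma euclid_mat {κ : Type} [Fintype κ] [DecidableEq κ]
    (S : EuclideanSpace ℝ κ →L[ℝ] EuclideanSpace ℝ κ) (u : EuclideanSpace ℝ κ) (i : κ) :
    S u i = ∑ j, S (EuclideanSpace.single j 1) i * u j := by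
  have h : u = ∑ j, u j • EuclideanSpace.single j (1 : ℝ) := by
    ext k; simp [Pi.single_apply]
  conv_lhs => rw [h]
  rw [map_sum]
  simp [mul_comm]

lemma holo_rescale (n : ℕ) (Ω : Set (Cn n)) (J : Cn n → (Cn n →L[ℝ] Cn n)) (g : ℂ → Cn n)
    (h : IsJHolomorphicOn n Ω J (1 / 4) g) :
    IsJHolomorphicOn n Ω J 1 (fun z => g ((1 / 4 : ℂ) * z)) := by
  have hm : ∀ z ∈ ball (0:ℂ) 1, (1 / 4 : ℂ) * z ∈ ball (0:ℂ) (1 / 4) := by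
    intro z hz
    rw [mem_ball_zero_iff] at hz ⊢
    rw [norm_mul]; norm_num; linarith
  refine ⟨fun z hz => h.1 (hm z hz), fun z hz => ?_⟩
  obtain ⟨h1, h2⟩ := h.2 _ (hm z hz)
  have h3 : HasFDerivAt (fun z : ℂ => (1 / 4 : ℂ) * z)
      ((ContinuousLinearMap.mul ℝ ℂ) (1 / 4 : ℂ)) z :=
    ((ContinuousLinearMap.mul ℝ ℂ) (1 / 4 : ℂ)).hasFDerivAt
  have h4 : HasFDerivAt (fun z => g ((1 / 4 : ℂ) * z))
    ((fderiv ℝ g ((1 / 4 : ℂ) * z)).comp ((ContinuousLinearMap.mul ℝ ℂ) (1 / 4 : ℂ))) z :=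
    h1.hasFDerivAt.comp z h3
  refine ⟨h4.differentiableAt, fun ξ => ?_⟩
  rw [h4.fderiv]
  simp only [ContinuousLinearMap.comp_apply, ContinuousLinearMap.mul_apply']
  rw [← h2]
  congr 1; ring

lemma disc_holo (n : ℕ) (Ω : Set (Cn n)) (J : Cn n → (Cn n →L[ℝ] Cn n)) {κ : Type} [Fintype κ]
    (Φ : Cn n ≃L[ℝ] EuclideanSpace ℝ κ) (p : Cn n) (hJ : IsAlmostComplexOn n Ω J) (d : κ → Wn)
    (hΩ : ∀ z : ℂ, ‖z‖ < 1 / 4 → p + Φ.symm (WithLp.toLp 2 fun k => (ev z (GG (d k))).re) ∈ Ω)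
    (hpde : ∀ z : ℂ, ‖z‖ < 1 / 4 → (WithLp.toLp 2 fun k => (ev z (D2 (d k))).re) =
      Φ (J (p + Φ.symm (WithLp.toLp 2 fun k => (ev z (GG (d k))).re))
        (Φ.symm (WithLp.toLp 2 fun k => (ev z (D1 (d k))).re)))) :
    IsJHolomorphicOn n Ω J (1 / 4)
      (fun z => p + Φ.symm (WithLp.toLp 2 fun k => (ev z (GG (d k))).re)) := by
  refine ⟨fun z hz => hΩ z (by simpa using hz), fun z hz => ?_⟩
  have hz' : ‖z‖ < 1 / 4 := by simpa using hz
  set y1 : EuclideanSpace ℝ κ := WithLp.toLp 2 fun k => (ev z (D1 (d k))).re with hy1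
  set y2 : EuclideanSpace ℝ κ := WithLp.toLp 2 fun k => (ev z (D2 (d k))).re with hy2
  set T : ℂ →L[ℝ] EuclideanSpace ℝ κ :=
    Complex.reCLM.smulRight y1 + Complex.imCLM.smulRight y2 with hT
  have h1 : HasFDerivAt (fun z => fun k => (ev z (GG (d k))).re)
      (ContinuousLinearMap.pi fun k => Complex.reCLM.comp (rlin (ev z (D1 (d k))) (ev z (D2 (d k))))) z := by
    rw [hasFDerivAt_pi]
    intro k
    exact Complex.reCLM.hasFDerivAt.comp z (ev_GG_hasFDerivAt (d k) z)
  have h2 : HasFDerivAt (fun z => (WithLp.toLp 2 fun k => (ev z (GG (d k))).re : EuclideanSpace ℝ κ)) T z := by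
    have := ((EuclideanSpace.equiv κ ℝ).symm : (κ → ℝ) →L[ℝ] EuclideanSpace ℝ κ).hasFDerivAt.comp z h1
    refine HasFDerivAt.congr_fderiv this ?_
    ext ξ k
    simp [hT, rlin_apply, hy1, hy2]
  have h3 : HasFDerivAt (fun z => p + Φ.symm (WithLp.toLp 2 fun k => (ev z (GG (d k))).re))
      ((Φ.symm : EuclideanSpace ℝ κ →L[ℝ] Cn n).comp T) z :=
    ((Φ.symm : EuclideanSpace ℝ κ →L[ℝ] Cn n).hasFDerivAt.comp z h2).const_add p
  refine ⟨h3.differentiableAt, fun ξ => ?_⟩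
  rw [h3.fderiv]
  have hp := hpde z hz'
  set G := p + Φ.symm (WithLp.toLp 2 fun k => (ev z (GG (d k))).re) with hG
  have hp2 : Φ.symm y2 = J G (Φ.symm y1) := by
    have hp' : y2 = Φ (J G (Φ.symm y1)) := hp
    rw [hp', ContinuousLinearEquiv.symm_apply_apply]
  have hJJ : ∀ v, J G (J G v) = -v := fun v => by
    have := congrArg (fun T : Cn n →L[ℝ] Cn n => T v) (hJ.2 G (hΩ z hz'))
    simpa using this
  have hTa : ∀ ξ, Φ.symm (T ξ) = ξ.re • Φ.symm y1 + ξ.im • Φ.symm y2 := fun ξ => by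
    simp [hT]
  simp only [ContinuousLinearMap.comp_apply, ContinuousLinearEquiv.coe_coe, hTa, map_add, map_smul, hp2]
  rw [← hG, hJJ]
  simp
  abel

lemma local_disc (n : ℕ) (Ω : Set (Cn n)) (hΩ : IsOpen Ω)
    (J : Cn n → (Cn n →L[ℝ] Cn n)) (hJ : IsAlmostComplexOn n Ω J) (p : Cn n) (hp : p ∈ Ω) :
    ∃ η : ℝ, 0 < η ∧ ∀ (X Y : Cn n) (s : ℝ), 0 < s → s < 1 → ‖X - p‖ ≤ η → ‖Y - X‖ ≤ η * s →
      ∃ F : ℂ → Cn n, IsJHolomorphicOn n Ω J 1 F ∧ F 0 = X ∧ F (s : ℂ) = Y := by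
  set N := Module.finrank ℝ (Cn n) with hN
  let V := EuclideanSpace ℝ (Fin N)
  let Φ : Cn n ≃L[ℝ] V := toEuclidean
  let P : V → Cn n := fun y => p + Φ.symm y
  have hPc : ContDiff ℝ ∞ P := contDiff_const.add Φ.symm.contDiff
  have hP0 : P 0 = p := by simp [P]
  have hU : IsOpen (P ⁻¹' Ω) := hΩ.preimage hPc.continuous
  obtain ⟨R', hR', hball⟩ := Metric.isOpen_iff.1 hU 0 (by simpa [hP0] using hp)
  set R := R' / 2 with hRdef
  have hR : 0 < R := by positivity
  have hRb : closedBall (0:V) R ⊆ P ⁻¹' Ω :=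
    (closedBall_subset_ball (by rw [hRdef]; linarith)).trans hball
  let χ : ContDiffBump (0 : V) := ⟨R / 2, R, by positivity, by linarith⟩
  let S : V → (V →L[ℝ] V) := fun y => (Φ : Cn n →L[ℝ] V).comp ((J (P y)).comp (Φ.symm : V →L[ℝ] Cn n))
  have hSa : ∀ y u, S y u = Φ (J (P y) (Φ.symm u)) := fun y u => rfl
  have hSS : ∀ y, P y ∈ Ω → ∀ u, S y (S y u) = -u := by
    intro y hy u
    have := congrArg (fun T : Cn n →L[ℝ] Cn n => T (Φ.symm u)) (hJ.2 _ hy)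
    simp only [ContinuousLinearMap.comp_apply] at this
    rw [hSa, hSa, ContinuousLinearEquiv.symm_apply_apply, this]
    simp
  let a : Fin N → Fin N → V → ℝ := fun i j y => S y (EuclideanSpace.single j 1) i
  have haS : ∀ i j, ContDiffOn ℝ ∞ (a i j) (P ⁻¹' Ω) := by
    intro i j
    have h1 : ContDiffOn ℝ ∞ (fun y => J (P y)) (P ⁻¹' Ω) :=
      hJ.1.comp hPc.contDiffOn (fun y hy => hy)
    have h2 : ContDiffOn ℝ ∞ (fun y => J (P y) (Φ.symm (EuclideanSpace.single j 1))) (P ⁻¹' Ω) :=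
      h1.clm_apply contDiffOn_const
    exact ((EuclideanSpace.proj i : V →L[ℝ] ℝ).comp (Φ : Cn n →L[ℝ] V)).contDiff.comp_contDiffOn h2
  have hsm : ∀ i j, ContDiff ℝ ∞ (fun y : V => ((χ y * (a i j y - a i j 0) : ℝ) : ℂ)) := by
    intro i j
    refine Complex.ofRealCLM.contDiff.comp (contDiff_iff_contDiffAt.2 fun y => ?_)
    by_cases hy : y ∈ P ⁻¹' Ω
    · exact χ.contDiffAt.mul (((haS i j).contDiffAt (hU.mem_nhds hy)).sub contDiffAt_const)
    · have h1 : y ∉ tsupport χ := by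
        rw [χ.tsupport_eq]; exact fun h => hy (hRb h)
      refine (contDiffAt_const (c := (0:ℝ))).congr_of_eventuallyEq ?_
      filter_upwards [notMem_tsupport_iff_eventuallyEq.1 h1] with w hw
      rw [hw]; exact zero_mul _
  have hcs : ∀ i j, HasCompactSupport (fun y : V => ((χ y * (a i j y - a i j 0) : ℝ) : ℂ)) := by
    intro i j
    have h1 : HasCompactSupport (fun y : V => χ y * (a i j y - a i j 0)) :=
      HasCompactSupport.mul_right (f' := fun y : V => a i j y - a i j 0) χ.hasCompactSupport
    exact h1.comp_left (g := fun y : ℝ => (y : ℂ)) Complex.ofReal_zero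
  let φ : Fin N → Fin N → 𝓢(V, ℂ) := fun i j => (hcs i j).toSchwartzMap (hsm i j)
  have hφ : ∀ i j y, φ i j y = ((χ y * (a i j y - a i j 0) : ℝ) : ℂ) := fun i j y => rfl
  have hJ0 : ∀ i k, ∑ j, a i j 0 * a j k 0 = if i = k then -1 else 0 := by
    intro i k
    have h1 := euclid_mat (S 0) (S 0 (EuclideanSpace.single k 1)) i
    rw [hSS 0 (by rw [hP0]; exact hp)] at h1
    have h2 : ∑ j, a i j 0 * a j k 0 = (-(EuclideanSpace.single k (1:ℝ)) : V) i := h1.symm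
    rw [h2]
    simp only [PiLp.neg_apply, PiLp.single_apply]
    split_ifs <;> simp
  let E := ((EuclideanSpace.equiv (Fin N) ℝ).symm : (Fin N → ℝ) →L[ℝ] V)
  set ε := min 1 (R / (2 * (‖E‖ + 1))) with hεdef
  have hε0 : 0 < ε := by positivity
  have hεE : ‖E‖ * ε ≤ R / 2 := by
    have : ε ≤ R / (2 * (‖E‖ + 1)) := min_le_right _ _
    rw [le_div_iff₀ (by positivity)] at this
    nlinarith
  obtain ⟨η', hη'0, hη'⟩ := pde_solve (fun i j => a i j 0) hJ0 φ
    (fun i j => by rw [hφ]; simp) ε hε0 (min_le_left _ _)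
  let Φc : Cn n →L[ℝ] V := (Φ : Cn n →L[ℝ] V)
  refine ⟨η' / (4 * (‖Φc‖ + 1)), by positivity, fun X Y s hs0 hs1 hX hY => ?_⟩
  have hco : ∀ (u : V) i, ‖u i‖ ≤ ‖u‖ := fun u i => PiLp.norm_apply_le u i
  have hηΦ : 4 * (‖Φc‖ * (η' / (4 * (‖Φc‖ + 1)))) ≤ η' := by
    rw [mul_div_assoc', mul_div_assoc', div_le_iff₀ (by positivity)]
    nlinarith [norm_nonneg Φc]
  obtain ⟨d, hdε, hd0, hds, hdp⟩ := hη' (s / 4) (fun i => Φ (X - p) i) (fun i => Φ (Y - X) i / (s / 4))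
    (by positivity) (by linarith) (by
      rw [pi_norm_le_iff_of_nonneg hη'0.le]
      intro i
      refine (hco _ i).trans ((Φc.le_opNorm _).trans ?_)
      have : ‖Φc‖ * ‖X - p‖ ≤ ‖Φc‖ * (η' / (4 * (‖Φc‖ + 1))) := by gcongr
      have h0 : 0 ≤ ‖Φc‖ * (η' / (4 * (‖Φc‖ + 1))) := by positivity
      linarith) (by
      rw [pi_norm_le_iff_of_nonneg hη'0.le]
      intro i
      rw [norm_div, Real.norm_of_nonneg (show 0 ≤ s / 4 by positivity), div_le_iff₀ (by positivity)]
      refine (hco _ i).trans ((Φc.le_opNorm _).trans ?_)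
      have : ‖Φc‖ * ‖Y - X‖ ≤ ‖Φc‖ * (η' / (4 * (‖Φc‖ + 1)) * s) := by gcongr
      nlinarith)
  have hyb : ∀ z, ‖(WithLp.toLp 2 fun k => (ev z (GG (d k))).re : V)‖ ≤ R / 2 := by
    intro z
    have h1 : ‖fun k => (ev z (GG (d k))).re‖ ≤ ε := by
      rw [pi_norm_le_iff_of_nonneg hε0.le]
      intro k
      refine (Complex.abs_re_le_norm _).trans ((ev_norm_le z _).trans ((GG_norm_le _).trans ?_))
      exact (norm_le_pi_norm d k).trans hdε
    have h2 := E.le_opNorm (fun k => (ev z (GG (d k))).re)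
    refine le_trans h2 (le_trans ?_ hεE)
    gcongr
  have hg := disc_holo n Ω J Φ p hJ d (fun z _ => hRb (by
      rw [mem_closedBall_zero_iff]; exact (hyb z).trans (by linarith))) (by
    intro z hz
    set y : V := WithLp.toLp 2 fun k => (ev z (GG (d k))).re with hy
    have hχ : χ y = 1 := χ.one_of_mem_closedBall (by
      rw [mem_closedBall_zero_iff]; exact hyb z)
    ext i
    have h1 := euclid_mat (S y) (WithLp.toLp 2 fun k => (ev z (D1 (d k))).re) i
    refine Eq.trans ?_ h1.symm
    have h2 := congrArg Complex.re (hdp z hz i)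
    refine Eq.trans h2 ?_
    rw [Complex.re_sum]
    refine Finset.sum_congr rfl fun j _ => ?_
    rw [hφ, hχ, one_mul, ← Complex.ofReal_add, Complex.re_ofReal_mul]
    simp only [a]
    ring)
  refine ⟨_, holo_rescale n Ω J _ hg, ?_, ?_⟩
  · simp only [mul_zero, hd0, Complex.ofReal_re]
    have : (WithLp.toLp 2 fun k => Φ (X - p) k : V) = Φ (X - p) := rfl
    rw [this]; simp
  · have hs4 : (1 / 4 : ℂ) * (s : ℂ) = ((s / 4 : ℝ) : ℂ) := by push_cast; ring
    simp only [hs4, hds, Complex.ofReal_re]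
    have : (WithLp.toLp 2 fun k => Φ (X - p) k + s / 4 * (Φ (Y - X) k / (s / 4)) : V) = Φ (Y - p) := by
      have e : Y - p = (X - p) + (Y - X) := by abel
      rw [e, map_add]
      ext k
      field_simp
      rfl
    rw [this]; simp

end localdisc

/-! ### The final estimate -/

lemma poincareDist_zero_ofReal (x : ℝ) (hx : 0 ≤ x) : poincareDist 0 (x : ℂ) = arctanh x := by
  simp [poincareDist, abs_of_nonneg hx]

lemma hasDerivAt_arctanh_zero : HasDerivAt arctanh 1 0 := by
  have h1 : HasDerivAt (fun x : ℝ => 1 + x) 1 0 := (hasDerivAt_id 0).const_add 1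
  have h2 : HasDerivAt (fun x : ℝ => 1 - x) (-1) 0 := (hasDerivAt_id 0).const_sub 1
  have h3 := (h1.fun_div h2 (by norm_num)).log (by norm_num)
  have h4 := h3.const_mul (1 / 2 : ℝ)
  refine h4.congr_deriv ?_
  norm_num

lemma two_disc (n : ℕ) (Ω : Set (Cn n)) (J : Cn n → (Cn n →L[ℝ] Cn n)) (f F : ℂ → Cn n)
    (hf : IsJHolomorphicOn n Ω J 1 f) (hF : IsJHolomorphicOn n Ω J 1 F) (x s : ℝ)
    (hx : 0 ≤ x) (hx1 : x < 1) (hs : 0 ≤ s) (hs1 : s < 1) (h : f (x : ℂ) = F 0) :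
    kobayashiDist n Ω J (f 0) (F (s : ℂ)) ≤ ENNReal.ofReal (arctanh x + arctanh s) := by
  refine sInf_le ⟨1, ![0, 0], ![(x : ℂ), (s : ℂ)], ![f, F], ?_, rfl, ?_, rfl, ?_⟩
  · intro k
    fin_cases k
    · refine ⟨?_, ?_, hf⟩
      · simp
      · simpa [abs_of_nonneg hx] using hx1
    · refine ⟨?_, ?_, hF⟩
      · simp
      · simpa [abs_of_nonneg hs] using hs1
  · intro k
    fin_cases k
    exact h
  · rw [Fin.sum_univ_two]
    congr 1
    exact congrArg₂ (· + ·) (poincareDist_zero_ofReal x hx).symm (poincareDist_zero_ofReal s hs).symm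

/-- Rate of a function differentiable at `0` and vanishing there. -/
lemma arctanh_le_of_small (e : ℝ) (he : 0 < e) :
    ∀ᶠ x in 𝓝 (0 : ℝ), 0 ≤ x → arctanh x ≤ (1 + e) * x := by
  have h := hasDerivAt_arctanh_zero.isLittleO.def he
  filter_upwards [h] with x hx h0
  have h00 : arctanh 0 = 0 := by simp [arctanh]
  simp only [h00, sub_zero, smul_eq_mul, mul_one, Real.norm_eq_abs, abs_of_nonneg h0] at hx
  have := (abs_le.1 hx).2
  linarith

lemma limsup_step (n : ℕ) (Ω : Set (Cn n)) (hΩ : IsOpen Ω)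
    (J : Cn n → (Cn n →L[ℝ] Cn n)) (hJ : IsAlmostComplexOn n Ω J)
    (γ : ℝ → Cn n) (t : ℝ) (v : Cn n) (hγ : HasDerivAt γ v t) (hp : γ t ∈ Ω)
    (r : ℝ) (hr : 0 < r) (f : ℂ → Cn n) (hf : IsJHolomorphicOn n Ω J 1 f) (hf0 : f 0 = γ t)
    (hfd : fderiv ℝ f 0 1 = r • v) (e : ℝ) (he : 0 < e) :
    ∀ᶠ δ in 𝓝[>] (0 : ℝ), kobayashiDist n Ω J (γ t) (γ (t + δ)) ≤
      ENNReal.ofReal ((1 + e) * (1 / r + e) * δ) := by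
  obtain ⟨η, hη, H⟩ := local_disc n Ω hΩ J hJ (γ t) hp
  have hfdiff : DifferentiableAt ℝ f 0 := (hf.2 0 (by simp)).1
  -- the disc along the real axis
  have hg : HasDerivAt (fun δ : ℝ => f ((δ / r : ℝ) : ℂ)) v 0 := by
    have h1 : HasDerivAt (fun δ : ℝ => ((δ / r : ℝ) : ℂ)) ((1 / r : ℝ) : ℂ) 0 :=
      ((hasDerivAt_id (0 : ℝ)).div_const r).ofReal_comp
    have h2 : HasFDerivAt f (fderiv ℝ f 0) (((0 : ℝ) / r : ℝ) : ℂ) := by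
      simpa using hfdiff.hasFDerivAt
    have h3 := HasFDerivAt.comp_hasDerivAt (f := fun δ : ℝ => ((δ / r : ℝ) : ℂ)) (0 : ℝ) h2 h1
    refine h3.congr_deriv ?_
    have : ((1 / r : ℝ) : ℂ) = (1 / r : ℝ) • (1 : ℂ) := by simp
    rw [this, map_smul, hfd, smul_smul, one_div, inv_mul_cancel₀ hr.ne', one_smul]
  have hγ' : HasDerivAt (fun δ : ℝ => γ (t + δ)) v 0 := by
    have h1 : HasDerivAt γ v (t + 0) := by simpa using hγ
    exact h1.comp_const_add t 0
  have hd := (hγ'.sub hg).isLittleO.def (mul_pos hη he)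
  have hcont := hg.continuousAt
  have hc2 : ∀ᶠ δ in 𝓝 (0 : ℝ), ‖f ((δ / r : ℝ) : ℂ) - γ t‖ < η := by
    have := Metric.continuousAt_iff'.1 hcont η hη
    filter_upwards [this] with δ h
    simpa [dist_eq_norm, hf0] using h
  have t1 : Tendsto (fun δ : ℝ => δ / r) (𝓝 0) (𝓝 0) := by
    have : Continuous (fun δ : ℝ => δ / r) := by fun_prop
    simpa using this.tendsto 0
  have t2 : Tendsto (fun δ : ℝ => e * δ) (𝓝 0) (𝓝 0) := by
    have : Continuous (fun δ : ℝ => e * δ) := by fun_prop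
    simpa using this.tendsto 0
  have ha := arctanh_le_of_small e he
  have hlt : ∀ᶠ x in 𝓝 (0 : ℝ), x < 1 := eventually_lt_nhds one_pos
  filter_upwards [self_mem_nhdsWithin, nhdsWithin_le_nhds hd, nhdsWithin_le_nhds hc2,
    nhdsWithin_le_nhds (t1.eventually ha), nhdsWithin_le_nhds (t2.eventually ha),
    nhdsWithin_le_nhds (t1.eventually hlt), nhdsWithin_le_nhds (t2.eventually hlt)]
    with δ hδ hd hc2 a1 a2 l1 l2
  have hδ0 : 0 < δ := hδ
  have hx0 : 0 ≤ δ / r := by positivity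
  have hs0 : 0 < e * δ := by positivity
  have hd' : ‖γ (t + δ) - f ((δ / r : ℝ) : ℂ)‖ ≤ η * (e * δ) := by
    simp only [Pi.sub_apply, sub_zero, sub_self, smul_zero, add_zero, zero_div, Complex.ofReal_zero,
      hf0, Real.norm_eq_abs, abs_of_pos hδ0] at hd
    linarith
  obtain ⟨F, hF, hF0, hFs⟩ := H _ _ (e * δ) hs0 l2 hc2.le hd'
  have := two_disc n Ω J f F hf hF (δ / r) (e * δ) hx0 l1 hs0.le l2 hF0.symm
  rw [hf0, hFs] at this
  refine this.trans (ENNReal.ofReal_le_ofReal ?_)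
  have a1' := a1 hx0
  have a2' := a2 hs0.le
  have : (1 + e) * (1 / r + e) * δ = (1 + e) * (δ / r) + (1 + e) * (e * δ) := by ring
  linarith

/-- along a `C¹` path `γ`, the upper right derivative of the Kobayashi
pseudodistance is bounded by the Kobayashi–Royden pseudonorm of the velocity. -/
theorem limsup_kobayashiDist_le_kobayashiRoyden
    (n : ℕ) (hn : 1 ≤ n) (Ω : Set (Cn n)) (hΩ : IsOpen Ω) (hne : Ω.Nonempty)
    (J : Cn n → (Cn n →L[ℝ] Cn n)) (hJ : IsAlmostComplexOn n Ω J)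
    (a b : ℝ) (γ : ℝ → Cn n) (hγmaps : MapsTo γ (Ioo a b) Ω)
    (hγ : ContDiffOn ℝ 1 γ (Ioo a b)) (t : ℝ) (ht : t ∈ Ioo a b) :
    Filter.limsup
        (fun δ : ℝ => kobayashiDist n Ω J (γ t) (γ (t + δ)) / ENNReal.ofReal δ)
        (𝓝[>] (0:ℝ)) ≤
      kobayashiRoyden n Ω J (γ t) (deriv γ t) := by
  have hd : HasDerivAt γ (deriv γ t) t :=
    ((hγ.differentiableOn one_ne_zero).differentiableAt (isOpen_Ioo.mem_nhds ht)).hasDerivAt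
  refine le_sInf ?_
  rintro c ⟨r, hr, ⟨f, hf, hf0, hfd⟩, rfl⟩
  have key : ∀ e : ℝ, 0 < e → Filter.limsup
        (fun δ : ℝ => kobayashiDist n Ω J (γ t) (γ (t + δ)) / ENNReal.ofReal δ)
        (𝓝[>] (0:ℝ)) ≤ ENNReal.ofReal ((1 + e) * (1 / r + e)) := by
    intro e he
    refine Filter.limsup_le_of_le (by isBoundedDefault) ?_
    filter_upwards [self_mem_nhdsWithin, limsup_step n Ω hΩ J hJ γ t _ hd (hγmaps ht) r hr f hf hf0
      hfd e he] with δ hδ h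
    refine ENNReal.div_le_of_le_mul ?_
    rw [← ENNReal.ofReal_mul (by positivity)]
    exact h
  have hT : Tendsto (fun e : ℝ => ENNReal.ofReal ((1 + e) * (1 / r + e))) (𝓝[>] 0)
      (𝓝 (ENNReal.ofReal (1 / r))) := by
    have : Continuous (fun e : ℝ => ENNReal.ofReal ((1 + e) * (1 / r + e))) :=
      ENNReal.continuous_ofReal.comp (by fun_prop)
    have h := this.tendsto 0
    simp only [add_zero, one_mul] at h
    exact h.mono_left nhdsWithin_le_nhds
  refine ge_of_tendsto hT ?_
  filter_upwards [self_mem_nhdsWithin] with e he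
  exact key e he
end
end
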